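/- Consider the scalar Gaussian broadcast channel G-BC(P,N1,N2) with 0 < N1 ≤ N2: inputs X(t) ∈ ℝ, outputs Y_i(t) = X(t) + Z_i(t) where {Z_i(t)} are i.i.d. zero-mean Gaussian with variance N_i (i=1,2), independent of the input, and each length-n codeword x^n must satisfy Σ_{t=1}^n x(t)² ≤ nP. Then: (i) 𝒞₁(G-BC(P,N1,N2)) = 𝒞(G-BC(P,N1,N2)) = {(R1,R2) ∈ ℝ²₊ : ∃β ∈ [0,1], R1 ≤ (1/2)log₂((βP+N1)/N1) and R2 ≤ (1/2)log₂((P+N2)/(βP+N2))}; (ii) 𝒞₂(G-BC(P,N1,N2)) = {(R1,R2) ∈ ℝ²₊ : R2 ≤ (1/2)log₂((P+N2)/N2) and R1+R2 ≤ (1/2)log₂((P+N1)/N1)}. -/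

import Mathlib

open scoped BigOperators Classical ENNReal NNReal
open Finset MeasureTheory ProbabilityTheory

noncomputable section

/-- `n` i.i.d. samples of zero-mean Gaussian noise of variance `N`. -/
def gaussVec (N : ℝ≥0) (n : ℕ) : Measure (Fin n → ℝ) :=
  Measure.pi fun _ : Fin n => gaussianReal 0 N

/-- Average error probability over the Gaussian broadcast channel with noise
variances `N1, N2`; message `M2` known at receiver 1. -/
def gErrP1 (N1 N2 : ℝ≥0) (n k1 k2 : ℕ) (f : Fin k1 × Fin k2 → Fin n → ℝ)
    (g1 : (Fin n → ℝ) × Fin k2 → Fin k1) (g2 : (Fin n → ℝ) → Fin k2) : ℝ :=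
  (1 : ℝ) / ((k1 : ℝ) * (k2 : ℝ)) * ∑ m : Fin k1 × Fin k2,
    (((gaussVec N1 n).prod (gaussVec N2 n))
      {z : (Fin n → ℝ) × (Fin n → ℝ) |
        ¬ (g1 (fun t => f m t + z.1 t, m.2) = m.1 ∧
           g2 (fun t => f m t + z.2 t) = m.2)}).toReal

/-- Same, with message `M1` known at receiver 2. -/
def gErrP2 (N1 N2 : ℝ≥0) (n k1 k2 : ℕ) (f : Fin k1 × Fin k2 → Fin n → ℝ)
    (g1 : (Fin n → ℝ) → Fin k1) (g2 : (Fin n → ℝ) × Fin k1 → Fin k2) : ℝ :=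
  (1 : ℝ) / ((k1 : ℝ) * (k2 : ℝ)) * ∑ m : Fin k1 × Fin k2,
    (((gaussVec N1 n).prod (gaussVec N2 n))
      {z : (Fin n → ℝ) × (Fin n → ℝ) |
        ¬ (g1 (fun t => f m t + z.1 t) = m.1 ∧
           g2 ((fun t => f m t + z.2 t), m.1) = m.2)}).toReal

/-- Same, with no receiver side information. -/
def gErrP0 (N1 N2 : ℝ≥0) (n k1 k2 : ℕ) (f : Fin k1 × Fin k2 → Fin n → ℝ)
    (g1 : (Fin n → ℝ) → Fin k1) (g2 : (Fin n → ℝ) → Fin k2) : ℝ :=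
  (1 : ℝ) / ((k1 : ℝ) * (k2 : ℝ)) * ∑ m : Fin k1 × Fin k2,
    (((gaussVec N1 n).prod (gaussVec N2 n))
      {z : (Fin n → ℝ) × (Fin n → ℝ) |
        ¬ (g1 (fun t => f m t + z.1 t) = m.1 ∧
           g2 (fun t => f m t + z.2 t) = m.2)}).toReal

/-- Achievability over `G-BC(P,N1,N2)` with `M2` available at receiver 1. -/
def gAch1 (P : ℝ) (N1 N2 : ℝ≥0) (R : ℝ × ℝ) : Prop :=
  0 ≤ R.1 ∧ 0 ≤ R.2 ∧ ∀ ε : ℝ, 0 < ε →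
    ∃ (n k1 k2 : ℕ), 0 < n ∧ 0 < k1 ∧ 0 < k2 ∧
      ∃ (f : Fin k1 × Fin k2 → Fin n → ℝ) (g1 : (Fin n → ℝ) × Fin k2 → Fin k1)
        (g2 : (Fin n → ℝ) → Fin k2),
        (∀ m, ∑ t, (f m t) ^ 2 ≤ (n : ℝ) * P) ∧
        R.1 ≤ Real.logb 2 (k1 : ℝ) / (n : ℝ) ∧ R.2 ≤ Real.logb 2 (k2 : ℝ) / (n : ℝ) ∧
        gErrP1 N1 N2 n k1 k2 f g1 g2 ≤ ε

/-- Achievability over `G-BC(P,N1,N2)` with `M1` available at receiver 2. -/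
def gAch2 (P : ℝ) (N1 N2 : ℝ≥0) (R : ℝ × ℝ) : Prop :=
  0 ≤ R.1 ∧ 0 ≤ R.2 ∧ ∀ ε : ℝ, 0 < ε →
    ∃ (n k1 k2 : ℕ), 0 < n ∧ 0 < k1 ∧ 0 < k2 ∧
      ∃ (f : Fin k1 × Fin k2 → Fin n → ℝ) (g1 : (Fin n → ℝ) → Fin k1)
        (g2 : (Fin n → ℝ) × Fin k1 → Fin k2),
        (∀ m, ∑ t, (f m t) ^ 2 ≤ (n : ℝ) * P) ∧
        R.1 ≤ Real.logb 2 (k1 : ℝ) / (n : ℝ) ∧ R.2 ≤ Real.logb 2 (k2 : ℝ) / (n : ℝ) ∧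
        gErrP2 N1 N2 n k1 k2 f g1 g2 ≤ ε

/-- Achievability over `G-BC(P,N1,N2)` with no receiver side information. -/
def gAch0 (P : ℝ) (N1 N2 : ℝ≥0) (R : ℝ × ℝ) : Prop :=
  0 ≤ R.1 ∧ 0 ≤ R.2 ∧ ∀ ε : ℝ, 0 < ε →
    ∃ (n k1 k2 : ℕ), 0 < n ∧ 0 < k1 ∧ 0 < k2 ∧
      ∃ (f : Fin k1 × Fin k2 → Fin n → ℝ) (g1 : (Fin n → ℝ) → Fin k1)
        (g2 : (Fin n → ℝ) → Fin k2),
        (∀ m, ∑ t, (f m t) ^ 2 ≤ (n : ℝ) * P) ∧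
        R.1 ≤ Real.logb 2 (k1 : ℝ) / (n : ℝ) ∧ R.2 ≤ Real.logb 2 (k2 : ℝ) / (n : ℝ) ∧
        gErrP0 N1 N2 n k1 k2 f g1 g2 ≤ ε

/-- Capacity region `𝒞₁(G-BC(P,N1,N2))`. -/
def gCap1 (P : ℝ) (N1 N2 : ℝ≥0) : Set (ℝ × ℝ) := closure {R | gAch1 P N1 N2 R}

/-- Capacity region `𝒞₂(G-BC(P,N1,N2))`. -/
def gCap2 (P : ℝ) (N1 N2 : ℝ≥0) : Set (ℝ × ℝ) := closure {R | gAch2 P N1 N2 R}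

/-- Private-message capacity region `𝒞(G-BC(P,N1,N2))`. -/
def gCap (P : ℝ) (N1 N2 : ℝ≥0) : Set (ℝ × ℝ) := closure {R | gAch0 P N1 N2 R}

/-- Gaussian density in `n` dimensions. -/
def gd (N : ℝ≥0) (n : ℕ) (z : Fin n → ℝ) : ℝ := ∏ t, gaussianPDFReal 0 N (z t)

instance instProbGaussVec (N : ℝ≥0) (n : ℕ) : IsProbabilityMeasure (gaussVec N n) := by
  unfold gaussVec; infer_instance

lemma gd_pos {N : ℝ≥0} (hN : N ≠ 0) (n : ℕ) (z : Fin n → ℝ) : 0 < gd N n z :=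
  Finset.prod_pos fun t _ => gaussianPDFReal_pos 0 N (z t) hN

lemma measurable_gd (N : ℝ≥0) (n : ℕ) : Measurable (gd N n) := by
  unfold gd
  exact Finset.measurable_prod _ fun t _ =>
    (measurable_gaussianPDFReal 0 N).comp (measurable_pi_apply t)

lemma gaussVec_eq {N : ℝ≥0} (hN : N ≠ 0) (n : ℕ) :
    gaussVec N n = (volume : Measure (Fin n → ℝ)).withDensity
      (fun z => ENNReal.ofReal (gd N n z)) := by
  unfold gaussVec
  refine Measure.pi_eq fun s hs => ?_
  have hms : MeasurableSet (Set.univ.pi s) := MeasurableSet.univ_pi hs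
  rw [withDensity_apply _ hms, ← lintegral_indicator hms]
  have hInteg : ∀ i, Integrable ((s i).indicator (gaussianPDFReal 0 N)) volume := fun i =>
    (integrable_gaussianPDFReal 0 N).indicator (hs i)
  have key : ∀ z : Fin n → ℝ, (Set.univ.pi s).indicator (fun z => ENNReal.ofReal (gd N n z)) z
      = ENNReal.ofReal (∏ i, (s i).indicator (gaussianPDFReal 0 N) (z i)) := by
    intro z
    by_cases hz : z ∈ Set.univ.pi s
    · rw [Set.indicator_of_mem hz]
      congr 1
      refine Finset.prod_congr rfl fun i _ => ?_
      rw [Set.indicator_of_mem (hz i (Set.mem_univ i))]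
    · rw [Set.indicator_of_notMem hz]
      have : ∃ i, z i ∉ s i := by
        by_contra hcon
        push Not at hcon
        exact hz fun i _ => hcon i
      obtain ⟨i, hi⟩ := this
      rw [Finset.prod_eq_zero (Finset.mem_univ i) (Set.indicator_of_notMem hi _)]
      simp
  simp_rw [key]
  rw [← ofReal_integral_eq_lintegral_ofReal]
  · rw [integral_fintype_prod_volume_eq_prod (fun i => (s i).indicator (gaussianPDFReal 0 N)),
      ENNReal.ofReal_prod_of_nonneg]
    · refine Finset.prod_congr rfl fun i _ => ?_
      rw [integral_indicator (hs i), gaussianReal_apply_eq_integral 0 hN]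
    · intro i _
      exact integral_nonneg fun x => Set.indicator_nonneg (fun _ _ => gaussianPDFReal_nonneg _ _ _) _
  · exact Integrable.fintype_prod (f := fun i => (s i).indicator (gaussianPDFReal 0 N)) hInteg
  · exact Filter.Eventually.of_forall fun z => Finset.prod_nonneg fun i _ =>
      Set.indicator_nonneg (fun _ _ => gaussianPDFReal_nonneg _ _ _) _

lemma lintegral_gaussVec {N : ℝ≥0} (hN : N ≠ 0) (n : ℕ) (f : (Fin n → ℝ) → ℝ≥0∞)
    (hf : Measurable f) :
    ∫⁻ z, f z ∂gaussVec N n = ∫⁻ z, ENNReal.ofReal (gd N n z) * f z := by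
  rw [gaussVec_eq hN, lintegral_withDensity_eq_lintegral_mul _
    (measurable_gd N n).ennreal_ofReal hf]
  rfl

lemma gaussVec_add (a b : ℝ≥0) (n : ℕ) :
    ((gaussVec a n).prod (gaussVec b n)).map (fun p => p.1 + p.2) = gaussVec (a + b) n := by
  have h1 := (measurePreserving_arrowProdEquivProdArrow ℝ ℝ (Fin n)
    (fun _ => gaussianReal 0 a) (fun _ => gaussianReal 0 b)).map_eq
  unfold gaussVec
  rw [← h1, Measure.map_map (by fun_prop) (MeasurableEquiv.measurable _)]
  have h2 : ((fun p : (Fin n → ℝ) × (Fin n → ℝ) => p.1 + p.2) ∘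
      (MeasurableEquiv.arrowProdEquivProdArrow ℝ ℝ (Fin n)))
      = fun x i => (x i).1 + (x i).2 := by
    rfl
  rw [h2, Measure.pi_map_pi (f := fun _ (x : ℝ × ℝ) => x.1 + x.2)
    (fun i => (by fun_prop : Measurable fun x : ℝ × ℝ => x.1 + x.2).aemeasurable)]
  congr 1
  funext i
  have := gaussianReal_conv_gaussianReal (m₁ := 0) (m₂ := 0) (v₁ := a) (v₂ := b)
  rw [add_zero] at this
  exact this

/-- Jensen for the exponential, in `ℝ≥0∞` form. -/
lemma jensen_exp {α : Type*} [MeasurableSpace α] (μ : Measure α) [IsProbabilityMeasure μ]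
    {h : α → ℝ} (hh : Integrable h μ) :
    ENNReal.ofReal (Real.exp (∫ x, h x ∂μ)) ≤ ∫⁻ x, ENNReal.ofReal (Real.exp (h x)) ∂μ := by
  by_cases hi : Integrable (fun x => Real.exp (h x)) μ
  · rw [← ofReal_integral_eq_lintegral_ofReal hi
      (Filter.Eventually.of_forall fun x => (Real.exp_pos _).le)]
    apply ENNReal.ofReal_le_ofReal
    exact convexOn_exp.map_integral_le Real.continuous_exp.continuousOn isClosed_univ
      (Filter.Eventually.of_forall fun x => Set.mem_univ _) hh hi
  · have : ∫⁻ x, ENNReal.ofReal (Real.exp (h x)) ∂μ = ∞ := by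
      by_contra hne
      apply hi
      refine ⟨Real.continuous_exp.comp_aestronglyMeasurable hh.1, ?_⟩
      rw [hasFiniteIntegral_iff_ofReal (Filter.Eventually.of_forall fun x => (Real.exp_pos _).le)]
      exact lt_top_iff_ne_top.mpr hne
    rw [this]; exact le_top

lemma integrable_id_gr (N : ℝ≥0) : Integrable (fun x : ℝ => x) (gaussianReal 0 N) :=
  (memLp_id_gaussianReal (μ := 0) (v := N) 1).integrable (by simp)

lemma integrable_sq_gr (N : ℝ≥0) : Integrable (fun x : ℝ => x ^ 2) (gaussianReal 0 N) :=
  (memLp_id_gaussianReal (μ := 0) (v := N) 2).integrable_sq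

lemma integral_sq_gr (N : ℝ≥0) : ∫ x, x ^ 2 ∂(gaussianReal 0 N) = N := by
  have h := variance_fun_id_gaussianReal (μ := 0) (v := N)
  rw [variance_eq_integral (by fun_prop)] at h
  simpa using h

lemma mp_eval (N : ℝ≥0) (n : ℕ) (t : Fin n) :
    MeasurePreserving (Function.eval t) (gaussVec N n) (gaussianReal 0 N) :=
  measurePreserving_eval (fun _ : Fin n => gaussianReal 0 N) t

lemma integrable_eval_gv (N : ℝ≥0) (n : ℕ) (t : Fin n) {f : ℝ → ℝ}
    (hf : Integrable f (gaussianReal 0 N)) : Integrable (fun z => f (z t)) (gaussVec N n) :=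
  (mp_eval N n t).integrable_comp_of_integrable hf

lemma integral_eval_gv (N : ℝ≥0) (n : ℕ) (t : Fin n) {f : ℝ → ℝ}
    (hf : Measurable f) : ∫ z, f (z t) ∂(gaussVec N n) = ∫ x, f x ∂(gaussianReal 0 N) := by
  rw [← (mp_eval N n t).map_eq, integral_map (mp_eval N n t).measurable.aemeasurable
    hf.aestronglyMeasurable]

lemma integrable_shift_sq_one (N : ℝ≥0) (x : ℝ) :
    Integrable (fun z : ℝ => (x + z) ^ 2) (gaussianReal 0 N) := by
  have : (fun z : ℝ => (x + z) ^ 2) = fun z => x ^ 2 + 2 * x * z + z ^ 2 := by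
    funext z; ring
  rw [this]
  exact ((integrable_const _).add ((integrable_id_gr N).const_mul _)).add (integrable_sq_gr N)

lemma integral_shift_sq_one (N : ℝ≥0) (x : ℝ) :
    ∫ z, (x + z) ^ 2 ∂(gaussianReal 0 N) = x ^ 2 + N := by
  have : (fun z : ℝ => (x + z) ^ 2) = fun z => (x ^ 2 + 2 * x * z) + z ^ 2 := by
    funext z; ring
  rw [this, integral_add, integral_add, integral_sq_gr, integral_const_mul,
    integral_id_gaussianReal]
  · simp
  · exact integrable_const _
  · exact (integrable_id_gr N).const_mul _
  · exact (integrable_const _).add ((integrable_id_gr N).const_mul _)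
  · exact integrable_sq_gr N

lemma integrable_shift_sq (N : ℝ≥0) (n : ℕ) (x : Fin n → ℝ) :
    Integrable (fun z : Fin n → ℝ => ∑ t, (x + z) t ^ 2) (gaussVec N n) := by
  refine integrable_finsetSum _ fun t _ => ?_
  exact integrable_eval_gv N n t (integrable_shift_sq_one N (x t))

lemma integral_shift_sq (N : ℝ≥0) (n : ℕ) (x : Fin n → ℝ) :
    ∫ z, ∑ t, (x + z) t ^ 2 ∂(gaussVec N n) = ∑ t, x t ^ 2 + n * N := by
  rw [integral_finsetSum]
  · have : ∀ t : Fin n, ∫ z, (x + z) t ^ 2 ∂(gaussVec N n) = x t ^ 2 + N := by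
      intro t
      have h := integral_eval_gv N n t (f := fun z => (x t + z) ^ 2) (by fun_prop)
      rw [integral_shift_sq_one] at h
      exact h
    simp_rw [this]
    rw [Finset.sum_add_distrib]; simp
  · intro t _
    exact integrable_eval_gv N n t (integrable_shift_sq_one N (x t))

/-- Measurable functions of at most quadratic growth. -/
def QB {n : ℕ} (h : (Fin n → ℝ) → ℝ) : Prop :=
  Measurable h ∧ ∃ A B : ℝ, 0 ≤ A ∧ 0 ≤ B ∧ ∀ y, |h y| ≤ A + B * ∑ t, y t ^ 2

/-- Gaussian smoothing. -/
def cv {n : ℕ} (N : ℝ≥0) (h : (Fin n → ℝ) → ℝ) (x : Fin n → ℝ) : ℝ :=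
  ∫ z, h (x + z) ∂(gaussVec N n)

lemma QB.integrable {n : ℕ} {h : (Fin n → ℝ) → ℝ} (hh : QB h) (N : ℝ≥0) (x : Fin n → ℝ) :
    Integrable (fun z => h (x + z)) (gaussVec N n) := by
  obtain ⟨hm, A, B, hA, hB, hb⟩ := hh
  refine Integrable.mono' (g := fun z => A + B * ∑ t, (x + z) t ^ 2)
    ((integrable_const _).add ((integrable_shift_sq N n x).const_mul B))
    (hm.comp (by fun_prop : Measurable fun z => x + z)).aestronglyMeasurable
    (Filter.Eventually.of_forall fun z => ?_)
  exact hb _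

lemma cv_le {n : ℕ} {h : (Fin n → ℝ) → ℝ} (hh : QB h) (N : ℝ≥0) {A B : ℝ}
    (hb : ∀ y, h y ≤ A + B * ∑ t, y t ^ 2) (x : Fin n → ℝ) :
    cv N h x ≤ (A + B * (n * N)) + B * ∑ t, x t ^ 2 := by
  unfold cv
  calc _ ≤ ∫ z, (A + B * ∑ t, (x + z) t ^ 2) ∂(gaussVec N n) :=
        integral_mono (hh.integrable N x)
          ((integrable_const _).add ((integrable_shift_sq N n x).const_mul B)) fun z => hb _
    _ = _ := by
        rw [integral_add (integrable_const _) ((integrable_shift_sq N n x).const_mul B),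
          integral_const_mul, integral_shift_sq]
        simp; ring

lemma QB.neg {n : ℕ} {h : (Fin n → ℝ) → ℝ} (hh : QB h) : QB (fun y => - h y) := by
  obtain ⟨hm, A, B, hA, hB, hb⟩ := hh
  exact ⟨hm.neg, A, B, hA, hB, fun y => by rw [abs_neg]; exact hb y⟩

lemma QB.add {n : ℕ} {h k : (Fin n → ℝ) → ℝ} (hh : QB h) (hk : QB k) :
    QB (fun y => h y + k y) := by
  obtain ⟨hm, A, B, hA, hB, hb⟩ := hh
  obtain ⟨hm', A', B', hA', hB', hb'⟩ := hk
  refine ⟨hm.add hm', A + A', B + B', by positivity, by positivity, fun y => ?_⟩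
  have := abs_add_le (h y) (k y)
  have := hb y
  have := hb' y
  nlinarith

lemma QB.const_mul {n : ℕ} {h : (Fin n → ℝ) → ℝ} (hh : QB h) (c : ℝ) :
    QB (fun y => c * h y) := by
  obtain ⟨hm, A, B, hA, hB, hb⟩ := hh
  refine ⟨hm.const_mul c, |c| * A, |c| * B, by positivity, by positivity, fun y => ?_⟩
  rw [abs_mul]
  have := mul_le_mul_of_nonneg_left (hb y) (abs_nonneg c)
  nlinarith

lemma QB.of_bdd {n : ℕ} {h : (Fin n → ℝ) → ℝ} (hm : Measurable h) {A : ℝ}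
    (hA : ∀ y, |h y| ≤ A) : QB h :=
  ⟨hm, A, 0, (abs_nonneg _).trans (hA 0), le_rfl, fun y => by simpa using hA y⟩

lemma QB.shift {n : ℕ} {h : (Fin n → ℝ) → ℝ} (hh : QB h) (x : Fin n → ℝ) :
    QB (fun y => h (y + x)) := by
  obtain ⟨hm, A, B, hA, hB, hb⟩ := hh
  refine ⟨hm.comp (by fun_prop), A + B * (2 * ∑ t, x t ^ 2), 2 * B,
    by positivity, by positivity, fun y => ?_⟩
  have h1 := hb (y + x)
  have h2 : ∑ t, (y + x) t ^ 2 ≤ 2 * ∑ t, y t ^ 2 + 2 * ∑ t, x t ^ 2 := by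
    rw [Finset.mul_sum, Finset.mul_sum, ← Finset.sum_add_distrib]
    refine Finset.sum_le_sum fun t _ => ?_
    simp only [Pi.add_apply]
    nlinarith [sq_nonneg (y t - x t)]
  have := mul_le_mul_of_nonneg_left h2 hB
  nlinarith

lemma QB.cv {n : ℕ} {h : (Fin n → ℝ) → ℝ} (hh : QB h) (N : ℝ≥0) : QB (cv N h) := by
  have hh' := hh
  obtain ⟨hm, A, B, hA, hB, hb⟩ := hh
  refine ⟨?_, A + B * (n * N), B, by positivity, hB, fun x => ?_⟩
  · have : StronglyMeasurable (Function.uncurry fun (x z : Fin n → ℝ) => h (x + z)) :=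
      (hm.comp (by fun_prop : Measurable fun p : (Fin n → ℝ) × (Fin n → ℝ) => p.1 + p.2)).stronglyMeasurable
    exact (this.integral_prod_right (ν := gaussVec N n)).measurable
  · have h1 := cv_le hh' N (fun y => (le_abs_self _).trans (hb y)) x
    have h2 := cv_le hh'.neg N (fun y => (neg_le_abs _).trans (hb y)) x
    have h3 : _root_.cv N (fun y => - h y) x = - _root_.cv N h x := by
      unfold _root_.cv; rw [integral_neg]
    rw [h3] at h2
    rw [abs_le]; constructor <;> linarith

lemma cv_cv {n : ℕ} {h : (Fin n → ℝ) → ℝ} (hh : QB h) (a b : ℝ≥0) (x : Fin n → ℝ) :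
    cv a (cv b h) x = cv (a + b) h x := by
  unfold cv
  have hm : Measurable fun z => h (x + z) := hh.1.comp (by fun_prop : Measurable fun z => x + z)
  rw [← gaussVec_add, integral_map (by fun_prop) hm.aestronglyMeasurable]
  rw [integral_prod]
  · simp_rw [add_assoc]
  · have h1 := hh.integrable (a + b) x
    rw [← gaussVec_add] at h1
    exact h1.comp_measurable (by fun_prop)

lemma cv_add {n : ℕ} {h k : (Fin n → ℝ) → ℝ} (hh : QB h) (hk : QB k) (a : ℝ≥0) (x : Fin n → ℝ) :
    cv a (fun y => h y + k y) x = cv a h x + cv a k x :=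
  integral_add (hh.integrable a x) (hk.integrable a x)

lemma cv_const_mul {n : ℕ} (h : (Fin n → ℝ) → ℝ) (a : ℝ≥0) (c : ℝ) (x : Fin n → ℝ) :
    cv a (fun y => c * h y) x = c * cv a h x :=
  integral_const_mul _ _

lemma log_pdf {N : ℝ≥0} (hN : N ≠ 0) (z : ℝ) : Real.log (gaussianPDFReal 0 N z)
    = - (1/2) * Real.log (2 * Real.pi * N) - z ^ 2 / (2 * N) := by
  have hN' : (0:ℝ) < N := by positivity
  unfold gaussianPDFReal
  rw [Real.log_mul (by positivity) (Real.exp_pos _).ne', Real.log_exp, Real.log_inv,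
    Real.log_sqrt (by positivity)]
  rw [sub_zero]; ring

lemma log_gd {N : ℝ≥0} (hN : N ≠ 0) (n : ℕ) (z : Fin n → ℝ) : Real.log (gd N n z)
    = - (n/2) * Real.log (2 * Real.pi * N) + (- (1 / (2 * N))) * ∑ t, z t ^ 2 := by
  unfold gd
  rw [Real.log_prod (fun t _ => (gaussianPDFReal_pos 0 N _ hN).ne')]
  simp_rw [log_pdf hN]
  rw [Finset.sum_sub_distrib, ← Finset.sum_div]
  simp; ring

lemma QB_log_gd {N : ℝ≥0} (hN : N ≠ 0) (n : ℕ) : QB (fun z => Real.log (gd N n z)) := by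
  refine ⟨(Real.measurable_log.comp (measurable_gd N n)), |- (n/2) * Real.log (2 * Real.pi * N)|,
    1 / (2 * N), by positivity, by positivity, fun y => ?_⟩
  simp only [log_gd hN]
  refine (abs_add_le _ _).trans ?_
  gcongr
  rw [neg_mul, abs_neg, abs_of_nonneg]
  positivity

lemma cv_log_gd {N : ℝ≥0} (hN : N ≠ 0) (a : ℝ≥0) (n : ℕ) (x : Fin n → ℝ) :
    cv a (fun z => Real.log (gd N n z)) x = - (n/2) * Real.log (2 * Real.pi * N)
      - (∑ t, x t ^ 2 + n * a) / (2 * N) := by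
  unfold cv
  simp_rw [log_gd hN]
  rw [integral_add (integrable_const _) ((integrable_shift_sq a n x).const_mul _),
    integral_const_mul (- (1 / (2 * (N:ℝ)))), integral_shift_sq]
  simp; ring

lemma cdf_facts (p : ℝ → ℝ) (hc : Continuous p) (hp : ∀ x, 0 < p x) (hi : Integrable p volume)
    (h1 : ∫ x, p x = 1) :
    ∃ F : ℝ → ℝ, (∀ x, HasDerivAt F (p x) x) ∧ StrictMono F ∧ Set.range F = Set.Ioo 0 1 := by
  set c : ℝ := ∫ x in Set.Iic 0, p x with hcdef
  let F : ℝ → ℝ := fun x => c + ∫ y in (0:ℝ)..x, p y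
  have hd : ∀ x, HasDerivAt F (p x) x := fun x =>
    (intervalIntegral.integral_hasDerivAt_right (hc.intervalIntegrable _ _)
      (hc.stronglyMeasurableAtFilter _ _) hc.continuousAt).const_add c
  have hm : StrictMono F := strictMono_of_deriv_pos fun x => by rw [(hd x).deriv]; exact hp x
  have hcont : Continuous F := continuous_iff_continuousAt.mpr fun x => (hd x).continuousAt
  have ht : Filter.Tendsto F Filter.atTop (nhds 1) := by
    have h2 := (intervalIntegral_tendsto_integral_Ioi 0 hi.integrableOn
      (Filter.tendsto_id (α := ℝ) (x := Filter.atTop))).const_add c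
    rw [hcdef, intervalIntegral.integral_Iic_add_Ioi hi.integrableOn hi.integrableOn, h1] at h2
    exact h2
  have hb : Filter.Tendsto F Filter.atBot (nhds 0) := by
    have h2 := (intervalIntegral_tendsto_integral_Iic 0 hi.integrableOn
      (Filter.tendsto_id (α := ℝ) (x := Filter.atBot))).const_sub c
    rw [← hcdef, sub_self] at h2
    refine h2.congr fun x => ?_
    simp only [F, id]
    rw [intervalIntegral.integral_symm]; ring
  refine ⟨F, hd, hm, ?_⟩
  ext u
  constructor
  · rintro ⟨x, rfl⟩
    constructor
    · have : 0 ≤ F (x - 1) := le_of_tendsto hb ((Filter.eventually_le_atBot (x - 1)).mono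
        fun y hy => hm.monotone hy)
      exact this.trans_lt (hm (by linarith))
    · have : F (x + 1) ≤ 1 := ge_of_tendsto ht ((Filter.eventually_ge_atTop (x + 1)).mono
        fun y hy => hm.monotone hy)
      exact (hm (by linarith)).trans_le this
  · rintro ⟨h0, h1⟩
    refine mem_range_of_exists_le_of_exists_ge hcont ?_ ?_
    · obtain ⟨a, ha⟩ := (hb.eventually (gt_mem_nhds h0)).exists
      exact ⟨a, ha.le⟩
    · obtain ⟨a, ha⟩ := (ht.eventually (lt_mem_nhds h1)).exists
      exact ⟨a, ha.le⟩

/-- Monotone transport between two continuous positive densities on the line. -/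
lemma transport (p q : ℝ → ℝ) (hpc : Continuous p) (hp : ∀ x, 0 < p x) (hpi : Integrable p volume)
    (hp1 : ∫ x, p x = 1) (hqc : Continuous q) (hq : ∀ x, 0 < q x) (hqi : Integrable q volume)
    (hq1 : ∫ x, q x = 1) :
    ∃ T : ℝ → ℝ, (∀ x, HasDerivAt T (q x / p (T x)) x) ∧ StrictMono T ∧ Function.Surjective T := by
  obtain ⟨F, hF, hFm, hFr⟩ := cdf_facts p hpc hp hpi hp1
  obtain ⟨H, hH, hHm, hHr⟩ := cdf_facts q hqc hq hqi hq1
  have hex : ∀ u : ℝ, ∃ y, u ∈ Set.Ioo (0:ℝ) 1 → F y = u := by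
    intro u
    by_cases hu : u ∈ Set.Ioo (0:ℝ) 1
    · have : u ∈ Set.range F := by rw [hFr]; exact hu
      obtain ⟨y, hy⟩ := this
      exact ⟨y, fun _ => hy⟩
    · exact ⟨0, fun h => absurd h hu⟩
  choose G hG using hex
  have hFmem : ∀ y, F y ∈ Set.Ioo (0:ℝ) 1 := fun y => hFr ▸ Set.mem_range_self y
  have hHmem : ∀ y, H y ∈ Set.Ioo (0:ℝ) 1 := fun y => hHr ▸ Set.mem_range_self y
  have hGF : ∀ y, G (F y) = y := fun y => hFm.injective (hG _ (hFmem y))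
  have hGm : StrictMonoOn G (Set.Ioo 0 1) := by
    intro u hu w hw huw
    rw [← hFm.lt_iff_lt, hG u hu, hG w hw]; exact huw
  have himg : G '' Set.Ioo 0 1 = Set.univ := by
    rw [Set.eq_univ_iff_forall]
    exact fun y => ⟨F y, hFmem y, hGF y⟩
  have hGd : ∀ u ∈ Set.Ioo (0:ℝ) 1, HasDerivAt G (p (G u))⁻¹ u := by
    intro u hu
    have hn : Set.Ioo (0:ℝ) 1 ∈ nhds u := isOpen_Ioo.mem_nhds hu
    refine HasDerivAt.of_local_left_inverse
      (hGm.continuousAt_of_image_mem_nhds hn (by rw [himg]; exact Filter.univ_mem))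
      (hF (G u)) (hp _).ne' ?_
    filter_upwards [hn] with y hy using hG y hy
  refine ⟨fun x => G (H x), fun x => ?_, fun x y hxy => hGm (hHmem x) (hHmem y) (hHm hxy), ?_⟩
  · have := (hGd (H x) (hHmem x)).comp x (hH x)
    rw [div_eq_inv_mul]
    exact this
  · intro y
    have : F y ∈ Set.range H := by rw [hHr]; exact hFmem y
    obtain ⟨x, hx⟩ := this
    exact ⟨x, by simp only [hx]; exact hGF y⟩

/-- Change of variables for nonnegative functions. -/
lemma lintegral_cov (T T' : ℝ → ℝ) (hT : ∀ x, HasDerivAt T (T' x) x) (hp : ∀ x, 0 ≤ T' x)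
    (hm : Function.Injective T) (f : ℝ → ℝ≥0∞) :
    ∫⁻ x, ENNReal.ofReal (T' x) * f (T x) ≤ ∫⁻ y, f y := by
  have h := lintegral_image_eq_lintegral_abs_deriv_mul (s := Set.univ) (f := T) (f' := T')
    MeasurableSet.univ (fun x _ => (hT x).hasDerivWithinAt) hm.injOn f
  rw [Measure.restrict_univ] at h
  simp_rw [abs_of_nonneg (hp _)] at h
  rw [← h]
  exact setLIntegral_le_lintegral _ _

/-- Product decomposition of Gaussian densities. -/
lemma pdf_mul_pdf {a b : ℝ≥0} (ha : a ≠ 0) (hb : b ≠ 0) (x z : ℝ) :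
    gaussianPDFReal 0 a x * gaussianPDFReal 0 b z =
      gaussianPDFReal 0 (a + b) (x + z) *
        gaussianPDFReal 0 (a * b / (a + b)) (x - (a / (a + b) : ℝ) * (x + z)) := by
  have ha' : (0:ℝ) < a := by positivity
  have hb' : (0:ℝ) < b := by positivity
  have hab : a + b ≠ 0 := by positivity
  have hc : a * b / (a + b) ≠ 0 := by positivity
  apply Real.log_injOn_pos
  · exact mul_pos (gaussianPDFReal_pos _ _ _ ha) (gaussianPDFReal_pos _ _ _ hb)
  · exact mul_pos (gaussianPDFReal_pos _ _ _ hab) (gaussianPDFReal_pos _ _ _ hc)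
  rw [Real.log_mul (gaussianPDFReal_pos _ _ _ ha).ne' (gaussianPDFReal_pos _ _ _ hb).ne',
    Real.log_mul (gaussianPDFReal_pos _ _ _ hab).ne' (gaussianPDFReal_pos _ _ _ hc).ne',
    log_pdf ha, log_pdf hb, log_pdf hab, log_pdf hc]
  push_cast
  have hpi : (2 * Real.pi : ℝ) ≠ 0 := by positivity
  rw [Real.log_mul hpi ha'.ne', Real.log_mul hpi hb'.ne', Real.log_mul hpi (by positivity),
    Real.log_mul hpi (by positivity), Real.log_div (by positivity) (by positivity),
    Real.log_mul ha'.ne' hb'.ne']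
  field_simp
  ring

lemma lintegral_gr {N : ℝ≥0} (m : ℝ) (hN : N ≠ 0) (f : ℝ → ℝ≥0∞) (hf : Measurable f) :
    ∫⁻ z, f z ∂gaussianReal m N = ∫⁻ z, ENNReal.ofReal (gaussianPDFReal m N z) * f z := by
  rw [gaussianReal_of_var_ne_zero m hN, lintegral_withDensity_eq_lintegral_mul _
    (measurable_gaussianPDF m N) hf]
  rfl

lemma integrable_pdf_mul {N : ℝ≥0} (m : ℝ) (hN : N ≠ 0) (f : ℝ → ℝ)
    (hi : Integrable f (gaussianReal m N)) :
    Integrable (fun z => gaussianPDFReal m N z * f z) volume := by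
  rw [gaussianReal_of_var_ne_zero m hN, integrable_withDensity_iff_integrable_smul'
    (measurable_gaussianPDF m N) (Filter.Eventually.of_forall fun x => gaussianPDF_lt_top)] at hi
  simpa [toReal_gaussianPDF] using hi

lemma transport_bound {σ s : ℝ≥0} (hσ : σ ≠ 0) (hs : s ≠ 0) (T T' h : ℝ → ℝ)
    (hT : ∀ x, HasDerivAt T (T' x) x) (hT' : ∀ x, 0 < T' x) (hTm : StrictMono T)
    (hT'm : Measurable T') (hm : Measurable h) :
    ∫⁻ q, ENNReal.ofReal (Real.exp (h (T q.1 + q.2) + (σ / (σ + s) : ℝ) * Real.log (T' q.1)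
      - Real.log (gaussianPDFReal 0 (σ + s) (q.1 + q.2))))
        ∂((gaussianReal 0 σ).prod (gaussianReal 0 s)) ≤ ∫⁻ y, ENNReal.ofReal (Real.exp (h y)) := by
  set κ : ℝ := (σ / (σ + s) : ℝ) with hκ
  have hσ' : (0:ℝ) < σ := by positivity
  have hs' : (0:ℝ) < s := by positivity
  have hκ0 : 0 < κ := by positivity
  have hκ1 : κ < 1 := by rw [hκ, div_lt_one (by positivity)]; linarith
  set τ : ℝ≥0 := σ * s / (σ + s) with hτ
  have hτ0 : τ ≠ 0 := by positivity
  have hTmeas : Measurable T := hTm.monotone.measurable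
  have hv : σ + s ≠ 0 := by positivity
  have hpm : Measurable (gaussianPDFReal 0 (σ + s)) := measurable_gaussianPDFReal _ _
  have hpm2 : Measurable (gaussianPDFReal 0 τ) := measurable_gaussianPDFReal _ _
  have hpm3 : Measurable (gaussianPDFReal 0 σ) := measurable_gaussianPDFReal _ _
  have hpm4 : Measurable (gaussianPDFReal 0 s) := measurable_gaussianPDFReal _ _
  have hmeas1 : Measurable fun q : ℝ × ℝ => ENNReal.ofReal (Real.exp (h (T q.1 + q.2)
      + κ * Real.log (T' q.1) - Real.log (gaussianPDFReal 0 (σ + s) (q.1 + q.2)))) := by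
    fun_prop
  rw [lintegral_prod _ hmeas1.aemeasurable]
  -- pass to Lebesgue integrals
  have e1 : ∀ x : ℝ, ENNReal.ofReal (gaussianPDFReal 0 σ x) *
      ∫⁻ z, ENNReal.ofReal (Real.exp (h (T x + z)
      + κ * Real.log (T' x) - Real.log (gaussianPDFReal 0 (σ + s) (x + z)))) ∂(gaussianReal 0 s)
      ≤ ∫⁻ w, ENNReal.ofReal (gaussianPDFReal 0 τ (x - κ * w)) *
        (ENNReal.ofReal (κ * T' x + (1 - κ)) * ENNReal.ofReal (Real.exp (h (T x + (w - x))))) := by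
    intro x
    rw [lintegral_gr 0 hs _ (by fun_prop), ← lintegral_const_mul _ (by fun_prop)]
    rw [← lintegral_add_left_eq_self (fun w => ENNReal.ofReal (gaussianPDFReal 0 τ (x - κ * w)) *
        (ENNReal.ofReal (κ * T' x + (1 - κ)) * ENNReal.ofReal (Real.exp (h (T x + (w - x)))))) x]
    refine lintegral_mono fun z => ?_
    rw [← ENNReal.ofReal_mul (gaussianPDFReal_nonneg _ _ _),
      ← ENNReal.ofReal_mul (gaussianPDFReal_nonneg _ _ _),
      ← ENNReal.ofReal_mul (by have := hT' x; nlinarith [mul_pos hκ0 this]),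
      ← ENNReal.ofReal_mul (gaussianPDFReal_nonneg _ _ _)]
    apply ENNReal.ofReal_le_ofReal
    have hvpos := gaussianPDFReal_pos 0 (σ + s) (x + z) hv
    rw [sub_eq_add_neg, Real.exp_add, Real.exp_add, Real.exp_neg, Real.exp_log hvpos, ← mul_assoc,
      pdf_mul_pdf hσ hs, ← hκ, ← hτ, add_sub_cancel_left]
    have hgm := Real.geom_mean_le_arith_mean2_weighted hκ0.le (by linarith : (0:ℝ) ≤ 1 - κ)
      (hT' x).le (zero_le_one) (by ring)
    rw [Real.one_rpow, mul_one, mul_one, Real.rpow_def_of_pos (hT' x), mul_comm] at hgm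
    have e : gaussianPDFReal 0 (σ + s) (x + z) * gaussianPDFReal 0 τ (x - κ * (x + z)) *
        (Real.exp (h (T x + z)) * Real.exp (κ * Real.log (T' x)) *
          (gaussianPDFReal 0 (σ + s) (x + z))⁻¹) =
        gaussianPDFReal 0 τ (x - κ * (x + z)) * (Real.exp (κ * Real.log (T' x)) *
          Real.exp (h (T x + z))) := by
      field_simp
    rw [e]
    have := gaussianPDFReal_nonneg 0 τ (x - κ * (x + z))
    gcongr
  calc _ = ∫⁻ x, ENNReal.ofReal (gaussianPDFReal 0 σ x) *
      ∫⁻ z, ENNReal.ofReal (Real.exp (h (T x + z)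
      + κ * Real.log (T' x) - Real.log (gaussianPDFReal 0 (σ + s) (x + z)))) ∂(gaussianReal 0 s) := by
        rw [lintegral_gr 0 hσ _ hmeas1.lintegral_prod_right']
    _ ≤ ∫⁻ x, ∫⁻ w, ENNReal.ofReal (gaussianPDFReal 0 τ (x - κ * w)) *
        (ENNReal.ofReal (κ * T' x + (1 - κ)) * ENNReal.ofReal (Real.exp (h (T x + (w - x))))) :=
        lintegral_mono e1
    _ = ∫⁻ w, ∫⁻ x, ENNReal.ofReal (gaussianPDFReal 0 τ (x - κ * w)) *
        (ENNReal.ofReal (κ * T' x + (1 - κ)) * ENNReal.ofReal (Real.exp (h (T x + (w - x))))) := by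
        rw [lintegral_lintegral_swap]
        apply Measurable.aemeasurable
        unfold Function.uncurry
        fun_prop
    _ = ∫⁻ w, ∫⁻ t, ENNReal.ofReal (gaussianPDFReal 0 τ t) *
        (ENNReal.ofReal (κ * T' (t + κ * w) + (1 - κ)) *
          ENNReal.ofReal (Real.exp (h (T (t + κ * w) + (w - (t + κ * w)))))) := by
        refine lintegral_congr fun w => ?_
        rw [← lintegral_add_right_eq_self _ (κ * w)]
        simp only [add_sub_cancel_right]
    _ = ∫⁻ t, ∫⁻ w, ENNReal.ofReal (gaussianPDFReal 0 τ t) *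
        (ENNReal.ofReal (κ * T' (t + κ * w) + (1 - κ)) *
          ENNReal.ofReal (Real.exp (h (T (t + κ * w) + (w - (t + κ * w)))))) := by
        rw [lintegral_lintegral_swap]
        apply Measurable.aemeasurable
        unfold Function.uncurry
        fun_prop
    _ ≤ ∫⁻ t, ENNReal.ofReal (gaussianPDFReal 0 τ t) * ∫⁻ y, ENNReal.ofReal (Real.exp (h y)) := by
        refine lintegral_mono fun t => ?_
        rw [lintegral_const_mul _ (by fun_prop)]
        refine mul_le_mul_right ?_ _
        refine lintegral_cov (fun w => T (t + κ * w) + (w - (t + κ * w)))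
          (fun w => κ * T' (t + κ * w) + (1 - κ)) (fun w => ?_) (fun w => ?_) ?_
          (fun y => ENNReal.ofReal (Real.exp (h y)))
        · have h1 : HasDerivAt (fun w : ℝ => t + κ * w) κ w := by
            simpa using ((hasDerivAt_id w).const_mul κ).const_add t
          have h2 := (hT (t + κ * w)).comp w h1
          have h3 := h2.add ((hasDerivAt_id w).sub h1)
          rw [mul_comm] at h3
          exact h3
        · have := mul_pos hκ0 (hT' (t + κ * w))
          linarith
        · apply StrictMono.injective
          intro w w' hw
          have h1 := hTm (show t + κ * w < t + κ * w' by nlinarith)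
          simp only []
          nlinarith
    _ = _ := by
        rw [lintegral_mul_const _ (by fun_prop), lintegral_gaussianPDFReal_eq_one 0 hτ0, one_mul]

lemma continuous_smooth {s : ℝ≥0} (hs : s ≠ 0) (h : ℝ → ℝ) (hm : Measurable h) (A B : ℝ)
    (hb : ∀ y, |h y| ≤ A + B * y ^ 2) :
    Continuous fun x => ∫ z, h (x + z) ∂(gaussianReal 0 s) := by
  have hs' : (0:ℝ) < s := by positivity
  have e : ∀ x, ∫ z, h (x + z) ∂(gaussianReal 0 s) = ∫ y, gaussianPDFReal 0 s (y - x) * h y := by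
    intro x
    rw [integral_gaussianReal_eq_integral_smul hs,
      ← integral_add_left_eq_self (fun y => gaussianPDFReal 0 s (y - x) * h y) x]
    simp
  simp_rw [e]
  rw [continuous_iff_continuousAt]
  intro x0
  have h2s : 2 * s ≠ 0 := by positivity
  set c := (√(2 * Real.pi * s))⁻¹ * Real.exp (1 / (2 * s)) * √(2 * Real.pi * (2 * s : ℝ≥0)) with hc
  refine continuousAt_of_dominated
    (bound := fun y => c * (gaussianPDFReal x0 (2 * s) y * (A + B * y ^ 2))) ?_ ?_ ?_ ?_
  · refine Filter.Eventually.of_forall fun x => ?_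
    have := measurable_gaussianPDFReal 0 s
    exact (by fun_prop : Measurable fun y => gaussianPDFReal 0 s (y - x) * h y).aestronglyMeasurable
  · filter_upwards [Metric.ball_mem_nhds x0 one_pos] with x hx
    refine Filter.Eventually.of_forall fun y => ?_
    rw [norm_mul, Real.norm_eq_abs, Real.norm_eq_abs, abs_of_nonneg (gaussianPDFReal_nonneg _ _ _),
      ← mul_assoc]
    refine mul_le_mul ?_ (hb y) (abs_nonneg _) ?_
    · unfold gaussianPDFReal
      have e2 : c * ((√(2 * Real.pi * (2 * s : ℝ≥0)))⁻¹ *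
          Real.exp (-(y - x0) ^ 2 / (2 * (2 * s : ℝ≥0)))) = (√(2 * Real.pi * s))⁻¹ *
          (Real.exp (1 / (2 * s)) * Real.exp (-(y - x0) ^ 2 / (2 * (2 * s : ℝ≥0)))) := by
        rw [hc]
        have : √(2 * Real.pi * (2 * s : ℝ≥0)) ≠ 0 := by positivity
        field_simp
      rw [e2, ← Real.exp_add]
      gcongr
      push_cast
      rw [Metric.mem_ball, Real.dist_eq] at hx
      have hx2 : (x - x0) ^ 2 ≤ 1 := by
        rw [← sq_abs]; have := abs_nonneg (x - x0); nlinarith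
      have e3 : 1 / (2 * (s:ℝ)) + -(y - x0) ^ 2 / (2 * (2 * s)) =
        (1 - (y - x0) ^ 2 / 2) / (2 * s) := by field_simp; ring
      rw [e3]
      gcongr
      nlinarith [sq_nonneg (y - x - (x - x0))]
    · exact mul_nonneg (by positivity) (gaussianPDFReal_nonneg _ _ _)
  · refine (integrable_pdf_mul x0 h2s _ ?_).const_mul c
    exact (integrable_const _).add
      ((memLp_id_gaussianReal (μ := x0) (v := 2 * s) 2).integrable_sq.const_mul B)
  · refine Filter.Eventually.of_forall fun y => ?_
    unfold gaussianPDFReal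
    fun_prop

/-- Logarithm of the sharp constant of the functional inequality. -/
def LC (σ s : ℝ≥0) : ℝ :=
  - ((σ + s) / σ / 2) * (Real.log (2 * Real.pi * (σ + s)) + 1)
    + (1/2) * (Real.log (2 * Real.pi * σ) + 1)

lemma fi_one {σ s : ℝ≥0} (hσ : σ ≠ 0) (hs : s ≠ 0) (h : ℝ → ℝ) (hm : Measurable h) (A B : ℝ)
    (hA : 0 ≤ A) (hB : 0 ≤ B)
    (hb : ∀ y, |h y| ≤ A + B * y ^ 2) (A₂ B₂ : ℝ) (hB₂ : 0 < B₂)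
    (hu : ∀ y, h y ≤ A₂ - B₂ * y ^ 2) :
    ∫⁻ x, ENNReal.ofReal (Real.exp ((σ + s) / σ * ∫ z, h (x + z) ∂(gaussianReal 0 s)))
      ≤ ENNReal.ofReal (Real.exp (LC σ s)) *
        (∫⁻ y, ENNReal.ofReal (Real.exp (h y))) ^ ((σ + s) / σ : ℝ) := by
  have hσ' : (0:ℝ) < σ := by positivity
  have hs' : (0:ℝ) < s := by positivity
  set μ : ℝ := (σ + s) / σ with hμ
  set κ : ℝ := σ / (σ + s) with hκ
  have hμ0 : 0 < μ := by positivity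
  have hκ0 : 0 < κ := by positivity
  have hκμ : κ * μ = 1 := by rw [hκ, hμ]; field_simp
  set c : ℝ → ℝ := fun x => ∫ z, h (x + z) ∂(gaussianReal 0 s) with hcdef
  have hcc : Continuous c := continuous_smooth hs h hm A B hb
  have hInteg : ∀ x, Integrable (fun z => h (x + z)) (gaussianReal 0 s) := by
    intro x
    refine Integrable.mono' (g := fun z => A + B * (x + z) ^ 2)
      ((integrable_const _).add ((integrable_shift_sq_one s x).const_mul B))
      (hm.comp (by fun_prop : Measurable fun z => x + z)).aestronglyMeasurable
      (Filter.Eventually.of_forall fun z => hb _)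
  have hquad : ∀ (a b x : ℝ), ∫ z, (a + b * (x + z) ^ 2) ∂(gaussianReal 0 s)
      = (a + b * s) + b * x ^ 2 := by
    intro a b x
    rw [integral_add (integrable_const _) ((integrable_shift_sq_one s x).const_mul b),
      integral_const_mul, integral_shift_sq_one]
    simp; ring
  have hquadi : ∀ (a b x : ℝ), Integrable (fun z => a + b * (x + z) ^ 2) (gaussianReal 0 s) :=
    fun a b x => (integrable_const _).add ((integrable_shift_sq_one s x).const_mul b)
  have hcb : ∀ x, |c x| ≤ (A + B * s) + B * x ^ 2 := by
    intro x
    rw [abs_le]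
    constructor
    · have : ∫ z, (-A + (-B) * (x + z) ^ 2) ∂(gaussianReal 0 s) ≤ c x :=
        integral_mono (hquadi _ _ _) (hInteg x) fun z => by
          have := (abs_le.mp (hb (x + z))).1
          simp only []; linarith
      rw [hquad] at this; linarith
    · rw [← hquad]
      exact integral_mono (hInteg x) (hquadi _ _ _) fun z => (abs_le.mp (hb (x + z))).2
  have hcu : ∀ x, c x ≤ A₂ - B₂ * x ^ 2 := by
    intro x
    have : c x ≤ ∫ z, (A₂ + (-B₂) * (x + z) ^ 2) ∂(gaussianReal 0 s) :=
        integral_mono (hInteg x) (hquadi _ _ _) fun z => by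
          have := hu (x + z)
          simp only []; linarith
    rw [hquad] at this; nlinarith
  -- the tilted density
  have hexpi : ∀ b : ℝ, 0 < b → Integrable (fun x : ℝ => Real.exp (- b * x ^ 2)) volume :=
    fun b hb => integrable_exp_neg_mul_sq hb
  set u : ℝ → ℝ := fun x => Real.exp (μ * c x) with hudef
  have hupos : ∀ x, 0 < u x := fun x => Real.exp_pos _
  have huc : Continuous u := by rw [hudef]; fun_prop
  have hub : ∀ x, u x ≤ Real.exp (μ * A₂) * Real.exp (-(μ * B₂) * x ^ 2) := by
    intro x
    rw [← Real.exp_add]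
    apply Real.exp_le_exp.mpr
    nlinarith [mul_le_mul_of_nonneg_left (hcu x) hμ0.le]
  have hui : Integrable u volume := by
    refine Integrable.mono' ((hexpi (μ * B₂) (by positivity)).const_mul (Real.exp (μ * A₂)))
      huc.aestronglyMeasurable (Filter.Eventually.of_forall fun x => ?_)
    rw [Real.norm_eq_abs, abs_of_pos (hupos x)]
    exact hub x
  have hu2i : Integrable (fun x => u x * x ^ 2) volume := by
    refine Integrable.mono' ((hexpi (μ * B₂ / 2) (by positivity)).const_mul
      (Real.exp (μ * A₂) * (2 / (μ * B₂)))) (by fun_prop) (Filter.Eventually.of_forall fun x => ?_)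
    rw [Real.norm_eq_abs, abs_of_nonneg (by have := hupos x; positivity)]
    have h1 : μ * B₂ / 2 * x ^ 2 ≤ Real.exp (μ * B₂ / 2 * x ^ 2) := by
      have := Real.add_one_le_exp (μ * B₂ / 2 * x ^ 2); linarith
    have h2 : x ^ 2 ≤ (2 / (μ * B₂)) * Real.exp (μ * B₂ / 2 * x ^ 2) := by
      have h3 := mul_le_mul_of_nonneg_left h1 (by positivity : (0:ℝ) ≤ 2 / (μ * B₂))
      have h4 : 2 / (μ * B₂) * (μ * B₂ / 2 * x ^ 2) = x ^ 2 := by field_simp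
      rwa [h4] at h3
    calc u x * x ^ 2 ≤ (Real.exp (μ * A₂) * Real.exp (-(μ * B₂) * x ^ 2)) *
          ((2 / (μ * B₂)) * Real.exp (μ * B₂ / 2 * x ^ 2)) :=
          mul_le_mul (hub x) h2 (by positivity) (by positivity)
      _ = Real.exp (μ * A₂) * (2 / (μ * B₂)) * (Real.exp (-(μ * B₂) * x ^ 2) *
            Real.exp (μ * B₂ / 2 * x ^ 2)) := by ring
      _ = _ := by rw [← Real.exp_add]; congr 2; ring
  set I : ℝ := ∫ x, u x with hI
  have hIpos : 0 < I := by
    rw [hI, integral_pos_iff_support_of_nonneg (fun x => (hupos x).le) hui]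
    have : Function.support u = Set.univ := by
      ext x; simp [(hupos x).ne']
    rw [this]; simp
  have hIl : ∫⁻ x, ENNReal.ofReal (Real.exp (μ * c x)) = ENNReal.ofReal I := by
    rw [hI, ofReal_integral_eq_lintegral_ofReal hui
      (Filter.Eventually.of_forall fun x => (hupos x).le)]
  obtain ⟨T, hT, hTm, hTs⟩ := transport (fun x => u x / I) (gaussianPDFReal 0 σ)
    (huc.div_const I) (fun x => div_pos (hupos x) hIpos) (hui.div_const I)
    (by rw [integral_div, ← hI, div_self hIpos.ne'])
    (by unfold gaussianPDFReal; fun_prop) (fun x => gaussianPDFReal_pos 0 σ x hσ)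
    (integrable_gaussianPDFReal 0 σ) (integral_gaussianPDFReal_eq_one 0 hσ)
  have hTmeas : Measurable T := hTm.monotone.measurable
  set T' : ℝ → ℝ := fun x => gaussianPDFReal 0 σ x / (u (T x) / I) with hT'def
  have hT'pos : ∀ x, 0 < T' x := fun x =>
    div_pos (gaussianPDFReal_pos 0 σ x hσ) (div_pos (hupos _) hIpos)
  have hpdfm : Measurable (gaussianPDFReal 0 σ) := measurable_gaussianPDFReal _ _
  have hT'm : Measurable T' := by
    have := huc.measurable
    fun_prop
  have hlogT' : ∀ x, Real.log (T' x) = Real.log (gaussianPDFReal 0 σ x) - μ * c (T x) + Real.log I := by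
    intro x
    rw [hT'def]
    simp only []
    rw [Real.log_div (gaussianPDFReal_pos 0 σ x hσ).ne' (div_pos (hupos _) hIpos).ne',
      Real.log_div (hupos _).ne' hIpos.ne', hudef]
    simp only [Real.log_exp]
    ring
  have hT2 : Integrable (fun x => T x ^ 2) (gaussianReal 0 σ) := by
    refine ⟨(by fun_prop : Measurable fun x => T x ^ 2).aestronglyMeasurable, ?_⟩
    rw [hasFiniteIntegral_iff_ofReal (Filter.Eventually.of_forall fun x => sq_nonneg _),
      lintegral_gr 0 hσ _ (by fun_prop)]
    have e : ∀ x, ENNReal.ofReal (gaussianPDFReal 0 σ x) * ENNReal.ofReal (T x ^ 2)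
        = ENNReal.ofReal (T' x) * (ENNReal.ofReal ((u (T x) * T x ^ 2) / I)) := by
      intro x
      rw [← ENNReal.ofReal_mul (gaussianPDFReal_nonneg _ _ _), ← ENNReal.ofReal_mul (hT'pos x).le]
      congr 1
      rw [hT'def]
      have := (hupos (T x)).ne'
      field_simp
    simp_rw [e]
    refine (lintegral_cov T T' hT (fun x => (hT'pos x).le) hTm.injective
      (fun y => ENNReal.ofReal ((u y * y ^ 2) / I))).trans_lt ?_
    have := (hu2i.div_const I).2
    rwa [hasFiniteIntegral_iff_ofReal (Filter.Eventually.of_forall fun x => by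
      have := hupos x; positivity)] at this
  -- the function to which Jensen is applied
  set v : ℝ≥0 := σ + s with hv
  have hv0 : v ≠ 0 := by positivity
  have hpdfv : Measurable (gaussianPDFReal 0 v) := measurable_gaussianPDFReal _ _
  set K : ℝ × ℝ → ℝ := fun q => h (T q.1 + q.2) + κ * Real.log (T' q.1)
      - Real.log (gaussianPDFReal 0 v (q.1 + q.2)) with hK
  have hKm : Measurable K := by fun_prop
  have i1 : Integrable (fun q : ℝ × ℝ => T q.1 ^ 2) ((gaussianReal 0 σ).prod (gaussianReal 0 s)) :=
    hT2.comp_fst _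
  have i2 : Integrable (fun q : ℝ × ℝ => q.1 ^ 2) ((gaussianReal 0 σ).prod (gaussianReal 0 s)) :=
    (integrable_sq_gr σ).comp_fst _
  have i3 : Integrable (fun q : ℝ × ℝ => q.2 ^ 2) ((gaussianReal 0 σ).prod (gaussianReal 0 s)) :=
    (integrable_sq_gr s).comp_snd _
  have j1 : Integrable (fun q : ℝ × ℝ => h (T q.1 + q.2))
      ((gaussianReal 0 σ).prod (gaussianReal 0 s)) := by
    refine Integrable.mono' (g := fun q : ℝ × ℝ => A + B * (2 * T q.1 ^ 2 + 2 * q.2 ^ 2))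
      ((integrable_const _).add (((i1.const_mul 2).add (i3.const_mul 2)).const_mul B))
      (by fun_prop : Measurable fun q : ℝ × ℝ => h (T q.1 + q.2)).aestronglyMeasurable
      (Filter.Eventually.of_forall fun q => ?_)
    refine (hb _).trans ?_
    have : (T q.1 + q.2) ^ 2 ≤ 2 * T q.1 ^ 2 + 2 * q.2 ^ 2 := by nlinarith [sq_nonneg (T q.1 - q.2)]
    gcongr
  have j2 : Integrable (fun x : ℝ => Real.log (T' x)) (gaussianReal 0 σ) := by
    simp_rw [hlogT', log_pdf hσ]
    refine Integrable.add (Integrable.sub ((integrable_const _).sub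
      ((integrable_sq_gr σ).div_const _)) (Integrable.const_mul ?_ μ)) (integrable_const _)
    refine Integrable.mono' (g := fun x : ℝ => (A + B * s) + B * T x ^ 2)
      ((integrable_const _).add (hT2.const_mul B))
      (hcc.measurable.comp hTmeas).aestronglyMeasurable (Filter.Eventually.of_forall fun x => hcb _)
  have j3 : Integrable (fun q : ℝ × ℝ => Real.log (gaussianPDFReal 0 v (q.1 + q.2)))
      ((gaussianReal 0 σ).prod (gaussianReal 0 s)) := by
    simp_rw [log_pdf hv0]
    refine (integrable_const _).sub (Integrable.div_const ?_ _)
    refine Integrable.mono' (g := fun q : ℝ × ℝ => 2 * q.1 ^ 2 + 2 * q.2 ^ 2)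
      ((i2.const_mul 2).add (i3.const_mul 2)) (by fun_prop)
      (Filter.Eventually.of_forall fun q => ?_)
    rw [Real.norm_eq_abs, abs_of_nonneg (sq_nonneg _)]
    nlinarith [sq_nonneg (q.1 - q.2)]
  have hKi : Integrable K ((gaussianReal 0 σ).prod (gaussianReal 0 s)) :=
    (j1.add ((j2.comp_fst _).const_mul κ)).sub j3
  have hKint : ∫ q, K q ∂((gaussianReal 0 σ).prod (gaussianReal 0 s)) =
      κ * (-(1/2) * Real.log (2 * Real.pi * σ) - 1/2 + Real.log I)
        + (1/2) * Real.log (2 * Real.pi * v) + 1/2 := by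
    rw [integral_prod _ hKi]
    have inner : ∀ x, ∫ z, K (x, z) ∂(gaussianReal 0 s) =
        κ * (-(1/2) * Real.log (2 * Real.pi * σ) + Real.log I)
          + (1/2) * Real.log (2 * Real.pi * v) + s / (2 * v)
          + (1 / (2 * v) - κ / (2 * σ)) * x ^ 2 := by
      intro x
      have e : (fun z => K (x, z)) = fun z => h (T x + z) +
          ((κ * Real.log (T' x) + (1/2) * Real.log (2 * Real.pi * v)) + 1 / (2 * v) * (x + z) ^ 2) := by
        funext z
        simp only [hK, log_pdf hv0]
        ring
      rw [e, integral_add (hInteg _) (hquadi _ _ _), hquad, hlogT', log_pdf hσ]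
      have : ∫ z, h (T x + z) ∂(gaussianReal 0 s) = c (T x) := rfl
      rw [this]
      linear_combination (- c (T x)) * hκμ
    simp_rw [inner]
    rw [integral_add (integrable_const _) ((integrable_sq_gr σ).const_mul _), integral_const_mul,
      integral_sq_gr]
    simp only [integral_const, probReal_univ, one_smul, smul_eq_mul, one_mul]
    rw [hv, hκ]; push_cast
    field_simp
    ring
  have hJ := (jensen_exp _ hKi).trans (transport_bound hσ hs T T' h hT hT'pos hTm hT'm hm)
  rw [hKint] at hJ
  have hJ2 := ENNReal.rpow_le_rpow hJ hμ0.le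
  rw [ENNReal.ofReal_rpow_of_pos (Real.exp_pos _), ← Real.exp_mul] at hJ2
  calc _ = ENNReal.ofReal I := hIl
    _ = ENNReal.ofReal (Real.exp (LC σ s)) * ENNReal.ofReal (Real.exp ((κ * (-(1/2) *
        Real.log (2 * Real.pi * σ) - 1/2 + Real.log I)
        + (1/2) * Real.log (2 * Real.pi * v) + 1/2) * μ)) := by
        rw [← ENNReal.ofReal_mul (Real.exp_pos _).le, ← Real.exp_add]
        congr 1
        rw [← Real.exp_log hIpos]
        congr 1
        rw [Real.exp_log hIpos, LC, ← hμ, hv]; push_cast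
        linear_combination (-(-(1/2) * Real.log (2 * Real.pi * σ) - 1/2 + Real.log I)) * hκμ
    _ ≤ _ := by gcongr

lemma psa_symm {n : ℕ} (p : ℝ × (Fin n → ℝ)) :
    (MeasurableEquiv.piFinSuccAbove (fun _ : Fin (n+1) => ℝ) 0).symm p
      = (Fin.cons p.1 p.2 : Fin (n+1) → ℝ) := by
  have : (MeasurableEquiv.piFinSuccAbove (fun _ : Fin (n+1) => ℝ) 0).symm p
    = Fin.insertNth (α := fun _ => ℝ) 0 p.1 p.2 := rfl
  rw [this, Fin.insertNth_zero]; rfl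

lemma lintegral_fin_succ {n : ℕ} (f : (Fin (n+1) → ℝ) → ℝ≥0∞) (hf : Measurable f) :
    ∫⁻ x, f x = ∫⁻ a : ℝ, ∫⁻ v : Fin n → ℝ, f (Fin.cons a v) := by
  have h1 := (volume_preserving_piFinSuccAbove (fun _ : Fin (n+1) => ℝ) 0).symm
  rw [← h1.lintegral_comp hf, Measure.volume_eq_prod, lintegral_prod]
  · simp only [psa_symm]
  · exact (hf.comp h1.measurable).aemeasurable

lemma measurable_cons2 {n : ℕ} : Measurable (fun p : ℝ × (Fin n → ℝ) =>
    (Fin.cons p.1 p.2 : Fin (n+1) → ℝ)) := by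
  have := (MeasurableEquiv.piFinSuccAbove (fun _ : Fin (n+1) => ℝ) 0).symm.measurable
  simpa only [← psa_symm] using this

lemma measurable_cons_right {n : ℕ} (a : ℝ) : Measurable (fun v : Fin n → ℝ =>
    (Fin.cons a v : Fin (n+1) → ℝ)) :=
  measurable_cons2.comp measurable_prodMk_left

lemma integral_gv_succ {n : ℕ} (s : ℝ≥0) (f : (Fin (n+1) → ℝ) → ℝ)
    (hf : Integrable f (gaussVec s (n+1))) :
    ∫ x, f x ∂(gaussVec s (n+1))
      = ∫ a, ∫ v : Fin n → ℝ, f (Fin.cons a v) ∂(gaussVec s n) ∂(gaussianReal 0 s) ∧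
    Integrable (fun a => ∫ v : Fin n → ℝ, f (Fin.cons a v) ∂(gaussVec s n)) (gaussianReal 0 s) := by
  have h1 : MeasurePreserving (MeasurableEquiv.piFinSuccAbove (fun _ : Fin (n+1) => ℝ) 0).symm
      ((gaussianReal 0 s).prod (gaussVec s n)) (gaussVec s (n+1)) :=
    (measurePreserving_piFinSuccAbove (fun _ : Fin (n+1) => gaussianReal 0 s) 0).symm
  have h2 : Integrable (fun p : ℝ × (Fin n → ℝ) =>
      f ((MeasurableEquiv.piFinSuccAbove (fun _ : Fin (n+1) => ℝ) 0).symm p))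
      ((gaussianReal 0 s).prod (gaussVec s n)) := h1.integrable_comp_of_integrable hf
  constructor
  · rw [← h1.integral_comp', integral_prod _ h2]
    simp only [psa_symm]
  · have h3 := h2.integral_prod_left
    simpa only [psa_symm] using h3

lemma cont_holder {α β : Type*} [MeasurableSpace α] [MeasurableSpace β] (ν : Measure α)
    [IsProbabilityMeasure ν] (ρ : Measure β) [SFinite ρ] (H : α → β → ℝ)
    (hH : Measurable (Function.uncurry H)) (Lf : α → ℝ) (hLm : Measurable Lf)
    (hL : Integrable Lf ν) (hHi : ∀ b, Integrable (fun a => H a b) ν)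
    (hb : ∀ a, ∫⁻ b, ENNReal.ofReal (Real.exp (H a b)) ∂ρ ≤ ENNReal.ofReal (Real.exp (Lf a))) :
    ∫⁻ b, ENNReal.ofReal (Real.exp (∫ a, H a b ∂ν)) ∂ρ
      ≤ ENNReal.ofReal (Real.exp (∫ a, Lf a ∂ν)) := by
  have h1 : ∀ b, ENNReal.ofReal (Real.exp (∫ a, H a b ∂ν)) ≤
      ENNReal.ofReal (Real.exp (∫ a, Lf a ∂ν)) *
        ∫⁻ a, ENNReal.ofReal (Real.exp (H a b - Lf a)) ∂ν := by
    intro b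
    have := jensen_exp ν ((hHi b).sub hL)
    calc _ = ENNReal.ofReal (Real.exp (∫ a, Lf a ∂ν)) *
          ENNReal.ofReal (Real.exp (∫ a, (H a b - Lf a) ∂ν)) := by
          rw [integral_sub (hHi b) hL, ← ENNReal.ofReal_mul (Real.exp_pos _).le, ← Real.exp_add]
          congr 2; ring
      _ ≤ _ := by gcongr; exact this
  have hmm : Measurable (Function.uncurry fun b a => ENNReal.ofReal (Real.exp (H a b - Lf a))) := by
    apply Measurable.ennreal_ofReal
    apply Real.measurable_exp.comp
    exact (hH.comp measurable_swap).sub (hLm.comp measurable_snd)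
  calc _ ≤ ∫⁻ b, ENNReal.ofReal (Real.exp (∫ a, Lf a ∂ν)) *
        ∫⁻ a, ENNReal.ofReal (Real.exp (H a b - Lf a)) ∂ν ∂ρ := lintegral_mono h1
    _ = ENNReal.ofReal (Real.exp (∫ a, Lf a ∂ν)) *
        ∫⁻ b, ∫⁻ a, ENNReal.ofReal (Real.exp (H a b - Lf a)) ∂ν ∂ρ :=
        lintegral_const_mul _ hmm.lintegral_prod_right
    _ = ENNReal.ofReal (Real.exp (∫ a, Lf a ∂ν)) *
        ∫⁻ a, ∫⁻ b, ENNReal.ofReal (Real.exp (H a b - Lf a)) ∂ρ ∂ν := by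
        rw [lintegral_lintegral_swap hmm.aemeasurable]
    _ ≤ ENNReal.ofReal (Real.exp (∫ a, Lf a ∂ν)) * ∫⁻ a, 1 ∂ν := by
        gcongr with a
        calc _ = ∫⁻ b, ENNReal.ofReal (Real.exp (-Lf a)) * ENNReal.ofReal (Real.exp (H a b)) ∂ρ := by
              congr 1; funext b
              rw [← ENNReal.ofReal_mul (Real.exp_pos _).le, ← Real.exp_add]
              congr 2; ring
          _ = ENNReal.ofReal (Real.exp (-Lf a)) * ∫⁻ b, ENNReal.ofReal (Real.exp (H a b)) ∂ρ := by
              rw [lintegral_const_mul]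
              exact ((Real.measurable_exp.comp (hH.comp measurable_prodMk_left))).ennreal_ofReal
          _ ≤ ENNReal.ofReal (Real.exp (-Lf a)) * ENNReal.ofReal (Real.exp (Lf a)) := by
              gcongr; exact hb a
          _ = 1 := by
              rw [← ENNReal.ofReal_mul (Real.exp_pos _).le, ← Real.exp_add]; simp
    _ = _ := by simp

lemma gauss_int (n : ℕ) {b : ℝ} (hb : 0 < b) : ∃ K : ℝ,
    ∫⁻ y : Fin n → ℝ, ENNReal.ofReal (Real.exp (-b * ∑ t, y t ^ 2)) = ENNReal.ofReal (Real.exp K) := by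
  set N : ℝ≥0 := ⟨1 / (2 * b), by positivity⟩ with hNd
  have hNv : (N : ℝ) = 1 / (2 * b) := rfl
  have hN : N ≠ 0 := by
    intro h
    have : (N : ℝ) = 0 := by rw [h]; rfl
    rw [hNv] at this
    have h2 : 0 < 1 / (2 * b) := by positivity
    linarith
  refine ⟨(n/2) * Real.log (2 * Real.pi * N), ?_⟩
  have h1 : ∀ y : Fin n → ℝ, ENNReal.ofReal (Real.exp (-b * ∑ t, y t ^ 2)) =
      ENNReal.ofReal (Real.exp ((n/2) * Real.log (2 * Real.pi * N))) *
        (ENNReal.ofReal (gd N n y) * 1) := by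
    intro y
    rw [mul_one, ← ENNReal.ofReal_mul (Real.exp_pos _).le]
    congr 1
    rw [← Real.exp_log (gd_pos hN n y), log_gd hN, ← Real.exp_add]
    congr 1
    rw [hNv]
    field_simp
    ring
  simp_rw [h1]
  rw [lintegral_const_mul _ (by simpa using (measurable_gd N n).ennreal_ofReal),
    ← lintegral_gaussVec hN n (fun _ => 1) measurable_const]
  simp

lemma LC_zero {σ : ℝ≥0} (hσ : σ ≠ 0) : LC σ 0 = 0 := by
  have : (0:ℝ) < σ := by positivity
  unfold LC
  simp
  field_simp
  ring

lemma fi_zero {n : ℕ} (σ : ℝ≥0) (hσ : σ ≠ 0) (h : (Fin n → ℝ) → ℝ) (hh : QB h) :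
    ∫⁻ x, ENNReal.ofReal (Real.exp (((σ:ℝ) + (0:ℝ≥0)) / σ * cv 0 h x))
      ≤ ENNReal.ofReal (Real.exp (n * LC σ 0)) *
        (∫⁻ y, ENNReal.ofReal (Real.exp (h y))) ^ (((σ:ℝ) + (0:ℝ≥0)) / σ : ℝ) := by
  have : (0:ℝ) < σ := by positivity
  rw [LC_zero hσ]
  have h1 : (((σ:ℝ) + (0:ℝ≥0)) / σ : ℝ) = 1 := by simp [this.ne']
  rw [h1]
  simp only [one_mul, mul_zero, Real.exp_zero, ENNReal.ofReal_one, ENNReal.rpow_one]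
  have hm : Measurable fun y => ENNReal.ofReal (Real.exp (h y)) :=
    (Real.measurable_exp.comp hh.1).ennreal_ofReal
  calc _ ≤ ∫⁻ x, ∫⁻ z, ENNReal.ofReal (Real.exp (h (x + z))) ∂(gaussVec 0 n) :=
        lintegral_mono fun x => jensen_exp _ (hh.integrable 0 x)
    _ = ∫⁻ z, (∫⁻ x, ENNReal.ofReal (Real.exp (h (x + z)))) ∂(gaussVec 0 n) := by
        apply lintegral_lintegral_swap
        exact (hm.comp (by fun_prop : Measurable fun p : (Fin n → ℝ) × (Fin n → ℝ) =>
          p.1 + p.2)).aemeasurable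
    _ = ∫⁻ z, (∫⁻ x, ENNReal.ofReal (Real.exp (h x))) ∂(gaussVec 0 n) := by
        congr 1; funext z
        exact lintegral_add_right_eq_self (fun x => ENNReal.ofReal (Real.exp (h x))) z
    _ = _ := by simp
    _ ≤ _ := le_rfl

lemma fi_n {σ s : ℝ≥0} (hσ : σ ≠ 0) (hs : s ≠ 0) : ∀ (n : ℕ) (h : (Fin n → ℝ) → ℝ) (_ : QB h)
    (A₂ B₂ : ℝ) (_ : 0 < B₂) (_ : ∀ y, h y ≤ A₂ - B₂ * ∑ t, y t ^ 2),
    ∫⁻ x, ENNReal.ofReal (Real.exp ((σ + s) / σ * cv s h x))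
      ≤ ENNReal.ofReal (Real.exp (n * LC σ s)) *
        (∫⁻ y, ENNReal.ofReal (Real.exp (h y))) ^ ((σ + s) / σ : ℝ) := by
  have hσ' : (0:ℝ) < σ := by positivity
  have hs' : (0:ℝ) < s := by positivity
  set μ : ℝ := (σ + s) / σ with hμ
  have hμ0 : 0 < μ := by positivity
  have hpow : ∀ a : ℝ, (ENNReal.ofReal (Real.exp a)) ^ μ = ENNReal.ofReal (Real.exp (μ * a)) := by
    intro a
    rw [ENNReal.ofReal_rpow_of_pos (Real.exp_pos _), ← Real.exp_mul, mul_comm]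
  intro n
  induction n with
  | zero =>
    intro h hh A₂ B₂ hB₂ hu
    have hv : (volume : Measure (Fin 0 → ℝ)) Set.univ = 1 := by
      rw [volume_pi, Measure.pi_univ]; simp
    rw [lintegral_unique, lintegral_unique, hv]
    simp only [mul_one, hpow]
    have : cv s h default = h default := by
      unfold cv
      rw [integral_unique]
      simp
      congr 1
      exact Subsingleton.elim _ _
    have h5 : ∀ x, cv s h x = h x := fun x => by
      rw [Subsingleton.elim x default]; exact this
    simp [h5]
  | succ n ih =>
    intro h hh A₂ B₂ hB₂ hu
    obtain ⟨hm, A, B, hA, hB, hb⟩ := id hh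
    have hsum : ∀ (a : ℝ) (v : Fin n → ℝ), ∑ t, (Fin.cons a v : Fin (n+1) → ℝ) t ^ 2
        = a ^ 2 + ∑ t, v t ^ 2 := by
      intro a v; rw [Fin.sum_univ_succ]; simp
    have hmc : Measurable fun p : ℝ × (Fin n → ℝ) => h (Fin.cons p.1 p.2) :=
      hm.comp measurable_cons2
    -- slices
    have hsl : ∀ a : ℝ, QB fun v : Fin n → ℝ => h (Fin.cons a v) := by
      intro a
      refine ⟨hm.comp (measurable_cons_right a), A + B * a ^ 2, B, by positivity, hB, fun v => ?_⟩
      have := hb (Fin.cons a v)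
      rw [hsum] at this
      linarith
    have hslu : ∀ (a : ℝ) (v : Fin n → ℝ), h (Fin.cons a v) ≤ (A₂ - B₂ * a ^ 2) - B₂ * ∑ t, v t ^ 2 := by
      intro a v
      have := hu (Fin.cons a v)
      rw [hsum] at this
      linarith
    set g1 : ℝ → ℝ≥0∞ := fun a => ∫⁻ v : Fin n → ℝ, ENNReal.ofReal (Real.exp (h (Fin.cons a v))) with hg1
    have hg1m : Measurable g1 :=
      Measurable.lintegral_prod_right (f := fun (a : ℝ) (v : Fin n → ℝ) =>
        ENNReal.ofReal (Real.exp (h (Fin.cons a v))))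
        (Real.measurable_exp.comp hmc).ennreal_ofReal
    obtain ⟨K₁, hK₁⟩ := gauss_int n hB₂
    obtain ⟨K₂, hK₂⟩ := gauss_int n (b := B + 1) (by positivity)
    have hg1u : ∀ a, g1 a ≤ ENNReal.ofReal (Real.exp (A₂ + K₁ - B₂ * a ^ 2)) := by
      intro a
      calc g1 a ≤ ∫⁻ v : Fin n → ℝ, ENNReal.ofReal (Real.exp (A₂ - B₂ * a ^ 2)) *
            ENNReal.ofReal (Real.exp (-B₂ * ∑ t, v t ^ 2)) := by
            refine lintegral_mono fun v => ?_
            rw [← ENNReal.ofReal_mul (Real.exp_pos _).le, ← Real.exp_add]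
            gcongr
            have := hslu a v
            linarith
        _ = _ := by
            rw [lintegral_const_mul _ (by fun_prop), hK₁,
              ← ENNReal.ofReal_mul (Real.exp_pos _).le, ← Real.exp_add]
            congr 2; ring
    have hg1l : ∀ a, ENNReal.ofReal (Real.exp (-A + K₂ - B * a ^ 2)) ≤ g1 a := by
      intro a
      calc _ = ∫⁻ v : Fin n → ℝ, ENNReal.ofReal (Real.exp (-A - B * a ^ 2)) *
            ENNReal.ofReal (Real.exp (-(B+1) * ∑ t, v t ^ 2)) := by
            rw [lintegral_const_mul _ (by fun_prop), hK₂,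
              ← ENNReal.ofReal_mul (Real.exp_pos _).le, ← Real.exp_add]
            congr 2; ring
        _ ≤ g1 a := by
            refine lintegral_mono fun v => ?_
            rw [← ENNReal.ofReal_mul (Real.exp_pos _).le, ← Real.exp_add]
            gcongr
            have := hb (Fin.cons a v)
            rw [hsum] at this
            have h3 := neg_abs_le (h (Fin.cons a v))
            have : 0 ≤ ∑ t, v t ^ 2 := by positivity
            linarith
    set h1 : ℝ → ℝ := fun a => Real.log (g1 a).toReal with hh1
    have hg1eq : ∀ a, g1 a = ENNReal.ofReal (Real.exp (h1 a)) := by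
      intro a
      have ht : g1 a ≠ ⊤ := ne_top_of_le_ne_top ENNReal.ofReal_ne_top (hg1u a)
      have hp : 0 < g1 a := lt_of_lt_of_le (by simp [Real.exp_pos]) (hg1l a)
      rw [hh1]
      simp only
      rw [Real.exp_log (ENNReal.toReal_pos hp.ne' ht), ENNReal.ofReal_toReal ht]
    have h1u : ∀ a, h1 a ≤ A₂ + K₁ - B₂ * a ^ 2 := by
      intro a
      have := hg1u a
      rw [hg1eq, ENNReal.ofReal_le_ofReal_iff (Real.exp_pos _).le, Real.exp_le_exp] at this
      exact this
    have h1l : ∀ a, -A + K₂ - B * a ^ 2 ≤ h1 a := by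
      intro a
      have := hg1l a
      rw [hg1eq, ENNReal.ofReal_le_ofReal_iff (Real.exp_pos _).le, Real.exp_le_exp] at this
      exact this
    have h1m : Measurable h1 := Real.measurable_log.comp hg1m.ennreal_toReal
    have h1b : ∀ a, |h1 a| ≤ (A + |A₂| + |K₁| + |K₂|) + B * a ^ 2 := by
      intro a
      have e1 := h1u a
      have e2 := h1l a
      have := le_abs_self A₂
      have := le_abs_self K₁
      have := neg_abs_le K₂
      have := abs_nonneg A₂
      have := abs_nonneg K₁
      have := abs_nonneg K₂
      have : 0 ≤ B₂ * a ^ 2 := by positivity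
      have : 0 ≤ B * a ^ 2 := by positivity
      rw [abs_le]; constructor <;> linarith
    have h1i : ∀ x, Integrable (fun z => h1 (x + z)) (gaussianReal 0 s) := by
      intro x
      refine Integrable.mono' (g := fun z => (A + |A₂| + |K₁| + |K₂|) + B * (x + z) ^ 2)
        ((integrable_const _).add ((integrable_shift_sq_one s x).const_mul B))
        (h1m.comp (by fun_prop : Measurable fun z => x + z)).aestronglyMeasurable
        (Filter.Eventually.of_forall fun z => ?_)
      exact h1b _
    -- splitting cv
    have hadd : ∀ (a b : ℝ) (v w : Fin n → ℝ),
        (Fin.cons a v : Fin (n+1) → ℝ) + Fin.cons b w = Fin.cons (a + b) (v + w) := by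
      intro a b v w
      funext i
      refine Fin.cases ?_ (fun j => ?_) i <;> simp
    have hcv : ∀ (a : ℝ) (v : Fin n → ℝ), cv s h (Fin.cons a v)
        = ∫ z, cv s (fun v => h (Fin.cons (a + z) v)) v ∂(gaussianReal 0 s) ∧
        Integrable (fun z => cv s (fun v => h (Fin.cons (a + z) v)) v) (gaussianReal 0 s) := by
      intro a v
      have h3 := integral_gv_succ s (fun z => h (Fin.cons a v + z)) (hh.integrable s _)
      simp only [hadd] at h3
      exact h3
    have hfull : ∫⁻ y, ENNReal.ofReal (Real.exp (h y)) = ∫⁻ a, ENNReal.ofReal (Real.exp (h1 a)) := by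
      rw [lintegral_fin_succ (fun y => ENNReal.ofReal (Real.exp (h y)))
        (Real.measurable_exp.comp hm).ennreal_ofReal]
      congr 1; funext a; exact hg1eq a
    have hcvm : Measurable (fun p : ℝ × (Fin n → ℝ) => cv s (fun v => h (Fin.cons p.1 v)) p.2) := by
      have : StronglyMeasurable (Function.uncurry fun (p : ℝ × (Fin n → ℝ)) (z : Fin n → ℝ) =>
          h (Fin.cons p.1 (p.2 + z))) :=
        (hmc.comp (by fun_prop : Measurable fun q : (ℝ × (Fin n → ℝ)) × (Fin n → ℝ) =>
          (q.1.1, q.1.2 + q.2))).stronglyMeasurable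
      exact (this.integral_prod_right (ν := gaussVec s n)).measurable
    rw [hfull, lintegral_fin_succ (fun x => ENNReal.ofReal (Real.exp (μ * cv s h x)))
      (Real.measurable_exp.comp (((hh.cv s).1).const_mul μ)).ennreal_ofReal]
    have hstep : ∀ a : ℝ, ∫⁻ v : Fin n → ℝ, ENNReal.ofReal (Real.exp (μ * cv s h (Fin.cons a v)))
        ≤ ENNReal.ofReal (Real.exp (n * LC σ s)) *
          ENNReal.ofReal (Real.exp (μ * ∫ z, h1 (a + z) ∂(gaussianReal 0 s))) := by
      intro a
      have h4 := cont_holder (gaussianReal 0 s) (volume : Measure (Fin n → ℝ))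
        (fun z v => μ * cv s (fun v => h (Fin.cons (a + z) v)) v)
        ((hcvm.comp (by fun_prop : Measurable fun q : ℝ × (Fin n → ℝ) => (a + q.1, q.2))).const_mul μ)
        (fun z => n * LC σ s + μ * h1 (a + z))
        ((h1m.comp (by fun_prop : Measurable fun z => a + z)).const_mul μ |>.const_add _)
        ((integrable_const _).add ((h1i a).const_mul μ))
        (fun v => ((hcv a v).2).const_mul μ)
        (fun z => by
          refine (ih _ (hsl (a + z)) _ B₂ hB₂ (hslu (a + z))).trans ?_
          rw [← hg1] at *
          have : (∫⁻ y : Fin n → ℝ, ENNReal.ofReal (Real.exp (h (Fin.cons (a + z) y))))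
            = ENNReal.ofReal (Real.exp (h1 (a + z))) := hg1eq (a + z)
          rw [this, hpow, ← ENNReal.ofReal_mul (Real.exp_pos _).le, ← Real.exp_add])
      rw [integral_add (integrable_const _) ((h1i a).const_mul μ), integral_const_mul] at h4
      simp only [integral_const_mul] at h4
      rw [← ENNReal.ofReal_mul (Real.exp_pos _).le, ← Real.exp_add]
      simp only [fun v => (hcv a v).1]
      simpa using h4
    calc _ ≤ ∫⁻ a, ENNReal.ofReal (Real.exp (n * LC σ s)) *
          ENNReal.ofReal (Real.exp (μ * ∫ z, h1 (a + z) ∂(gaussianReal 0 s))) := lintegral_mono hstep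
      _ = ENNReal.ofReal (Real.exp (n * LC σ s)) *
          ∫⁻ a, ENNReal.ofReal (Real.exp (μ * ∫ z, h1 (a + z) ∂(gaussianReal 0 s))) := by
          rw [lintegral_const_mul' _ _ ENNReal.ofReal_ne_top]
      _ ≤ ENNReal.ofReal (Real.exp (n * LC σ s)) * (ENNReal.ofReal (Real.exp (LC σ s)) *
        (∫⁻ y, ENNReal.ofReal (Real.exp (h1 y))) ^ μ) := by
          gcongr
          exact fi_one hσ hs h1 h1m _ B (by positivity) hB h1b _ B₂ hB₂ h1u
      _ = _ := by
          rw [← mul_assoc, ← ENNReal.ofReal_mul (Real.exp_pos _).le, ← Real.exp_add]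
          congr 3
          push_cast; ring

lemma fi_all {σ s : ℝ≥0} (hσ : σ ≠ 0) {n : ℕ} (h : (Fin n → ℝ) → ℝ) (hh : QB h)
    (A₂ B₂ : ℝ) (hB₂ : 0 < B₂) (hu : ∀ y, h y ≤ A₂ - B₂ * ∑ t, y t ^ 2) :
    ∫⁻ x, ENNReal.ofReal (Real.exp ((σ + s) / σ * cv s h x))
      ≤ ENNReal.ofReal (Real.exp (n * LC σ s)) *
        (∫⁻ y, ENNReal.ofReal (Real.exp (h y))) ^ ((σ + s) / σ : ℝ) := by
  by_cases hs : s = 0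
  · subst hs
    exact fi_zero σ hσ h hh
  · exact fi_n hσ hs n h hh A₂ B₂ hB₂ hu

lemma decoder_soft {n : ℕ} (N : ℝ≥0) {ι J : Type*} [Fintype ι] [Fintype J] [Nonempty ι]
    (x : J → Fin n → ℝ) (g : (Fin n → ℝ) → ι) {ε : ℝ} (h0 : 0 < ε) (h1 : ε < 1) :
    ∃ d : ι → (Fin n → ℝ) → ℝ, (∀ i, Measurable (d i)) ∧
      (∀ i y, ε / (Fintype.card ι : ℝ) ≤ d i y) ∧ (∀ i y, d i y ≤ 1) ∧
      (∀ y, ∑ i, d i y ≤ 1) ∧ ∀ i j, Real.log (1 - ε) +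
        (gaussVec N n {z | g (x j + z) ≠ i}).toReal * Real.log (ε / (Fintype.card ι : ℝ))
        ≤ cv N (fun y => Real.log (d i y)) (x j) := by
  set k : ℝ := (Fintype.card ι : ℝ) with hk
  have hk1 : 1 ≤ k := by rw [hk]; exact_mod_cast Fintype.card_pos
  have hk0 : 0 < k := by linarith
  set T : ι → J → Set (Fin n → ℝ) := fun i j =>
    toMeasurable (gaussVec N n) {z | g (x j + z) ≠ i} with hT
  set D : ι → Set (Fin n → ℝ) := fun i => {y | ∃ j, y - x j ∉ T i j} with hD
  have hDm : ∀ i, MeasurableSet (D i) := by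
    intro i
    have : D i = ⋃ j, (fun y => y - x j) ⁻¹' (T i j)ᶜ := by
      ext y; simp [hD]
    rw [this]
    refine MeasurableSet.iUnion fun j => ?_
    exact (by fun_prop : Measurable fun y : Fin n → ℝ => y - x j)
      (measurableSet_toMeasurable _ _).compl
  have hDg : ∀ i y, y ∈ D i → g y = i := by
    rintro i y ⟨j, hj⟩
    by_contra hne
    apply hj
    apply subset_toMeasurable
    simpa using hne
  have hεk : ε / k ≤ ε := div_le_self h0.le hk1
  have hεk0 : 0 < ε / k := by positivity
  refine ⟨fun i y => (1 - ε) * (D i).indicator 1 y + ε / k, ?_, ?_, ?_, ?_, ?_⟩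
  · intro i
    exact ((measurable_one.indicator (hDm i)).const_mul _).add_const _
  · intro i y
    have : 0 ≤ (D i).indicator (1 : (Fin n → ℝ) → ℝ) y := Set.indicator_nonneg (by simp) _
    have : 0 ≤ (1 - ε) * (D i).indicator 1 y := mul_nonneg (by linarith) this
    linarith
  · intro i y
    have : (D i).indicator (1 : (Fin n → ℝ) → ℝ) y ≤ 1 :=
      Set.indicator_le_self' (by simp) _
    have : (1 - ε) * (D i).indicator 1 y ≤ (1 - ε) * 1 := mul_le_mul_of_nonneg_left this (by linarith)
    simp only
    linarith
  · intro y
    simp only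
    rw [Finset.sum_add_distrib, ← Finset.mul_sum]
    have h2 : ∑ i, (D i).indicator (1 : (Fin n → ℝ) → ℝ) y ≤ 1 := by
      rw [Finset.sum_eq_single (g y)]
      · exact Set.indicator_le_self' (by simp) _
      · intro i _ hi
        rw [Set.indicator_of_notMem]
        intro h; exact hi (hDg i y h).symm
      · simp
    have h3 : (1 - ε) * ∑ i, (D i).indicator (1 : (Fin n → ℝ) → ℝ) y ≤ (1 - ε) * 1 :=
      mul_le_mul_of_nonneg_left h2 (by linarith)
    have h4 : ∑ _i : ι, ε / k = ε := by
      rw [Finset.sum_const, Finset.card_univ, nsmul_eq_mul, ← hk]; field_simp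
    linarith
  · intro i j
    have hl1 : Real.log (1 - ε) ≤ 0 := Real.log_nonpos (by linarith) (by linarith)
    have hl2 : Real.log (ε / k) ≤ 0 := Real.log_nonpos hεk0.le (by linarith)
    have hpt : ∀ y, Real.log (1 - ε) + (D i)ᶜ.indicator (fun _ => Real.log (ε / k)) y ≤
        Real.log ((1 - ε) * (D i).indicator 1 y + ε / k) := by
      intro y
      by_cases hy : y ∈ D i
      · rw [Set.indicator_of_notMem (by simpa using hy), Set.indicator_of_mem hy]
        simp only [Pi.one_apply, mul_one, add_zero]
        exact Real.log_le_log (by linarith) (by linarith)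
      · rw [Set.indicator_of_mem (by simpa using hy), Set.indicator_of_notMem hy]
        simp; exact hl1
    have hDm' : MeasurableSet ((fun z => x j + z) ⁻¹' (D i)ᶜ) :=
      (by fun_prop : Measurable fun z : Fin n → ℝ => x j + z) (hDm i).compl
    have hind : (fun z => (D i)ᶜ.indicator (fun _ => Real.log (ε / k)) (x j + z))
        = ((fun z => x j + z) ⁻¹' (D i)ᶜ).indicator (fun _ => Real.log (ε / k)) := by
      funext z; rfl
    have hle : (gaussVec N n).real ((fun z => x j + z) ⁻¹' (D i)ᶜ) ≤
        (gaussVec N n {z | g (x j + z) ≠ i}).toReal := by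
      unfold Measure.real
      apply ENNReal.toReal_mono (measure_ne_top _ _)
      rw [← measure_toMeasurable {z | g (x j + z) ≠ i}]
      apply measure_mono
      intro z hz
      simp only [hD, Set.mem_preimage, Set.mem_compl_iff, Set.mem_ofPred_eq, not_exists,
        not_not] at hz
      have := hz j
      simpa using this
    have hInteg : Integrable (fun z => Real.log ((1 - ε) * (D i).indicator 1 (x j + z) + ε / k))
        (gaussVec N n) := by
      have hq : QB fun y => Real.log ((1 - ε) * (D i).indicator 1 y + ε / k) := by
        refine QB.of_bdd (A := |Real.log (1-ε+ε/k)| + |Real.log (ε/k)|)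
          (Real.measurable_log.comp (((measurable_one.indicator (hDm i)).const_mul _).add_const _))
          fun y => ?_
        by_cases hy : y ∈ D i
        · rw [Set.indicator_of_mem hy]; simp
        · rw [Set.indicator_of_notMem hy]; simp
      exact hq.integrable N (x j)
    calc _ ≤ Real.log (1 - ε) + (gaussVec N n).real ((fun z => x j + z) ⁻¹' (D i)ᶜ) *
          Real.log (ε / k) := by
          have := mul_le_mul_of_nonpos_right hle hl2
          linarith
      _ = ∫ z, (Real.log (1 - ε) + (D i)ᶜ.indicator (fun _ => Real.log (ε / k)) (x j + z))
          ∂(gaussVec N n) := by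
          rw [integral_add (integrable_const _) (by
            rw [hind]; exact (integrable_const _).indicator hDm'), hind,
            integral_indicator_const _ hDm']
          simp
      _ ≤ _ := by
          unfold cv
          refine integral_mono ((integrable_const _).add (by
            rw [hind]; exact (integrable_const _).indicator hDm')) hInteg fun z => ?_
          exact hpt _

lemma info_bound {n : ℕ} {N : ℝ≥0} (hN : N ≠ 0) {ι : Type*} [Fintype ι] [Nonempty ι]
    (x : ι → Fin n → ℝ) {W : (Fin n → ℝ) → ℝ} (hW : QB W) {D : ι → (Fin n → ℝ) → ℝ}
    (hD : ∀ i, QB (D i)) (hs : ∀ y, ∑ i, Real.exp (D i y) ≤ 1) {J : ℝ} (hJ : 0 < J)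
    (hWJ : ∫⁻ y, ENNReal.ofReal (Real.exp (W y)) ≤ ENNReal.ofReal J) :
    ∑ i, (cv N W (x i) + cv N (D i) (x i)) ≤ (Fintype.card ι : ℝ) *
      (-(n/2) * (Real.log (2 * Real.pi * N) + 1) + Real.log J - Real.log (Fintype.card ι : ℝ)) := by
  have hN' : (0:ℝ) < N := by positivity
  set k : ℝ := (Fintype.card ι : ℝ) with hk
  have hk0 : 0 < k := by rw [hk]; exact_mod_cast Fintype.card_pos
  set G : ℝ := -(n/2) * (Real.log (2 * Real.pi * N) + 1) with hG
  have hgd : cv N (fun z => Real.log (gd N n z)) 0 = G := by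
    rw [cv_log_gd hN, hG]; simp; field_simp; ring
  have hgdi : Integrable (fun z => Real.log (gd N n z)) (gaussVec N n) := by
    simpa using (QB_log_gd hN n).integrable N 0
  set a : ι → ℝ := fun i => cv N W (x i) + cv N (D i) (x i) - G - Real.log (J / k) with ha
  have hE : ∀ i, ENNReal.ofReal (Real.exp (a i)) ≤ ENNReal.ofReal (k / J) *
      ∫⁻ y, ENNReal.ofReal (Real.exp (W y) * Real.exp (D i y)) := by
    intro i
    have hi1 := hW.integrable N (x i)
    have hi2 := (hD i).integrable N (x i)
    have hii : Integrable (fun z => W (x i + z) + D i (x i + z) - Real.log (gd N n z)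
        - Real.log (J / k)) (gaussVec N n) :=
      ((hi1.add hi2).sub hgdi).sub (integrable_const (Real.log (J / k)))
    have h1 := jensen_exp (gaussVec N n) hii
    have h2 : ∫ z, (W (x i + z) + D i (x i + z) - Real.log (gd N n z) - Real.log (J / k)) ∂(gaussVec N n) = a i := by
      rw [integral_sub (f := fun z => W (x i + z) + D i (x i + z) - Real.log (gd N n z))
        ((hi1.add hi2).sub hgdi) (integrable_const _),
        integral_sub (f := fun z => W (x i + z) + D i (x i + z)) (hi1.add hi2) hgdi,
        integral_add hi1 hi2]
      simp only [ha, ← hgd, cv, zero_add]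
      simp
    rw [h2] at h1
    refine h1.trans ?_
    have hm : Measurable fun z => ENNReal.ofReal (Real.exp (W (x i + z) + D i (x i + z) - Real.log (gd N n z) - Real.log (J / k))) := by
      apply Measurable.ennreal_ofReal
      apply Real.measurable_exp.comp
      have m1 : Measurable fun z => W (x i + z) := hW.1.comp (by fun_prop)
      have m2 : Measurable fun z => D i (x i + z) := (hD i).1.comp (by fun_prop)
      exact ((m1.add m2).sub (QB_log_gd hN n).1).sub measurable_const
    rw [lintegral_gaussVec hN n _ hm]
    have h3 : ∀ z, ENNReal.ofReal (gd N n z) * ENNReal.ofReal (Real.exp (W (x i + z) + D i (x i + z) - Real.log (gd N n z) - Real.log (J / k))) =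
        ENNReal.ofReal (k / J) *
          ENNReal.ofReal (Real.exp (W (x i + z)) * Real.exp (D i (x i + z))) := by
      intro z
      rw [← ENNReal.ofReal_mul (gd_pos hN n z).le, ← ENNReal.ofReal_mul (by positivity)]
      congr 1
      rw [Real.exp_sub, Real.exp_sub, Real.exp_add, Real.exp_log (gd_pos hN n z),
        Real.exp_log (by positivity)]
      have := (gd_pos hN n z).ne'
      field_simp
    simp_rw [h3]
    rw [lintegral_const_mul' _ _ ENNReal.ofReal_ne_top]
    exact mul_le_mul_right (lintegral_add_left_eq_self
      (fun y => ENNReal.ofReal (Real.exp (W y) * Real.exp (D i y))) (x i)).le _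
  have hsum : ∑ i, Real.exp (a i) ≤ k := by
    have h4 : ENNReal.ofReal (∑ i, Real.exp (a i)) ≤ ENNReal.ofReal k := by
      rw [ENNReal.ofReal_sum_of_nonneg fun i _ => (Real.exp_pos _).le]
      calc _ ≤ ∑ i, ENNReal.ofReal (k / J) *
            ∫⁻ y, ENNReal.ofReal (Real.exp (W y) * Real.exp (D i y)) :=
            Finset.sum_le_sum fun i _ => hE i
        _ = ENNReal.ofReal (k / J) *
            ∫⁻ y, ∑ i, ENNReal.ofReal (Real.exp (W y) * Real.exp (D i y)) := by
            rw [← Finset.mul_sum, lintegral_finsetSum]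
            intro i _
            exact ((Real.measurable_exp.comp hW.1).mul
              (Real.measurable_exp.comp (hD i).1)).ennreal_ofReal
        _ ≤ ENNReal.ofReal (k / J) * ∫⁻ y, ENNReal.ofReal (Real.exp (W y)) := by
            gcongr with y
            rw [← ENNReal.ofReal_sum_of_nonneg fun i _ => by positivity, ← Finset.mul_sum]
            apply ENNReal.ofReal_le_ofReal
            have := mul_le_mul_of_nonneg_left (hs y) (Real.exp_pos (W y)).le
            linarith
        _ ≤ ENNReal.ofReal (k / J) * ENNReal.ofReal J := by gcongr
        _ = _ := by
            rw [← ENNReal.ofReal_mul (by positivity)]; congr 1; field_simp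
    rwa [ENNReal.ofReal_le_ofReal_iff hk0.le] at h4
  have hle : ∑ i, a i ≤ 0 := by
    have : ∑ i, (a i + 1) ≤ k := (Finset.sum_le_sum fun i _ => Real.add_one_le_exp (a i)).trans hsum
    rw [Finset.sum_add_distrib] at this
    simp only [Finset.sum_const, Finset.card_univ, nsmul_eq_mul, mul_one] at this
    linarith
  simp only [ha, Finset.sum_sub_distrib, Finset.sum_const, Finset.card_univ, nsmul_eq_mul] at hle
  rw [Real.log_div hJ.ne' hk0.ne'] at hle
  rw [← hk] at hle
  linarith

lemma prod_err_left {α β : Type*} [MeasurableSpace α] [MeasurableSpace β] (μ : Measure α)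
    (ν : Measure β) [IsProbabilityMeasure μ] [IsProbabilityMeasure ν] (p : α → Prop) (q : β → Prop) :
    (μ {a | ¬ p a}).toReal ≤ (μ.prod ν {z | ¬ (p z.1 ∧ q z.2)}).toReal := by
  apply ENNReal.toReal_mono (measure_ne_top _ _)
  calc _ = (μ.prod ν) ({a | ¬ p a} ×ˢ Set.univ) := by rw [Measure.prod_prod]; simp
    _ ≤ _ := measure_mono fun z hz => by
        simp only [Set.mem_prod, Set.mem_ofPred_eq] at hz ⊢
        tauto

lemma prod_err_right {α β : Type*} [MeasurableSpace α] [MeasurableSpace β] (μ : Measure α)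
    (ν : Measure β) [IsProbabilityMeasure μ] [IsProbabilityMeasure ν] (p : α → Prop) (q : β → Prop) :
    (ν {a | ¬ q a}).toReal ≤ (μ.prod ν {z | ¬ (p z.1 ∧ q z.2)}).toReal := by
  apply ENNReal.toReal_mono (measure_ne_top _ _)
  calc _ = (μ.prod ν) (Set.univ ×ˢ {a | ¬ q a}) := by rw [Measure.prod_prod]; simp
    _ ≤ _ := measure_mono fun z hz => by
        simp only [Set.mem_prod, Set.mem_ofPred_eq] at hz ⊢
        tauto

lemma QB_log_of_bdd {n : ℕ} {d : (Fin n → ℝ) → ℝ} (hm : Measurable d) {c : ℝ} (hc : 0 < c)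
    (h1 : ∀ y, c ≤ d y) (h2 : ∀ y, d y ≤ 1) : QB fun y => Real.log (d y) := by
  refine QB.of_bdd (A := - Real.log c) (Real.measurable_log.comp hm) fun y => ?_
  rw [abs_of_nonpos (Real.log_nonpos (hc.le.trans (h1 y)) (h2 y))]
  have := Real.log_le_log hc (h1 y)
  linarith

lemma lintegral_gd {N : ℝ≥0} (hN : N ≠ 0) (n : ℕ) : ∫⁻ y, ENNReal.ofReal (gd N n y) = 1 := by
  have := lintegral_gaussVec hN n (fun _ => 1) measurable_const
  simpa using this.symm

lemma sum_err {k1 k2 : ℕ} (hk1 : 0 < k1) (hk2 : 0 < k2) (e e' : Fin k1 × Fin k2 → ℝ) {ε c : ℝ}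
    (h : (1:ℝ) / ((k1:ℝ) * (k2:ℝ)) * ∑ m, e m ≤ ε) (hc : c ≤ 0) (he : ∀ m, e' m ≤ e m) :
    (k1:ℝ) * k2 * (ε * c) ≤ ∑ m, e' m * c := by
  have h1 : (0:ℝ) < (k1:ℝ) * k2 := by positivity
  have h2 : ∑ m, e' m ≤ (k1:ℝ) * k2 * ε := by
    refine (Finset.sum_le_sum fun m _ => he m).trans ?_
    rw [one_div, inv_mul_le_iff₀ h1] at h
    exact h
  rw [← Finset.sum_mul]
  have := mul_le_mul_of_nonpos_right h2 hc
  linarith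

lemma conv1 {P : ℝ} (hP : 0 ≤ P) {N1 s σ : ℝ≥0} (hN1 : N1 ≠ 0) (hσ : σ ≠ 0)
    {n k1 k2 : ℕ} (hk1 : 0 < k1) (hk2 : 0 < k2)
    (f : Fin k1 × Fin k2 → Fin n → ℝ) (g1 : (Fin n → ℝ) × Fin k2 → Fin k1)
    (g2 : (Fin n → ℝ) → Fin k2) (hpow : ∀ m, ∑ t, (f m t) ^ 2 ≤ (n : ℝ) * P)
    {ε : ℝ} (h0 : 0 < ε) (h1 : ε < 1) (herr : gErrP1 N1 (N1 + s) n k1 k2 f g1 g2 ≤ ε) :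
    (1 - ε) * (Real.log k1 + (σ + s) / σ * Real.log k2) ≤
      n * (1/2 * (Real.log σ - Real.log N1) + (σ + s) / σ / 2 *
        (Real.log (P + (N1 + s)) - Real.log (σ + s)))
      - (1 + (σ + s) / σ) * (Real.log (1 - ε) + ε * Real.log ε) := by
  have hN1' : (0:ℝ) < N1 := by positivity
  have hσ' : (0:ℝ) < σ := by positivity
  have hk1' : (0:ℝ) < k1 := by positivity
  have hk2' : (0:ℝ) < k2 := by positivity
  have : Nonempty (Fin k1) := ⟨⟨0, hk1⟩⟩
  have : Nonempty (Fin k2) := ⟨⟨0, hk2⟩⟩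
  set μ : ℝ := (σ + s) / σ with hμ
  have hμ0 : 0 < μ := by positivity
  set Q : ℝ≥0 := P.toNNReal + (N1 + s) with hQ
  have hQv : (Q:ℝ) = P + (N1 + s) := by rw [hQ]; push_cast; rw [Real.coe_toNNReal _ hP]
  have hQ' : (0:ℝ) < Q := by rw [hQv]; positivity
  have hQ0 : Q ≠ 0 := by
    intro h; rw [h] at hQ'; simp at hQ'
  obtain ⟨d2, d2m, d2l, d2u, d2s, d2b⟩ := decoder_soft (N1 + s) f g2 h0 h1
  have hd1 := fun m2 : Fin k2 => decoder_soft N1 (fun m1 => f (m1, m2)) (fun y => g1 (y, m2)) h0 h1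
  choose d1 d1m d1l d1u d1s d1b using hd1
  simp only [Fintype.card_fin] at d2l d2b d1l d1b
  have c1 : 0 < ε / k1 := by positivity
  have c2 : 0 < ε / k2 := by positivity
  have q2 : ∀ i, QB fun y => Real.log (d2 i y) := fun i => QB_log_of_bdd (d2m i) c2 (d2l i) (d2u i)
  have q1 : ∀ m2 i, QB fun y => Real.log (d1 m2 i y) := fun m2 i =>
    QB_log_of_bdd (d1m m2 i) c1 (d1l m2 i) (d1u m2 i)
  set h : Fin k2 → (Fin n → ℝ) → ℝ := fun i y => Real.log (gd Q n y) + Real.log (d2 i y) with hh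
  have hq : ∀ i, QB (h i) := fun i => (QB_log_gd hQ0 n).add (q2 i)
  have hexp : ∀ i y, Real.exp (h i y) = gd Q n y * d2 i y := by
    intro i y
    simp only [hh]
    rw [Real.exp_add, Real.exp_log (gd_pos hQ0 n y), Real.exp_log (c2.trans_le (d2l i y))]
  set I : Fin k2 → ℝ≥0∞ := fun i => ∫⁻ y, ENNReal.ofReal (Real.exp (h i y)) with hI
  have hIsum : ∑ i, I i ≤ 1 := by
    simp only [hI]
    rw [← lintegral_finsetSum (f := fun i y => ENNReal.ofReal (Real.exp (h i y))) _
      fun i _ => (Real.measurable_exp.comp (hq i).1).ennreal_ofReal,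
      ← lintegral_gd hQ0 n]
    refine lintegral_mono fun y => ?_
    rw [← ENNReal.ofReal_sum_of_nonneg fun i _ => (Real.exp_pos _).le]
    simp only [hexp]
    rw [← Finset.mul_sum]
    apply ENNReal.ofReal_le_ofReal
    have := mul_le_mul_of_nonneg_left (d2s y) (gd_pos hQ0 n y).le
    linarith
  have hIt : ∀ i, I i ≠ ⊤ := fun i => ne_top_of_le_ne_top ENNReal.one_ne_top
    ((Finset.single_le_sum (f := I) (fun _ _ => zero_le) (Finset.mem_univ i)).trans hIsum)
  have hIp : ∀ i, 0 < I i := by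
    intro i
    refine lt_of_lt_of_le (b := ENNReal.ofReal (ε / k2)) (by simpa using c2) ?_
    calc ENNReal.ofReal (ε / k2) = ∫⁻ y, ENNReal.ofReal (ε / k2) * ENNReal.ofReal (gd Q n y) := by
          rw [lintegral_const_mul _ (measurable_gd Q n).ennreal_ofReal, lintegral_gd hQ0, mul_one]
      _ ≤ _ := by
          refine lintegral_mono fun y => ?_
          simp only [hexp]
          rw [← ENNReal.ofReal_mul c2.le, mul_comm]
          apply ENNReal.ofReal_le_ofReal
          exact mul_le_mul_of_nonneg_left (d2l i y) (gd_pos hQ0 n y).le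
  set Ir : Fin k2 → ℝ := fun i => (I i).toReal with hIr
  have hIrp : ∀ i, 0 < Ir i := fun i => ENNReal.toReal_pos (hIp i).ne' (hIt i)
  have hIrs : ∑ i, Ir i ≤ 1 := by
    rw [hIr, ← ENNReal.toReal_sum fun i _ => hIt i]
    exact ENNReal.toReal_le_of_le_ofReal zero_le_one (by simpa using hIsum)
  have hlogI : ∑ i, Real.log (Ir i) ≤ - (k2 * Real.log k2) := by
    have h2 : ∑ i, (Real.log k2 + Real.log (Ir i)) ≤ ∑ i, ((k2:ℝ) * Ir i - 1) := by
      refine Finset.sum_le_sum fun i _ => ?_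
      rw [← Real.log_mul hk2'.ne' (hIrp i).ne']
      exact Real.log_le_sub_one_of_pos (mul_pos hk2' (hIrp i))
    rw [Finset.sum_add_distrib, Finset.sum_sub_distrib, ← Finset.mul_sum] at h2
    simp at h2
    have := mul_le_mul_of_nonneg_left hIrs hk2'.le
    linarith
  have hfi : ∀ i, ∫⁻ x, ENNReal.ofReal (Real.exp (μ * cv s (h i) x)) ≤
      ENNReal.ofReal (Real.exp (n * LC σ s) * (Ir i) ^ μ) := by
    intro i
    refine (fi_all hσ (h i) (hq i) (-(n/2) * Real.log (2 * Real.pi * Q)) (1 / (2 * Q))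
      (by positivity) fun y => ?_).trans ?_
    · simp only [hh]
      have := Real.log_nonpos (c2.le.trans (d2l i y)) (d2u i y)
      rw [log_gd hQ0]
      linarith
    · rw [ENNReal.ofReal_mul (Real.exp_pos _).le, ← ENNReal.ofReal_rpow_of_pos (hIrp i)]
      rw [hIr]
      simp only
      rw [ENNReal.ofReal_toReal (hIt i)]
  have hinfo : ∀ m2 : Fin k2, ∑ m1 : Fin k1, (cv N1 (fun y => μ * cv s (h m2) y) (f (m1, m2)) +
      cv N1 (fun y => Real.log (d1 m2 m1 y)) (f (m1, m2))) ≤ k1 *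
      (-(n/2) * (Real.log (2 * Real.pi * N1) + 1) + (n * LC σ s + μ * Real.log (Ir m2))
        - Real.log k1) := by
    intro m2
    have h5 := info_bound hN1 (fun m1 => f (m1, m2)) (((hq m2).cv s).const_mul μ)
      (D := fun m1 y => Real.log (d1 m2 m1 y)) (q1 m2) (fun y => by
        simp only [fun i => Real.exp_log (c1.trans_le (d1l m2 i y))]
        exact d1s m2 y) (J := Real.exp (n * LC σ s) * (Ir m2) ^ μ)
        (mul_pos (Real.exp_pos _) (Real.rpow_pos_of_pos (hIrp m2) _)) (hfi m2)
    rw [Real.log_mul (Real.exp_pos _).ne' (Real.rpow_pos_of_pos (hIrp m2) _).ne', Real.log_exp,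
      Real.log_rpow (hIrp m2)] at h5
    simpa using h5
  -- errors
  set e : Fin k1 × Fin k2 → ℝ := fun m => (((gaussVec N1 n).prod (gaussVec (N1 + s) n))
      {z : (Fin n → ℝ) × (Fin n → ℝ) |
        ¬ (g1 (fun t => f m t + z.1 t, m.2) = m.1 ∧
           g2 (fun t => f m t + z.2 t) = m.2)}).toReal with he
  have he1 : ∀ m, (gaussVec N1 n {z | g1 (f m + z, m.2) ≠ m.1}).toReal ≤ e m := fun m =>
    prod_err_left (gaussVec N1 n) (gaussVec (N1 + s) n) (fun z => g1 (fun t => f m t + z t, m.2) = m.1)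
      (fun z => g2 (fun t => f m t + z t) = m.2)
  have he2 : ∀ m, (gaussVec (N1 + s) n {z | g2 (f m + z) ≠ m.2}).toReal ≤ e m := fun m =>
    prod_err_right (gaussVec N1 n) (gaussVec (N1 + s) n) (fun z => g1 (fun t => f m t + z t, m.2) = m.1)
      (fun z => g2 (fun t => f m t + z t) = m.2)
  have hl1 : Real.log (ε / k1) ≤ 0 := Real.log_nonpos c1.le
    ((div_le_self h0.le (by exact_mod_cast hk1)).trans h1.le)
  have hl2 : Real.log (ε / k2) ≤ 0 := Real.log_nonpos c2.le
    ((div_le_self h0.le (by exact_mod_cast hk2)).trans h1.le)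
  have s1 := sum_err hk1 hk2 e _ herr hl1 he1
  have s2 := sum_err hk1 hk2 e _ herr hl2 he2
  -- lower bound of each term
  have hlow : ∀ m : Fin k1 × Fin k2,
      (μ * (-(n/2) * (Real.log (2 * Real.pi * Q) + 1) + Real.log (1 - ε)) + Real.log (1 - ε)) +
      (μ * ((gaussVec (N1 + s) n {z | g2 (f m + z) ≠ m.2}).toReal * Real.log (ε / k2)) +
      (gaussVec N1 n {z | g1 (f m + z, m.2) ≠ m.1}).toReal * Real.log (ε / k1)) ≤
      cv N1 (fun y => μ * cv s (h m.2) y) (f m) + cv N1 (fun y => Real.log (d1 m.2 m.1 y)) (f m) := by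
    rintro ⟨m1, m2⟩
    have b1 := d1b m2 m1 m1
    have b2 := d2b m2 (m1, m2)
    have e1 : cv N1 (fun y => μ * cv s (h m2) y) (f (m1, m2)) = μ *
        (cv (N1 + s) (fun y => Real.log (gd Q n y)) (f (m1, m2)) +
          cv (N1 + s) (fun y => Real.log (d2 m2 y)) (f (m1, m2))) := by
      rw [cv_const_mul, cv_cv (hq m2)]
      simp only [hh]
      rw [cv_add (QB_log_gd hQ0 n) (q2 m2)]
    have e2 : -(n/2) * (Real.log (2 * Real.pi * Q) + 1) ≤
        cv (N1 + s) (fun y => Real.log (gd Q n y)) (f (m1, m2)) := by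
      rw [cv_log_gd hQ0]
      have : (∑ t, f (m1, m2) t ^ 2 + n * ((N1 + s : ℝ≥0) : ℝ)) / (2 * Q) ≤ n / 2 := by
        rw [div_le_iff₀ (by positivity), hQv]
        push_cast
        have := hpow (m1, m2)
        nlinarith
      linarith
    rw [e1]
    have := mul_le_mul_of_nonneg_left (add_le_add e2 b2) hμ0.le
    simp only at this b1 ⊢
    nlinarith
  have hL := Finset.sum_le_sum fun m (_ : m ∈ (Finset.univ : Finset (Fin k1 × Fin k2))) => hlow m
  have hLs : ∀ (K a b : ℝ) (E1 E2 : Fin k1 × Fin k2 → ℝ),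
      ∑ m : Fin k1 × Fin k2, (K + (μ * (E2 m * b) + E1 m * a)) =
      k1 * k2 * K + (μ * ∑ m, E2 m * b + ∑ m, E1 m * a) := by
    intro K a b E1 E2
    rw [Finset.sum_add_distrib, Finset.sum_add_distrib, ← Finset.mul_sum]
    simp
  rw [hLs _ _ _ (fun m => (gaussVec N1 n {z | g1 (f m + z, m.2) ≠ m.1}).toReal)
    (fun m => (gaussVec (N1 + s) n {z | g2 (f m + z) ≠ m.2}).toReal)] at hL
  have hR : ∑ m : Fin k1 × Fin k2, (cv N1 (fun y => μ * cv s (h m.2) y) (f m) +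
      cv N1 (fun y => Real.log (d1 m.2 m.1 y)) (f m)) ≤ ∑ m2 : Fin k2, (k1 *
      (-(n/2) * (Real.log (2 * Real.pi * N1) + 1) + (n * LC σ s + μ * Real.log (Ir m2))
        - Real.log k1)) := by
    rw [Fintype.sum_prod_type_right]
    exact Finset.sum_le_sum fun m2 _ => hinfo m2
  have hR2 : ∑ m2 : Fin k2, (k1 *
      (-(n/2) * (Real.log (2 * Real.pi * N1) + 1) + (n * LC σ s + μ * Real.log (Ir m2))
        - Real.log k1)) ≤ k1 * k2 * (-(n/2) * (Real.log (2 * Real.pi * N1) + 1) +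
        n * LC σ s - μ * Real.log k2 - Real.log k1) := by
    have h6 : ∀ m2 : Fin k2, k1 *
      (-(n/2) * (Real.log (2 * Real.pi * N1) + 1) + (n * LC σ s + μ * Real.log (Ir m2))
        - Real.log k1) = k1 * (-(n/2) * (Real.log (2 * Real.pi * N1) + 1) + n * LC σ s
        - Real.log k1) + (k1 * μ) * Real.log (Ir m2) := fun m2 => by ring
    simp only [h6]
    rw [Finset.sum_add_distrib, ← Finset.mul_sum, ← Finset.mul_sum]
    simp only [Finset.sum_const, Finset.card_univ, Fintype.card_fin, nsmul_eq_mul]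
    have := mul_le_mul_of_nonneg_left hlogI (by positivity : 0 ≤ k1 * μ)
    linarith
  have s2' := mul_le_mul_of_nonneg_left s2 hμ0.le
  have hfin : (k1:ℝ) * k2 * ((μ * (-(n/2) * (Real.log (2 * Real.pi * Q) + 1) + Real.log (1 - ε))
      + Real.log (1 - ε)) + (μ * (ε * Real.log (ε / k2)) + ε * Real.log (ε / k1))) ≤
      k1 * k2 * (-(n/2) * (Real.log (2 * Real.pi * N1) + 1) +
        n * LC σ s - μ * Real.log k2 - Real.log k1) := by
    linarith
  have hfin2 := le_of_mul_le_mul_left hfin (by positivity)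
  have hpi : (2 * Real.pi) ≠ 0 := by positivity
  have hss : ((σ:ℝ) + s) ≠ 0 := by positivity
  unfold LC at hfin2
  rw [← hμ] at hfin2
  rw [Real.log_mul hpi hQ'.ne', Real.log_mul hpi hN1'.ne', Real.log_mul hpi hσ'.ne',
    Real.log_mul hpi hss, Real.log_div h0.ne' hk1'.ne', Real.log_div h0.ne' hk2'.ne', hQv] at hfin2
  linarith

lemma gd_lower {P : ℝ} {N Q : ℝ≥0} (hN : N ≠ 0) (hQv : (Q:ℝ) = P + N) (hP : 0 ≤ P) {n : ℕ}
    {x : Fin n → ℝ} (hx : ∑ t, x t ^ 2 ≤ n * P) :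
    -(n/2) * (Real.log (2 * Real.pi * Q) + 1) ≤ cv N (fun y => Real.log (gd Q n y)) x := by
  have hN' : (0:ℝ) < N := by positivity
  have hQ' : (0:ℝ) < Q := by rw [hQv]; positivity
  have hQ0 : Q ≠ 0 := by
    intro h; rw [h] at hQ'; simp at hQ'
  rw [cv_log_gd hQ0]
  have : (∑ t, x t ^ 2 + n * (N : ℝ)) / (2 * Q) ≤ n / 2 := by
    rw [div_le_iff₀ (by positivity), hQv]
    nlinarith
  linarith

lemma conv2 {P : ℝ} (hP : 0 ≤ P) {N1 s : ℝ≥0} (hN1 : N1 ≠ 0)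
    {n k1 k2 : ℕ} (hk1 : 0 < k1) (hk2 : 0 < k2)
    (f : Fin k1 × Fin k2 → Fin n → ℝ) (g1 : (Fin n → ℝ) → Fin k1)
    (g2 : (Fin n → ℝ) × Fin k1 → Fin k2) (hpow : ∀ m, ∑ t, (f m t) ^ 2 ≤ (n : ℝ) * P)
    {ε : ℝ} (h0 : 0 < ε) (h1 : ε < 1) (herr : gErrP2 N1 (N1 + s) n k1 k2 f g1 g2 ≤ ε) :
    (1 - ε) * Real.log k2 ≤
      n * (1/2 * (Real.log (P + (N1 + s)) - Real.log (N1 + s)))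
      - (Real.log (1 - ε) + ε * Real.log ε) ∧
    (1 - ε) * (Real.log k1 + Real.log k2) ≤
      n * (1/2 * (Real.log (P + N1) - Real.log N1))
      - 2 * (Real.log (1 - ε) + ε * Real.log ε) := by
  have hN1' : (0:ℝ) < N1 := by positivity
  have hk1' : (0:ℝ) < k1 := by positivity
  have hk2' : (0:ℝ) < k2 := by positivity
  have : Nonempty (Fin k1) := ⟨⟨0, hk1⟩⟩
  have : Nonempty (Fin k2) := ⟨⟨0, hk2⟩⟩
  have hN2 : N1 + s ≠ 0 := by
    intro h; exact hN1 (by simpa using (add_eq_zero.mp h).1)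
  set Q2 : ℝ≥0 := P.toNNReal + (N1 + s) with hQ2
  set Q1 : ℝ≥0 := P.toNNReal + N1 with hQ1
  have hQ2v : (Q2:ℝ) = P + (N1 + s : ℝ≥0) := by
    rw [hQ2]; push_cast; rw [Real.coe_toNNReal _ hP]
  have hQ1v : (Q1:ℝ) = P + N1 := by rw [hQ1]; push_cast; rw [Real.coe_toNNReal _ hP]
  have hQ2' : (0:ℝ) < Q2 := by rw [hQ2v]; positivity
  have hQ1' : (0:ℝ) < Q1 := by rw [hQ1v]; positivity
  have hQ20 : Q2 ≠ 0 := by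
    intro h; rw [h] at hQ2'; simp at hQ2'
  have hQ10 : Q1 ≠ 0 := by
    intro h; rw [h] at hQ1'; simp at hQ1'
  obtain ⟨d1, d1m, d1l, d1u, d1s, d1b⟩ := decoder_soft N1 f g1 h0 h1
  have hd2 := fun m1 : Fin k1 => decoder_soft (N1 + s) (fun m2 => f (m1, m2))
    (fun y => g2 (y, m1)) h0 h1
  choose d2 d2m d2l d2u d2s d2b using hd2
  simp only [Fintype.card_fin] at d2l d2b d1l d1b
  have c1 : 0 < ε / k1 := by positivity
  have c2 : 0 < ε / k2 := by positivity
  have q1 : ∀ i, QB fun y => Real.log (d1 i y) := fun i => QB_log_of_bdd (d1m i) c1 (d1l i) (d1u i)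
  have q2 : ∀ m1 i, QB fun y => Real.log (d2 m1 i y) := fun m1 i =>
    QB_log_of_bdd (d2m m1 i) c2 (d2l m1 i) (d2u m1 i)
  -- errors
  set e : Fin k1 × Fin k2 → ℝ := fun m => (((gaussVec N1 n).prod (gaussVec (N1 + s) n))
      {z : (Fin n → ℝ) × (Fin n → ℝ) |
        ¬ (g1 (fun t => f m t + z.1 t) = m.1 ∧
           g2 ((fun t => f m t + z.2 t), m.1) = m.2)}).toReal with he
  set E1 : Fin k1 × Fin k2 → ℝ := fun m => (gaussVec N1 n {z | g1 (f m + z) ≠ m.1}).toReal with hE1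
  set E2 : Fin k1 × Fin k2 → ℝ := fun m =>
    (gaussVec (N1 + s) n {z | g2 (f m + z, m.1) ≠ m.2}).toReal with hE2
  have he1 : ∀ m, E1 m ≤ e m := fun m =>
    prod_err_left (gaussVec N1 n) (gaussVec (N1 + s) n) (fun z => g1 (fun t => f m t + z t) = m.1)
      (fun z => g2 (fun t => f m t + z t, m.1) = m.2)
  have he2 : ∀ m, E2 m ≤ e m := fun m =>
    prod_err_right (gaussVec N1 n) (gaussVec (N1 + s) n) (fun z => g1 (fun t => f m t + z t) = m.1)
      (fun z => g2 (fun t => f m t + z t, m.1) = m.2)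
  have hl1 : Real.log (ε / k1) ≤ 0 := Real.log_nonpos c1.le
    ((div_le_self h0.le (by exact_mod_cast hk1)).trans h1.le)
  have hl2 : Real.log (ε / k2) ≤ 0 := Real.log_nonpos c2.le
    ((div_le_self h0.le (by exact_mod_cast hk2)).trans h1.le)
  have s1 := sum_err hk1 hk2 e _ herr hl1 he1
  have s2 := sum_err hk1 hk2 e _ herr hl2 he2
  have hpi : (2 * Real.pi) ≠ 0 := by positivity
  have hexpgd : ∀ {Q : ℝ≥0}, Q ≠ 0 →
      ∫⁻ y, ENNReal.ofReal (Real.exp (Real.log (gd Q n y))) ≤ ENNReal.ofReal 1 := by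
    intro Q hQ
    simp only [fun y => Real.exp_log (gd_pos hQ n y)]
    rw [lintegral_gd hQ]; simp
  constructor
  · have hinfo : ∀ m1 : Fin k1, ∑ m2 : Fin k2, ((-(n/2) * (Real.log (2 * Real.pi * Q2) + 1) +
        Real.log (1 - ε)) + E2 (m1, m2) * Real.log (ε / k2)) ≤ k2 *
        (-(n/2) * (Real.log (2 * Real.pi * (N1 + s : ℝ≥0)) + 1) - Real.log k2) := by
      intro m1
      have h5 := info_bound hN2 (fun m2 => f (m1, m2)) (QB_log_gd hQ20 n)
        (D := fun m2 y => Real.log (d2 m1 m2 y)) (q2 m1) (fun y => by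
          simp only [fun i => Real.exp_log (c2.trans_le (d2l m1 i y))]
          exact d2s m1 y) (J := 1) one_pos (hexpgd hQ20)
      rw [Real.log_one, add_zero, Fintype.card_fin] at h5
      refine le_trans (Finset.sum_le_sum fun m2 _ => ?_) h5
      have b2 := d2b m1 m2 m2
      have e2 := gd_lower hN2 hQ2v hP (hpow (m1, m2))
      simp only [hE2] at b2 ⊢
      linarith
    have hL := Finset.sum_le_sum fun m (_ : m ∈ (Finset.univ : Finset (Fin k1))) => hinfo m
    rw [← Fintype.sum_prod_type (f := fun m : Fin k1 × Fin k2 =>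
      (-(n/2) * (Real.log (2 * Real.pi * Q2) + 1) +
        Real.log (1 - ε)) + E2 m * Real.log (ε / k2)), Finset.sum_add_distrib] at hL
    simp only [Finset.sum_const, Finset.card_univ, Fintype.card_prod, Fintype.card_fin,
      nsmul_eq_mul] at hL
    push_cast at hL
    have hfin : (k1:ℝ) * k2 * ((-(n/2) * (Real.log (2 * Real.pi * Q2) + 1) + Real.log (1 - ε))
        + ε * Real.log (ε / k2)) ≤
        k1 * k2 * (-(n/2) * (Real.log (2 * Real.pi * (N1 + s)) + 1) - Real.log k2) := by
      linarith
    have hfin2 := le_of_mul_le_mul_left hfin (by positivity)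
    have hss : ((N1:ℝ) + s) ≠ 0 := by positivity
    rw [Real.log_mul hpi hQ2'.ne', Real.log_mul hpi hss, Real.log_div h0.ne' hk2'.ne', hQ2v] at hfin2
    push_cast at hfin2
    linarith
  · have h5 := info_bound hN1 f (QB_log_gd hQ10 n)
        (D := fun m y => Real.log (d1 m.1 y) + cv s (fun y => Real.log (d2 m.1 m.2 y)) y)
        (fun m => (q1 m.1).add ((q2 m.1 m.2).cv s)) (fun y => by
          rw [Fintype.sum_prod_type]
          have hin : ∀ m1, ∑ m2, Real.exp (cv s (fun y => Real.log (d2 m1 m2 y)) y) ≤ 1 := by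
            intro m1
            have h6 : ∀ m2, ENNReal.ofReal (Real.exp (cv s (fun y => Real.log (d2 m1 m2 y)) y)) ≤
                ∫⁻ z, ENNReal.ofReal (d2 m1 m2 (y + z)) ∂(gaussVec s n) := by
              intro m2
              have := jensen_exp _ ((q2 m1 m2).integrable s y)
              simp only [fun z => Real.exp_log (c2.trans_le (d2l m1 m2 (y + z)))] at this
              exact this
            have h7 : ENNReal.ofReal (∑ m2, Real.exp (cv s (fun y => Real.log (d2 m1 m2 y)) y)) ≤
                ENNReal.ofReal 1 := by
              rw [ENNReal.ofReal_sum_of_nonneg fun i _ => (Real.exp_pos _).le]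
              refine (Finset.sum_le_sum fun m2 _ => h6 m2).trans ?_
              rw [← lintegral_finsetSum (f := fun m2 z => ENNReal.ofReal (d2 m1 m2 (y + z))) _
                fun i _ => ((d2m m1 i).comp
                  (by fun_prop : Measurable fun z => y + z)).ennreal_ofReal]
              calc _ ≤ ∫⁻ _z : Fin n → ℝ, ENNReal.ofReal 1 ∂(gaussVec s n) := by
                    refine lintegral_mono fun z => ?_
                    rw [← ENNReal.ofReal_sum_of_nonneg fun i _ => c2.le.trans (d2l m1 i _)]
                    exact ENNReal.ofReal_le_ofReal (d2s m1 _)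
                _ = _ := by simp
            rwa [ENNReal.ofReal_le_ofReal_iff zero_le_one] at h7
          calc _ = ∑ m1, d1 m1 y * ∑ m2, Real.exp (cv s (fun y => Real.log (d2 m1 m2 y)) y) := by
                refine Finset.sum_congr rfl fun m1 _ => ?_
                rw [Finset.mul_sum]
                refine Finset.sum_congr rfl fun m2 _ => ?_
                rw [Real.exp_add, Real.exp_log (c1.trans_le (d1l m1 y))]
            _ ≤ ∑ m1, d1 m1 y * 1 := Finset.sum_le_sum fun m1 _ =>
                mul_le_mul_of_nonneg_left (hin m1) (c1.le.trans (d1l m1 y))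
            _ ≤ 1 := by simpa using d1s y) (J := 1) one_pos (hexpgd hQ10)
    rw [Real.log_one, add_zero, Fintype.card_prod, Fintype.card_fin, Fintype.card_fin] at h5
    have hlow : ∑ m : Fin k1 × Fin k2, ((-(n/2) * (Real.log (2 * Real.pi * Q1) + 1) +
        2 * Real.log (1 - ε)) + (E1 m * Real.log (ε / k1) + E2 m * Real.log (ε / k2))) ≤
        ∑ m, (cv N1 (fun y => Real.log (gd Q1 n y)) (f m) +
          cv N1 (fun y => Real.log (d1 m.1 y) + cv s (fun y => Real.log (d2 m.1 m.2 y)) y) (f m)) := by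
      refine Finset.sum_le_sum fun m _ => ?_
      obtain ⟨m1, m2⟩ := m
      rw [cv_add (q1 m1) ((q2 m1 m2).cv s), cv_cv (q2 m1 m2)]
      have b2 := d2b m1 m2 m2
      have b1 := d1b m1 (m1, m2)
      have e2 := gd_lower hN1 hQ1v hP (hpow (m1, m2))
      simp only [hE1, hE2] at b2 b1 ⊢
      linarith
    have hL := hlow.trans h5
    rw [Finset.sum_add_distrib, Finset.sum_add_distrib, Finset.sum_add_distrib] at hL
    simp only [Finset.sum_const, Finset.card_univ, Fintype.card_prod, Fintype.card_fin,
      nsmul_eq_mul] at hL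
    push_cast at hL
    have hfin : (k1:ℝ) * k2 * ((-(n/2) * (Real.log (2 * Real.pi * Q1) + 1) + 2 * Real.log (1 - ε))
        + (ε * Real.log (ε / k1) + ε * Real.log (ε / k2))) ≤
        k1 * k2 * (-(n/2) * (Real.log (2 * Real.pi * N1) + 1) - Real.log (k1 * k2)) := by
      linarith
    have hfin2 := le_of_mul_le_mul_left hfin (by positivity)
    rw [Real.log_mul hpi hQ1'.ne', Real.log_mul hpi hN1'.ne', Real.log_mul hk1'.ne' hk2'.ne',
      Real.log_div h0.ne' hk1'.ne', Real.log_div h0.ne' hk2'.ne', hQ1v] at hfin2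
    linarith

lemma lim_eps {A B C : ℝ} (h : ∀ ε : ℝ, 0 < ε → ε < 1 →
    (1 - ε) * A ≤ B - C * (Real.log (1 - ε) + ε * Real.log ε)) : A ≤ B := by
  have h1 : Filter.Tendsto (fun ε : ℝ => (1 - ε) * A) (nhdsWithin 0 (Set.Ioi 0)) (nhds ((1 - 0) * A)) :=
    (Continuous.tendsto (by fun_prop) 0).mono_left nhdsWithin_le_nhds
  have h2 : Filter.Tendsto (fun ε : ℝ => B - C * (Real.log (1 - ε) + ε * Real.log ε))
      (nhdsWithin 0 (Set.Ioi 0)) (nhds (B - C * (Real.log (1 - 0) + 0 * Real.log 0))) := by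
    have e1 : Filter.Tendsto (fun ε : ℝ => Real.log (1 - ε)) (nhds 0) (nhds (Real.log (1 - 0))) := by
      apply Filter.Tendsto.log
      · exact Continuous.tendsto (by fun_prop) 0
      · norm_num
    have e2 : Filter.Tendsto (fun ε : ℝ => ε * Real.log ε) (nhds 0) (nhds (0 * Real.log 0)) :=
      Real.continuous_mul_log.tendsto 0
    exact (((e1.add e2).const_mul C).const_sub B).mono_left nhdsWithin_le_nhds
  have h3 := le_of_tendsto_of_tendsto h1 h2 (by
    filter_upwards [Ioo_mem_nhdsGT (by norm_num : (0:ℝ) < 1)] with ε hε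
    exact h ε hε.1 hε.2)
  simpa using h3

/-- Dividing by the block length and passing to the limit. -/
lemma rate_step {n : ℕ} (hn : 0 < n) {R L Cc C ε : ℝ} (h0 : 0 < ε) (h1 : ε < 1) (hC : 0 ≤ C)
    (hR : R * n ≤ L) (h : (1 - ε) * L ≤ n * Cc - C * (Real.log (1 - ε) + ε * Real.log ε)) :
    (1 - ε) * R ≤ Cc - C * (Real.log (1 - ε) + ε * Real.log ε) := by
  have hn1 : (1:ℝ) ≤ n := by exact_mod_cast hn
  have hl1 : Real.log (1 - ε) ≤ 0 := Real.log_nonpos (by linarith) (by linarith)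
  have hl2 : ε * Real.log ε ≤ 0 := mul_nonpos_of_nonneg_of_nonpos h0.le
    (Real.log_nonpos h0.le h1.le)
  set K := - (C * (Real.log (1 - ε) + ε * Real.log ε)) with hK
  have hK0 : 0 ≤ K := by rw [hK]; nlinarith
  have e1 : (1 - ε) * (R * n) ≤ (1 - ε) * L := mul_le_mul_of_nonneg_left hR (by linarith)
  have e2 : K ≤ n * K := by nlinarith
  have : n * ((1 - ε) * R) ≤ n * (Cc + K) := by nlinarith
  have := le_of_mul_le_mul_left this (by linarith)
  linarith

lemma rate_log {R : ℝ} {n k : ℕ} (hn : 0 < n) (h : R ≤ Real.logb 2 (k:ℝ) / n) :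
    R * Real.log 2 * n ≤ Real.log k := by
  have hn' : (0:ℝ) < n := by positivity
  have hl : 0 < Real.log 2 := Real.log_pos (by norm_num)
  rw [le_div_iff₀ hn', Real.logb, le_div_iff₀ hl] at h
  linarith

lemma conv1_lim {P : ℝ} (hP : 0 ≤ P) {N1 s σ : ℝ≥0} (hN1 : N1 ≠ 0) (hσ : σ ≠ 0) {R : ℝ × ℝ}
    (hR : gAch1 P N1 (N1 + s) R) : (R.1 + (σ + s) / σ * R.2) * Real.log 2 ≤
      1/2 * (Real.log σ - Real.log N1) + (σ + s) / σ / 2 *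
        (Real.log (P + (N1 + s)) - Real.log (σ + s)) := by
  have hσ' : (0:ℝ) < σ := by positivity
  refine lim_eps (C := 1 + (σ + s) / σ) fun ε h0 h1 => ?_
  obtain ⟨_, _, hR⟩ := hR
  obtain ⟨n, k1, k2, hn, hk1, hk2, f, g1, g2, hpow, r1, r2, herr⟩ := hR ε h0
  have h := conv1 hP hN1 hσ hk1 hk2 f g1 g2 hpow h0 h1 herr
  refine rate_step hn h0 h1 (by positivity) ?_ h
  have a1 := rate_log hn r1
  have a2 := rate_log hn r2
  have := mul_le_mul_of_nonneg_left a2 (by positivity : (0:ℝ) ≤ (σ + s) / σ)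
  linarith

lemma conv2_lim {P : ℝ} (hP : 0 ≤ P) {N1 s : ℝ≥0} (hN1 : N1 ≠ 0) {R : ℝ × ℝ}
    (hR : gAch2 P N1 (N1 + s) R) :
    R.2 * Real.log 2 ≤ 1/2 * (Real.log (P + (N1 + s)) - Real.log (N1 + s)) ∧
    (R.1 + R.2) * Real.log 2 ≤ 1/2 * (Real.log (P + N1) - Real.log N1) := by
  obtain ⟨_, _, hR⟩ := hR
  constructor
  · refine lim_eps (C := 1) fun ε h0 h1 => ?_
    obtain ⟨n, k1, k2, hn, hk1, hk2, f, g1, g2, hpow, r1, r2, herr⟩ := hR ε h0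
    have h := (conv2 hP hN1 hk1 hk2 f g1 g2 hpow h0 h1 herr).1
    refine rate_step hn h0 h1 (by positivity) (rate_log hn r2) (by rw [one_mul]; exact h)
  · refine lim_eps (C := 2) fun ε h0 h1 => ?_
    obtain ⟨n, k1, k2, hn, hk1, hk2, f, g1, g2, hpow, r1, r2, herr⟩ := hR ε h0
    have h := (conv2 hP hN1 hk1 hk2 f g1 g2 hpow h0 h1 herr).2
    refine rate_step hn h0 h1 (by positivity) ?_ h
    have a1 := rate_log hn r1
    have a2 := rate_log hn r2
    linarith

def region1 (P : ℝ) (N1 N2 : ℝ≥0) : Set (ℝ × ℝ) :=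
  {R : ℝ × ℝ | 0 ≤ R.1 ∧ 0 ≤ R.2 ∧ ∃ β ∈ Set.Icc (0:ℝ) 1,
      R.1 ≤ (1/2) * Real.logb 2 ((β * P + N1) / N1) ∧
      R.2 ≤ (1/2) * Real.logb 2 ((P + N2) / (β * P + N2))}

def region2 (P : ℝ) (N1 N2 : ℝ≥0) : Set (ℝ × ℝ) :=
  {R : ℝ × ℝ | 0 ≤ R.1 ∧ 0 ≤ R.2 ∧
      R.2 ≤ (1/2) * Real.logb 2 ((P + N2) / N2) ∧
      R.1 + R.2 ≤ (1/2) * Real.logb 2 ((P + N1) / N1)}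

lemma le_logb_iff {R a b : ℝ} (ha : 0 < a) (hb : 0 < b) :
    R ≤ (1/2) * Real.logb 2 (a / b) ↔ R * Real.log 2 ≤ 1/2 * (Real.log a - Real.log b) := by
  have h2 : 0 < Real.log 2 := Real.log_pos (by norm_num)
  rw [Real.logb, Real.log_div ha.ne' hb.ne', ← mul_div_assoc, le_div_iff₀ h2]

lemma gAch1_of_gAch0 {P : ℝ} {N1 N2 : ℝ≥0} {R : ℝ × ℝ} (h : gAch0 P N1 N2 R) :
    gAch1 P N1 N2 R := by
  refine ⟨h.1, h.2.1, fun ε hε => ?_⟩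
  obtain ⟨n, k1, k2, hn, hk1, hk2, f, g1, g2, h1, h2, h3, h4⟩ := h.2.2 ε hε
  exact ⟨n, k1, k2, hn, hk1, hk2, f, fun p => g1 p.1, g2, h1, h2, h3, h4⟩

lemma gCap_sub_gCap1 (P : ℝ) (N1 N2 : ℝ≥0) : gCap P N1 N2 ⊆ gCap1 P N1 N2 :=
  closure_mono fun _ h => gAch1_of_gAch0 h

lemma gCap2_sub {P : ℝ} (hP : 0 ≤ P) {N1 s : ℝ≥0} (hN1 : N1 ≠ 0) :
    gCap2 P N1 (N1 + s) ⊆ region2 P N1 (N1 + s) := by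
  have hN1' : (0:ℝ) < N1 := by exact_mod_cast pos_iff_ne_zero.mpr hN1
  have hs : (0:ℝ) ≤ s := s.2
  refine closure_minimal (fun R hR => ?_) ?_
  · have h := conv2_lim hP hN1 hR
    refine ⟨hR.1, hR.2.1, ?_, ?_⟩
    · rw [le_logb_iff (by push_cast; positivity) (by push_cast; positivity)]
      push_cast
      exact h.1
    · rw [le_logb_iff (by push_cast; positivity) (by push_cast; positivity)]
      exact h.2
  · unfold region2
    exact (isClosed_le continuous_const continuous_fst).inter
      ((isClosed_le continuous_const continuous_snd).inter
      ((isClosed_le continuous_snd continuous_const).inter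
       (isClosed_le (continuous_fst.add continuous_snd) continuous_const)))

lemma gCap1_sub {P : ℝ} (hP : 0 ≤ P) {N1 s : ℝ≥0} (hN1 : N1 ≠ 0) :
    gCap1 P N1 (N1 + s) ⊆ region1 P N1 (N1 + s) := by
  have hN1' : (0:ℝ) < N1 := by exact_mod_cast pos_iff_ne_zero.mpr hN1
  have hs : (0:ℝ) ≤ s := s.2
  have h2 : 0 < Real.log 2 := Real.log_pos (by norm_num)
  have hsub : gCap1 P N1 (N1 + s) ⊆ {R : ℝ × ℝ | 0 ≤ R.1} ∩ ({R : ℝ × ℝ | 0 ≤ R.2} ∩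
      ⋂ σ : {σ : ℝ≥0 // σ ≠ 0}, {R : ℝ × ℝ |
        (R.1 + ((σ.1:ℝ)+s)/σ.1*R.2)*Real.log 2 ≤ 1/2*(Real.log σ.1 - Real.log N1) +
          ((σ.1:ℝ)+s)/σ.1/2*(Real.log (P+(N1+s)) - Real.log (σ.1+s))}) := by
    refine closure_minimal (fun R hR => ?_) ?_
    · refine ⟨hR.1, hR.2.1, ?_⟩
      simp only [Set.mem_iInter]
      intro σ
      exact conv1_lim hP hN1 σ.2 hR
    · refine (isClosed_le continuous_const continuous_fst).inter
        ((isClosed_le continuous_const continuous_snd).inter (isClosed_iInter fun σ => ?_))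
      exact isClosed_le (by fun_prop) continuous_const
  refine hsub.trans ?_
  rintro ⟨R1, R2⟩ ⟨h1, h2', h3⟩
  simp only [Set.mem_iInter] at h3
  have key : ∀ σ : ℝ, 0 < σ → (R1 + (σ+s)/σ*R2)*Real.log 2 ≤ 1/2*(Real.log σ - Real.log N1) +
          (σ+s)/σ/2*(Real.log (P+(N1+s)) - Real.log (σ+s)) := by
    intro σ hσ
    have := h3 ⟨⟨σ, hσ.le⟩, fun h => hσ.ne' (congrArg NNReal.toReal h)⟩
    exact this
  have h1 : 0 ≤ R1 := h1
  have h2' : 0 ≤ R2 := h2'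
  refine ⟨h1, h2', ?_⟩
  -- choose σ = N1 * 4^{R1}
  set σ : ℝ := N1 * Real.exp (2 * R1 * Real.log 2) with hσdef
  have hσ : 0 < σ := by positivity
  have hlσ : Real.log σ = Real.log N1 + 2 * R1 * Real.log 2 := by
    rw [hσdef, Real.log_mul hN1'.ne' (Real.exp_pos _).ne', Real.log_exp]
  have hσN : (N1:ℝ) ≤ σ := by
    rw [hσdef]
    have : 1 ≤ Real.exp (2 * R1 * Real.log 2) := Real.one_le_exp (by positivity)
    nlinarith
  have hPN : 0 < P + N1 := by positivity
  have hσP : σ ≤ P + N1 := by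
    have := key (P + N1) hPN
    rw [show P + (N1 + (s:ℝ)) = P + N1 + s by ring, sub_self, mul_zero, add_zero] at this
    have hnn : 0 ≤ (P + N1 + s)/(P + N1) * R2 := by positivity
    have h5 : R1 * Real.log 2 ≤ 1/2*(Real.log (P + N1) - Real.log N1) := by nlinarith
    rw [← Real.log_le_log_iff hσ hPN, hlσ]
    linarith
  have hk := key σ hσ
  have hσs : 0 < (σ + s)/σ := by positivity
  have hk2 : R2 * Real.log 2 ≤ 1/2 * (Real.log (P+(N1+s)) - Real.log (σ+s)) := by
    refine le_of_mul_le_mul_left ?_ hσs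
    rw [hlσ] at hk
    nlinarith
  by_cases hP0 : P = 0
  · subst hP0
    have hσe : σ = N1 := le_antisymm (by simpa using hσP) hσN
    refine ⟨0, by simp, ?_, ?_⟩
    · rw [le_logb_iff (by positivity) hN1']
      rw [hσe] at hlσ
      simp only [mul_zero, zero_add]
      linarith
    · rw [le_logb_iff (by push_cast; positivity) (by push_cast; positivity)]
      rw [hσe] at hk2
      push_cast
      simpa using hk2
  · have hPp : 0 < P := lt_of_le_of_ne hP (Ne.symm hP0)
    have hb : (σ - N1) / P * P + N1 = σ := by field_simp; ring
    refine ⟨(σ - N1) / P, ⟨div_nonneg (by linarith) hP, (div_le_one hPp).2 (by linarith)⟩, ?_, ?_⟩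
    · rw [hb, le_logb_iff hσ hN1', hlσ]
      linarith
    · have hb2 : (σ - N1) / P * P + ((N1 + s : ℝ≥0) : ℝ) = σ + s := by
        push_cast; linarith
      rw [hb2, le_logb_iff (by push_cast; positivity) (by positivity)]
      push_cast
      exact hk2

lemma memLp_sq_gr (N : ℝ≥0) : MemLp (fun x : ℝ => x ^ 2) 2 (gaussianReal 0 N) := by
  rw [memLp_two_iff_integrable_sq (by fun_prop)]
  have h := (memLp_id_gaussianReal (μ := 0) (v := N) 4).integrable_norm_pow (p := 4) (by norm_num)
  refine h.congr (Filter.Eventually.of_forall fun x => ?_)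
  simp only [id, Real.norm_eq_abs]
  rw [show |x| ^ 4 = (|x| ^ 2) ^ 2 by ring, sq_abs]

/-- concentration of the squared norm -/
lemma conc {N : ℝ≥0} (hN : N ≠ 0) {δ : ℝ} (hδ : 0 < δ) :
    Filter.Tendsto (fun n : ℕ => gaussVec N n {z | n * N * δ ≤ |∑ t, z t ^ 2 - n * N|})
      Filter.atTop (nhds 0) := by
  have hN' : (0:ℝ) < N := by exact_mod_cast pos_iff_ne_zero.mpr hN
  set K := Var[fun x : ℝ => x ^ 2; gaussianReal 0 N] with hK
  have hb : ∀ n : ℕ, 0 < n → gaussVec N n {z | n * N * δ ≤ |∑ t, z t ^ 2 - n * N|} ≤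
      ENNReal.ofReal (K / (N * δ) ^ 2 * (1 / (n:ℝ))) := by
    intro n hn
    have hn' : (0:ℝ) < n := by exact_mod_cast hn
    have hm : MemLp (fun z : Fin n → ℝ => ∑ t, z t ^ 2) 2 (gaussVec N n) := by
      refine memLp_finsetSum _ fun t _ => ?_
      exact (memLp_sq_gr N).comp_measurePreserving (mp_eval N n t)
    have hmean : ∫ z, ∑ t, z t ^ 2 ∂(gaussVec N n) = n * N := by
      have := integral_shift_sq N n 0
      simpa using this
    have hvar : Var[fun z : Fin n → ℝ => ∑ t, z t ^ 2; gaussVec N n] = n * K := by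
      have := variance_sum_pi (ι := Fin n) (μ := fun _ => gaussianReal 0 N)
        (X := fun _ x => x ^ 2) (fun _ => memLp_sq_gr N)
      have he : (∑ i : Fin n, fun ω : Fin n → ℝ => (ω i) ^ 2) = fun z => ∑ t, z t ^ 2 := by
        ext z; simp
      rw [he] at this
      unfold gaussVec
      rw [this]
      simp [hK]
    have h := meas_ge_le_variance_div_sq hm (c := n * N * δ) (by positivity)
    rw [hmean, hvar] at h
    refine h.trans (ENNReal.ofReal_le_ofReal (le_of_eq ?_))
    field_simp
  have hlim : Filter.Tendsto (fun n : ℕ => ENNReal.ofReal (K / (N * δ) ^ 2 * (1 / (n:ℝ))))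
      Filter.atTop (nhds 0) := by
    have := (tendsto_one_div_atTop_nhds_zero_nat (𝕜 := ℝ)).const_mul (K / (N * δ) ^ 2)
    rw [mul_zero] at this
    simpa using ENNReal.tendsto_ofReal this
  refine tendsto_of_tendsto_of_tendsto_of_le_of_le' tendsto_const_nhds hlim
    (Filter.Eventually.of_forall fun _ => bot_le) ?_
  filter_upwards [Filter.eventually_gt_atTop 0] with n hn using hb n hn

/-- threshold test -/
def Tst (a b : ℝ≥0) (γ : ℝ) {n : ℕ} (x y : Fin n → ℝ) : Prop :=
  Real.exp (n * γ) * gd (a + b) n y ≤ gd b n (y - x)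

lemma measurableSet_Tst (a b : ℝ≥0) (γ : ℝ) (n : ℕ) :
    MeasurableSet {p : (Fin n → ℝ) × (Fin n → ℝ) | Tst a b γ p.1 p.2} := by
  unfold Tst
  exact measurableSet_le (((measurable_gd _ n).comp measurable_snd).const_mul _)
    ((measurable_gd _ n).comp (measurable_snd.sub measurable_fst))

/-- wrong codewords pass the test with small probability -/
lemma Tst_wrong {a b : ℝ≥0} (ha : a ≠ 0) (hb : b ≠ 0) (γ : ℝ) (n : ℕ) :
    ((gaussVec a n).prod (gaussVec (a + b) n)) {p | Tst a b γ p.1 p.2} ≤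
      ENNReal.ofReal (Real.exp (-(n * γ))) := by
  have hab : a + b ≠ 0 := by simp [ha]
  rw [Measure.prod_apply (measurableSet_Tst a b γ n)]
  have hx : ∀ x, gaussVec (a + b) n (Prod.mk x ⁻¹' {p | Tst a b γ p.1 p.2}) ≤
      ENNReal.ofReal (Real.exp (-(n * γ))) := by
    intro x
    have hms : MeasurableSet (Prod.mk x ⁻¹' {p : (Fin n → ℝ) × (Fin n → ℝ) | Tst a b γ p.1 p.2}) :=
      measurable_prodMk_left (measurableSet_Tst a b γ n)
    rw [gaussVec_eq hab, withDensity_apply _ hms, ← lintegral_indicator hms]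
    calc _ ≤ ∫⁻ y, ENNReal.ofReal (Real.exp (-(n * γ))) * ENNReal.ofReal (gd b n (y - x)) := by
          refine lintegral_mono fun y => ?_
          by_cases hy : y ∈ Prod.mk x ⁻¹' {p : (Fin n → ℝ) × (Fin n → ℝ) | Tst a b γ p.1 p.2}
          · rw [Set.indicator_of_mem hy, ← ENNReal.ofReal_mul (Real.exp_pos _).le]
            apply ENNReal.ofReal_le_ofReal
            have hy' : Real.exp (n * γ) * gd (a + b) n y ≤ gd b n (y - x) := hy
            calc gd (a + b) n y = Real.exp (-(n * γ)) * (Real.exp (n * γ) * gd (a + b) n y) := by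
                  rw [← mul_assoc, ← Real.exp_add]; simp
              _ ≤ _ := mul_le_mul_of_nonneg_left hy' (Real.exp_pos _).le
          · rw [Set.indicator_of_notMem hy]; exact bot_le
      _ = ENNReal.ofReal (Real.exp (-(n * γ))) := by
          rw [lintegral_const_mul _ (by
            exact ((measurable_gd b n).comp (measurable_id.sub_const x)).ennreal_ofReal)]
          rw [lintegral_sub_right_eq_self (fun y => ENNReal.ofReal (gd b n y)) x, lintegral_gd hb,
            mul_one]
  calc _ ≤ ∫⁻ _, ENNReal.ofReal (Real.exp (-(n * γ))) ∂(gaussVec a n) := lintegral_mono hx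
    _ = _ := by simp

/-- the right codeword passes the test with high probability -/
lemma Tst_right {a b : ℝ≥0} (ha : a ≠ 0) (hb : b ≠ 0) {γ : ℝ}
    (hγ : γ < 1/2 * (Real.log (a + b) - Real.log b)) :
    Filter.Tendsto (fun n : ℕ => ((gaussVec a n).prod (gaussVec b n))
      {p | ¬ Tst a b γ p.1 (p.1 + p.2)}) Filter.atTop (nhds 0) := by
  have hab : a + b ≠ 0 := by simp [ha]
  have hb' : (0:ℝ) < b := by exact_mod_cast pos_iff_ne_zero.mpr hb
  have ha' : (0:ℝ) < a := by exact_mod_cast pos_iff_ne_zero.mpr ha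
  set δ := 1/2 * (Real.log (a + b) - Real.log b) - γ with hδd
  have hδ : 0 < δ := by linarith
  have hl := (conc hb hδ).add (conc hab hδ)
  rw [add_zero] at hl
  refine tendsto_of_tendsto_of_tendsto_of_le_of_le tendsto_const_nhds hl
    (fun _ => bot_le) (fun n => ?_)
  have m1 : ∀ N : ℝ≥0, MeasurableSet {z : Fin n → ℝ | n * N * δ ≤ |∑ t, z t ^ 2 - n * N|} := by
    intro N
    exact measurableSet_le measurable_const (by fun_prop)
  have hmp : MeasurePreserving (fun p : (Fin n → ℝ) × (Fin n → ℝ) => p.1 + p.2)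
      ((gaussVec a n).prod (gaussVec b n)) (gaussVec (a + b) n) :=
    ⟨measurable_fst.add measurable_snd, gaussVec_add a b n⟩
  have hmp2 : MeasurePreserving (Prod.snd : (Fin n → ℝ) × (Fin n → ℝ) → _)
      ((gaussVec a n).prod (gaussVec b n)) (gaussVec b n) := measurePreserving_snd
  simp only
  rw [← hmp2.measure_preimage (m1 b).nullMeasurableSet,
    ← hmp.measure_preimage (m1 (a + b)).nullMeasurableSet]
  refine (measure_mono ?_).trans (measure_union_le _ _)
  rintro ⟨x, w⟩ hp
  by_contra hcon
  simp only [Set.mem_union, Set.mem_preimage, Set.mem_ofPred_eq, not_or, not_le, abs_lt] at hcon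
  apply hp
  obtain ⟨⟨-, h1⟩, ⟨h2, -⟩⟩ := hcon
  simp only [Tst]
  rw [add_sub_cancel_left, ← Real.log_le_log_iff (by have := gd_pos hab n (x + w); positivity)
    (gd_pos hb n w), Real.log_mul (Real.exp_pos _).ne' (gd_pos hab n _).ne', Real.log_exp,
    log_gd hb, log_gd hab]
  have hpi : 2 * Real.pi ≠ 0 := by positivity
  push_cast at h2 ⊢
  rw [Real.log_mul hpi hb'.ne', Real.log_mul hpi (by positivity)]
  have e1 : (1/(2*(b:ℝ))) * ∑ t, w t ^ 2 ≤ n/2 * (1 + δ) := by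
    rw [div_mul_eq_mul_div, one_mul, div_le_iff₀ (by positivity)]
    nlinarith
  have e2 : n/2 * (1 - δ) ≤ (1/(2*((a:ℝ)+b))) * ∑ t, (x + w) t ^ 2 := by
    rw [one_div_mul_eq_div, le_div_iff₀ (by positivity)]
    nlinarith
  have e3 : (n:ℝ) * γ = n * (1/2 * (Real.log (a + b) - Real.log b)) - n * δ := by
    rw [hδd]; ring
  nlinarith

/-- event that the threshold decoder may fail -/
def bad {Ω ι : Type*} {n : ℕ} (a b : ℝ≥0) (γ : ℝ) (x : ι → Ω → Fin n → ℝ) (m : ι) :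
    Set (Ω × (Fin n → ℝ)) :=
  {p | ¬ Tst a b γ (x m p.1) (x m p.1 + p.2)} ∪
    ⋃ m' : {m' : ι // m' ≠ m}, {p | Tst a b γ (x m'.1 p.1) (x m p.1 + p.2)}

/-- threshold decoder -/
def dec {ι : Type*} [Nonempty ι] {n : ℕ} (a b : ℝ≥0) (γ : ℝ) (c : ι → Fin n → ℝ)
    (y : Fin n → ℝ) : ι :=
  Classical.epsilon fun m => Tst a b γ (c m) y

lemma dec_eq {Ω ι : Type*} [Nonempty ι] {n : ℕ} {a b : ℝ≥0} {γ : ℝ} {x : ι → Ω → Fin n → ℝ} {m : ι}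
    {ω : Ω} {w : Fin n → ℝ} (h : (ω, w) ∉ bad a b γ x m) :
    dec a b γ (fun m => x m ω) (x m ω + w) = m := by
  simp only [bad, Set.mem_union, Set.mem_ofPred_eq, Set.mem_iUnion, not_or, not_not,
    not_exists] at h
  have h1 : Tst a b γ (x (dec a b γ (fun m => x m ω) (x m ω + w)) ω) (x m ω + w) :=
    Classical.epsilon_spec (p := fun m' => Tst a b γ (x m' ω) (x m ω + w)) ⟨m, h.1⟩
  by_contra hne
  exact h.2 ⟨_, hne⟩ h1

lemma measurableSet_bad {Ω ι : Type*} [MeasurableSpace Ω] [Finite ι] {n : ℕ} (a b : ℝ≥0) (γ : ℝ)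
    {x : ι → Ω → Fin n → ℝ} (hx : ∀ m, Measurable (x m)) (m : ι) :
    MeasurableSet (bad a b γ x m) := by
  have key : ∀ m', Measurable (fun p : Ω × (Fin n → ℝ) => (x m' p.1, x m p.1 + p.2)) := fun m' =>
    ((hx m').comp measurable_fst).prodMk (((hx m).comp measurable_fst).add measurable_snd)
  unfold bad
  refine MeasurableSet.union ?_ (MeasurableSet.iUnion fun m' => ?_)
  · exact (key m (measurableSet_Tst a b γ n)).compl
  · exact key m'.1 (measurableSet_Tst a b γ n)

lemma bad_le {Ω ι : Type*} [MeasurableSpace Ω] [Fintype ι] {n : ℕ} {a b : ℝ≥0}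
    (ha : a ≠ 0) (hb : b ≠ 0) (γ : ℝ)
    (μ : Measure Ω) [IsProbabilityMeasure μ]
    {x : ι → Ω → Fin n → ℝ} (hx : ∀ m, MeasurePreserving (x m) μ (gaussVec a n))
    (hxx : ∀ m' m, m' ≠ m → MeasurePreserving (fun ω => (x m' ω, x m ω)) μ
      ((gaussVec a n).prod (gaussVec a n))) (m : ι) :
    (μ.prod (gaussVec b n)) (bad a b γ x m) ≤
      ((gaussVec a n).prod (gaussVec b n)) {p | ¬ Tst a b γ p.1 (p.1 + p.2)} +
      ENNReal.ofReal ((Fintype.card ι : ℝ) * Real.exp (-(n * γ))) := by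
  unfold bad
  refine (measure_union_le _ _).trans (add_le_add ?_ ?_)
  · have hmp := (hx m).prod (MeasurePreserving.id (gaussVec b n))
    rw [← hmp.measure_preimage]
    · exact le_of_eq rfl
    · have hk : Measurable (fun p : (Fin n → ℝ) × (Fin n → ℝ) => (p.1, p.1 + p.2)) := by fun_prop
      exact (hk (measurableSet_Tst a b γ n)).compl.nullMeasurableSet
  · refine (measure_iUnion_le _).trans ?_
    rw [tsum_fintype]
    have h1 : ∀ m' : {m' : ι // m' ≠ m}, (μ.prod (gaussVec b n))
        {p | Tst a b γ (x m'.1 p.1) (x m p.1 + p.2)} ≤ ENNReal.ofReal (Real.exp (-(n * γ))) := by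
      intro m'
      have e1 := (hxx m'.1 m m'.2).prod (MeasurePreserving.id (gaussVec b n))
      have e2 := measurePreserving_prodAssoc (gaussVec a n) (gaussVec a n) (gaussVec b n)
      have e3 : MeasurePreserving (fun p : (Fin n → ℝ) × (Fin n → ℝ) => p.1 + p.2)
          ((gaussVec a n).prod (gaussVec b n)) (gaussVec (a + b) n) :=
        ⟨measurable_fst.add measurable_snd, gaussVec_add a b n⟩
      have e4 := (MeasurePreserving.id (gaussVec a n)).prod e3
      have e5 := (e4.comp e2).comp e1
      refine le_trans (le_of_eq ?_) (Tst_wrong ha hb γ n)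
      rw [← e5.measure_preimage (measurableSet_Tst a b γ n).nullMeasurableSet]
      rfl
    refine (Finset.sum_le_sum fun m' _ => h1 m').trans ?_
    rw [Finset.sum_const, nsmul_eq_mul, ENNReal.ofReal_mul (by positivity), ENNReal.ofReal_natCast]
    gcongr
    rw [Finset.card_univ]
    exact Fintype.card_subtype_le _

lemma p2p {a b : ℝ≥0} (ha : a ≠ 0) (hb : b ≠ 0) {R : ℝ}
    (hR : R < 1/2 * (Real.log (a + b) - Real.log b)) {ε : ℝ≥0∞} (hε : 0 < ε) :
    ∃ γ : ℝ, ∀ᶠ n : ℕ in Filter.atTop, ∀ (Ω ι : Type) [MeasurableSpace Ω] [Fintype ι]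
      (μ : Measure Ω) [IsProbabilityMeasure μ] (x : ι → Ω → Fin n → ℝ),
      (Fintype.card ι : ℝ) ≤ 4 * Real.exp (n * R) →
      (∀ m, MeasurePreserving (x m) μ (gaussVec a n)) →
      (∀ m' m, m' ≠ m → MeasurePreserving (fun ω => (x m' ω, x m ω)) μ
        ((gaussVec a n).prod (gaussVec a n))) →
      ∀ m, (μ.prod (gaussVec b n)) (bad a b γ x m) ≤ ε := by
  obtain ⟨γ, h1, h2⟩ := exists_between hR
  refine ⟨γ, ?_⟩
  have l1 := Tst_right ha hb h2
  have l2 : Filter.Tendsto (fun n : ℕ => ENNReal.ofReal (4 * Real.exp (-(n * (γ - R)))))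
      Filter.atTop (nhds 0) := by
    have : Filter.Tendsto (fun n : ℕ => 4 * Real.exp (-((n:ℝ) * (γ - R)))) Filter.atTop
        (nhds (4 * 0)) := by
      refine Filter.Tendsto.const_mul _ (Real.tendsto_exp_neg_atTop_nhds_zero.comp ?_)
      exact tendsto_natCast_atTop_atTop.atTop_mul_const (sub_pos.2 h1)
    simpa using ENNReal.tendsto_ofReal this
  have l3 := l1.add l2
  rw [add_zero] at l3
  filter_upwards [l3.eventually_lt_const hε] with n hn Ω ι _ _ μ _ x hc hx hxx m
  refine (bad_le ha hb γ μ hx hxx m).trans (le_trans ?_ hn.le)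
  refine add_le_add le_rfl (ENNReal.ofReal_le_ofReal ?_)
  calc (Fintype.card ι : ℝ) * Real.exp (-(n * γ)) ≤ 4 * Real.exp (n * R) * Real.exp (-(n * γ)) := by
        gcongr
    _ = _ := by rw [mul_assoc, ← Real.exp_add]; ring_nf

lemma mp_pair {ι E : Type*} [Fintype ι] [MeasurableSpace E] (ν : Measure E) [IsProbabilityMeasure ν]
    {i j : ι} (hij : i ≠ j) :
    MeasurePreserving (fun c : ι → E => (c i, c j)) (Measure.pi fun _ : ι => ν) (ν.prod ν) := by
  refine ⟨by fun_prop, ?_⟩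
  have h := (iIndepFun_pi (μ := fun _ : ι => ν) (X := fun _ x => x)
    (fun _ => aemeasurable_id)).indepFun hij
  rw [indepFun_iff_map_prod_eq_prod_map_map (measurable_pi_apply i).aemeasurable
    (measurable_pi_apply j).aemeasurable] at h
  rw [h]
  congr 1
  · exact (measurePreserving_eval (fun _ : ι => ν) i).map_eq
  · exact (measurePreserving_eval (fun _ : ι => ν) j).map_eq

lemma select {Ω Z ι : Type*} [MeasurableSpace Ω] [MeasurableSpace Z] [Fintype ι]
    (μ : Measure Ω) (ν : Measure Z) [IsProbabilityMeasure μ] [IsProbabilityMeasure ν]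
    (B : ι → Set (Ω × Z)) (hB : ∀ m, MeasurableSet (B m)) {ε : ℝ≥0∞}
    (h : ∀ m, μ.prod ν (B m) ≤ ε) :
    ∃ c, ∑ m, ν (Prod.mk c ⁻¹' B m) ≤ Fintype.card ι * ε := by
  have hm : ∀ m, Measurable (fun c => ν (Prod.mk c ⁻¹' B m)) := fun m =>
    measurable_measure_prodMk_left (hB m)
  obtain ⟨c, hc⟩ := exists_le_lintegral (μ := μ) (f := fun c => ∑ m, ν (Prod.mk c ⁻¹' B m))
    (Finset.measurable_sum _ fun m _ => hm m).aemeasurable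
  refine ⟨c, hc.trans ?_⟩
  rw [lintegral_finsetSum _ fun m _ => hm m]
  calc _ = ∑ m, μ.prod ν (B m) := by
        refine Finset.sum_congr rfl fun m _ => ?_
        rw [Measure.prod_apply (hB m)]
    _ ≤ ∑ _m : ι, ε := Finset.sum_le_sum fun m _ => h m
    _ = _ := by simp

/-- power constraint violation -/
lemma power_ev {a : ℝ≥0} (ha : a ≠ 0) {P : ℝ} (haP : (a:ℝ) < P) :
    Filter.Tendsto (fun n : ℕ => gaussVec a n {z | ¬ ∑ t, z t ^ 2 ≤ n * P})
      Filter.atTop (nhds 0) := by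
  have ha' : (0:ℝ) < a := by exact_mod_cast pos_iff_ne_zero.mpr ha
  have hδ : 0 < (P - a) / a := div_pos (by linarith) ha'
  refine tendsto_of_tendsto_of_tendsto_of_le_of_le tendsto_const_nhds (conc ha hδ)
    (fun _ => bot_le) (fun n => measure_mono fun z hz => ?_)
  simp only [Set.mem_ofPred_eq, not_le] at hz ⊢
  rw [mul_assoc, mul_div_cancel₀ _ ha'.ne']
  refine le_trans ?_ (le_abs_self _)
  linarith

lemma ceil_exp {R : ℝ} (hR : 0 ≤ R) {n : ℕ} (hn : 0 < n) :
    0 < ⌈Real.exp (n * (R * Real.log 2))⌉₊ ∧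
    R ≤ Real.logb 2 (⌈Real.exp (n * (R * Real.log 2))⌉₊ : ℝ) / n ∧
    (⌈Real.exp (n * (R * Real.log 2))⌉₊ : ℝ) ≤ 2 * Real.exp (n * (R * Real.log 2)) := by
  have h2 : 0 < Real.log 2 := Real.log_pos (by norm_num)
  have hn' : (0:ℝ) < n := by exact_mod_cast hn
  have hp : 0 < ⌈Real.exp (n * (R * Real.log 2))⌉₊ := Nat.ceil_pos.2 (Real.exp_pos _)
  refine ⟨hp, ?_, ?_⟩
  · rw [le_div_iff₀ hn', Real.logb, le_div_iff₀ h2, Real.le_log_iff_exp_le (by exact_mod_cast hp)]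
    refine le_trans (le_of_eq ?_) (Nat.le_ceil _)
    ring_nf
  · have := Nat.ceil_lt_add_one (Real.exp_pos (n * (R * Real.log 2))).le
    have h1 : 1 ≤ Real.exp (n * (R * Real.log 2)) := Real.one_le_exp (by positivity)
    linarith

/-- turning an `ℝ≥0∞` bound on the total error into a bound on the average error -/
lemma avg_le {k1 k2 : ℕ} (hk1 : 0 < k1) (hk2 : 0 < k2) {Z : Type*} [MeasurableSpace Z]
    (ν : Measure Z) [IsProbabilityMeasure ν] {S B : Fin k1 × Fin k2 → Set Z} {ε : ℝ} (hε : 0 ≤ ε)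
    (hS : ∀ m, S m ⊆ B m)
    (h : ∑ m, ν (B m) ≤ Fintype.card (Fin k1 × Fin k2) * ENNReal.ofReal ε) :
    (1 : ℝ) / ((k1 : ℝ) * (k2 : ℝ)) * ∑ m, (ν (S m)).toReal ≤ ε := by
  have hk1' : (0:ℝ) < k1 := by exact_mod_cast hk1
  have hk2' : (0:ℝ) < k2 := by exact_mod_cast hk2
  rw [one_div_mul_eq_div, div_le_iff₀ (by positivity)]
  have h1 : ∑ m, ν (S m) ≤ ENNReal.ofReal (k1 * k2 * ε) := by
    refine (Finset.sum_le_sum fun m _ => measure_mono (hS m)).trans (h.trans (le_of_eq ?_))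
    rw [ENNReal.ofReal_mul (by positivity)]
    congr 1
    rw [← Nat.cast_mul, ENNReal.ofReal_natCast]
    simp
  rw [← ENNReal.toReal_sum (fun m _ => measure_ne_top _ _)]
  refine ENNReal.toReal_le_of_le_ofReal (by positivity) (h1.trans (le_of_eq ?_))
  ring_nf

lemma ach2 {P : ℝ} {N1 N2 a : ℝ≥0} (hN1 : N1 ≠ 0) (hN2 : N2 ≠ 0) (ha : a ≠ 0) (haP : (a:ℝ) < P)
    {R : ℝ × ℝ} (h0 : 0 ≤ R.1) (h0' : 0 ≤ R.2)
    (h2 : R.2 * Real.log 2 < 1/2 * (Real.log (a + N2) - Real.log N2))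
    (h1 : (R.1 + R.2) * Real.log 2 < 1/2 * (Real.log (a + N1) - Real.log N1)) :
    gAch2 P N1 N2 R := by
  have ha' : (0:ℝ) ≤ a := a.2
  refine ⟨h0, h0', fun ε hε => ?_⟩
  have hε3 : (0:ℝ≥0∞) < ENNReal.ofReal (ε / 3) := ENNReal.ofReal_pos.2 (by positivity)
  obtain ⟨γ1, ev1⟩ := p2p ha hN1 h1 hε3
  obtain ⟨γ2, ev2⟩ := p2p ha hN2 h2 hε3
  have ev3 := (power_ev ha haP).eventually_lt_const hε3
  obtain ⟨n, hn, e1, e2, e3⟩ :=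
    ((Filter.eventually_gt_atTop 0).and (ev1.and (ev2.and ev3))).exists
  obtain ⟨hk1, hk1', hk1''⟩ := ceil_exp h0 hn
  obtain ⟨hk2, hk2', hk2''⟩ := ceil_exp h0' hn
  set k1 := ⌈Real.exp (n * (R.1 * Real.log 2))⌉₊ with hk1d
  set k2 := ⌈Real.exp (n * (R.2 * Real.log 2))⌉₊ with hk2d
  have : Nonempty (Fin k1) := ⟨⟨0, hk1⟩⟩
  have : Nonempty (Fin k2) := ⟨⟨0, hk2⟩⟩
  let Ω := Fin k1 × Fin k2 → Fin n → ℝ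
  let μ : Measure Ω := Measure.pi fun _ => gaussVec a n
  let x : Fin k1 × Fin k2 → Ω → Fin n → ℝ := fun m c => c m
  have hx : ∀ m, MeasurePreserving (x m) μ (gaussVec a n) := fun m =>
    measurePreserving_eval (fun _ : Fin k1 × Fin k2 => gaussVec a n) m
  have hxx : ∀ m' m, m' ≠ m → MeasurePreserving (fun ω => (x m' ω, x m ω)) μ
        ((gaussVec a n).prod (gaussVec a n)) := fun m' m h => mp_pair _ h
  let ν := (gaussVec N1 n).prod (gaussVec N2 n)
  -- bounds
  have b1 := e1 Ω (Fin k1 × Fin k2) μ x (by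
    rw [Fintype.card_prod, Fintype.card_fin, Fintype.card_fin, Nat.cast_mul]
    calc (k1:ℝ) * k2 ≤ (2 * Real.exp (n * (R.1 * Real.log 2))) *
          (2 * Real.exp (n * (R.2 * Real.log 2))) := by gcongr
      _ = 4 * (Real.exp (n * (R.1 * Real.log 2)) * Real.exp (n * (R.2 * Real.log 2))) := by ring
      _ = _ := by rw [← Real.exp_add]; ring_nf) hx hxx
  have b2 := fun m1 : Fin k1 => e2 Ω (Fin k2) μ (fun m2 => x (m1, m2)) (by
    rw [Fintype.card_fin]
    have := Real.exp_pos (n * (R.2 * Real.log 2))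
    linarith) (fun m => hx _) (fun m' m h => hxx _ _ (by simpa using h))
  let Φ1 : Ω × ((Fin n → ℝ) × (Fin n → ℝ)) → Ω × (Fin n → ℝ) := Prod.map id Prod.fst
  let Φ2 : Ω × ((Fin n → ℝ) × (Fin n → ℝ)) → Ω × (Fin n → ℝ) := Prod.map id Prod.snd
  have hΦ1 : MeasurePreserving Φ1 (μ.prod ν) (μ.prod (gaussVec N1 n)) :=
    (MeasurePreserving.id μ).prod measurePreserving_fst
  have hΦ2 : MeasurePreserving Φ2 (μ.prod ν) (μ.prod (gaussVec N2 n)) :=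
    (MeasurePreserving.id μ).prod measurePreserving_snd
  let Φ3 : Fin k1 × Fin k2 → Ω × ((Fin n → ℝ) × (Fin n → ℝ)) → (Fin n → ℝ) := fun m p => x m p.1
  have hΦ3 : ∀ m, MeasurePreserving (Φ3 m) (μ.prod ν) (gaussVec a n) := fun m =>
    (hx m).comp measurePreserving_fst
  let B : Fin k1 × Fin k2 → Set (Ω × ((Fin n → ℝ) × (Fin n → ℝ))) := fun m =>
    Φ1 ⁻¹' (bad a N1 γ1 x m) ∪ (Φ2 ⁻¹' (bad a N2 γ2 (fun m2 => x (m.1, m2)) m.2) ∪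
      Φ3 m ⁻¹' {z | ¬ ∑ t, z t ^ 2 ≤ n * P})
  have m1 : ∀ m, MeasurableSet (bad a N1 γ1 x m) :=
    measurableSet_bad a N1 γ1 (fun m => (hx m).measurable)
  have m2 : ∀ m : Fin k1 × Fin k2, MeasurableSet (bad a N2 γ2 (fun m2 => x (m.1, m2)) m.2) :=
    fun m => measurableSet_bad a N2 γ2 (fun m2 => (hx _).measurable) m.2
  have m3 : MeasurableSet {z : Fin n → ℝ | ¬ ∑ t, z t ^ 2 ≤ n * P} :=
    (measurableSet_le (f := fun z : Fin n → ℝ => ∑ t, z t ^ 2) (by fun_prop)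
      measurable_const).compl
  have hBm : ∀ m, MeasurableSet (B m) := fun m =>
    (hΦ1.measurable (m1 m)).union ((hΦ2.measurable (m2 m)).union ((hΦ3 m).measurable m3))
  have hBle : ∀ m, μ.prod ν (B m) ≤ ENNReal.ofReal ε := by
    intro m
    have hsum : ENNReal.ofReal ε = ENNReal.ofReal (ε/3) + (ENNReal.ofReal (ε/3) +
        ENNReal.ofReal (ε/3)) := by
      rw [← ENNReal.ofReal_add (by positivity) (by positivity),
        ← ENNReal.ofReal_add (by positivity) (by positivity)]
      congr 1; ring
    rw [hsum]
    refine (measure_union_le _ _).trans (add_le_add ?_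
      ((measure_union_le _ _).trans (add_le_add ?_ ?_)))
    · rw [hΦ1.measure_preimage (m1 m).nullMeasurableSet]
      exact b1 m
    · rw [hΦ2.measure_preimage (m2 m).nullMeasurableSet]
      exact b2 m.1 m.2
    · rw [(hΦ3 m).measure_preimage m3.nullMeasurableSet]
      exact e3.le
  obtain ⟨c, hc⟩ := select μ ν B hBm hBle
  refine ⟨n, k1, k2, hn, hk1, hk2, fun m => if ∑ t, c m t ^ 2 ≤ n * P then c m else 0,
    fun y => (dec a N1 γ1 c y).1, fun p => dec a N2 γ2 (fun m2 => c (p.2, m2)) p.1,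
    ?_, hk1', hk2', ?_⟩
  · intro m
    dsimp only
    split_ifs with h
    · exact h
    · have : 0 ≤ P := ha'.trans haP.le
      simp only [Pi.zero_apply]
      have : 0 ≤ (n:ℝ) * P := by positivity
      simpa using this
  · unfold gErrP2
    refine avg_le hk1 hk2 ν hε.le (fun m => ?_) hc
    intro z hz
    by_contra hcon
    apply hz
    have hcon' : (c, z) ∉ B m := hcon
    simp only [B, Set.mem_union, not_or, Set.mem_preimage] at hcon'
    obtain ⟨c1, c2, c3⟩ := hcon'
    have c3' : ∑ t, c m t ^ 2 ≤ n * P := by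
      by_contra hh; exact c3 hh
    have d1 := dec_eq c1
    have d2 := dec_eq c2
    simp only [if_pos c3']
    refine ⟨?_, ?_⟩
    · exact congrArg Prod.fst d1
    · exact d2

lemma ach0 {P : ℝ} {N1 N2 a b : ℝ≥0} (hN1 : N1 ≠ 0) (hN12 : N1 ≤ N2) (ha : a ≠ 0) (hb : b ≠ 0)
    (haP : (a:ℝ) + b < P)
    {R : ℝ × ℝ} (h0 : 0 ≤ R.1) (h0' : 0 ≤ R.2)
    (h1 : R.1 * Real.log 2 < 1/2 * (Real.log (b + N1) - Real.log N1))
    (h2 : R.2 * Real.log 2 < 1/2 * (Real.log (a + (b + N2)) - Real.log (b + N2))) :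
    gAch0 P N1 N2 R := by
  have ha' : (0:ℝ) < a := by exact_mod_cast pos_iff_ne_zero.mpr ha
  have hb' : (0:ℝ) < b := by exact_mod_cast pos_iff_ne_zero.mpr hb
  have hN12' : (N1:ℝ) ≤ N2 := by exact_mod_cast hN12
  have hN1' : (0:ℝ) ≤ N1 := N1.2
  have hab : a + b ≠ 0 := by simp [ha]
  have hbN1 : b + N1 ≠ 0 := by simp [hb]
  have hbN2 : b + N2 ≠ 0 := by simp [hb]
  have h3 : R.2 * Real.log 2 < 1/2 * (Real.log (a + (b + N1)) - Real.log (b + N1)) := by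
    refine h2.trans_le ?_
    have p1 : 0 < (b:ℝ) + N1 := by positivity
    have p2 : 0 < (b:ℝ) + N2 := by positivity
    rw [← Real.log_div (by positivity) (by positivity), ← Real.log_div (by positivity) (by positivity)]
    have : (a + (b + N2)) / ((b:ℝ) + N2) ≤ (a + (b + N1)) / ((b:ℝ) + N1) := by
      rw [div_le_div_iff₀ p2 p1]
      nlinarith
    have := Real.log_le_log (by positivity) this
    linarith
  refine ⟨h0, h0', fun ε hε => ?_⟩
  have hε4 : (0:ℝ≥0∞) < ENNReal.ofReal (ε / 4) := ENNReal.ofReal_pos.2 (by positivity)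
  obtain ⟨γ1, ev1⟩ := p2p hb hN1 h1 hε4
  obtain ⟨γ2, ev2⟩ := p2p ha hbN2 (by push_cast; exact h2) hε4
  obtain ⟨γ3, ev3⟩ := p2p ha hbN1 (by push_cast; exact h3) hε4
  have ev4 := (power_ev hab (by push_cast; exact haP)).eventually_lt_const hε4
  obtain ⟨n, hn, e1, e2, e3, e4⟩ :=
    ((Filter.eventually_gt_atTop 0).and (ev1.and (ev2.and (ev3.and ev4)))).exists
  obtain ⟨hk1, hk1', hk1''⟩ := ceil_exp h0 hn
  obtain ⟨hk2, hk2', hk2''⟩ := ceil_exp h0' hn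
  set k1 := ⌈Real.exp (n * (R.1 * Real.log 2))⌉₊ with hk1d
  set k2 := ⌈Real.exp (n * (R.2 * Real.log 2))⌉₊ with hk2d
  have : Nonempty (Fin k1) := ⟨⟨0, hk1⟩⟩
  have : Nonempty (Fin k2) := ⟨⟨0, hk2⟩⟩
  let ΩU := Fin k2 → Fin n → ℝ
  let ΩV := Fin k1 → Fin n → ℝ
  let μU : Measure ΩU := Measure.pi fun _ => gaussVec a n
  let μV : Measure ΩV := Measure.pi fun _ => gaussVec b n
  let u : Fin k2 → ΩU → Fin n → ℝ := fun m c => c m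
  let v : Fin k1 → ΩV → Fin n → ℝ := fun m c => c m
  have hu : ∀ m, MeasurePreserving (u m) μU (gaussVec a n) := fun m =>
    measurePreserving_eval (fun _ : Fin k2 => gaussVec a n) m
  have huu : ∀ m' m, m' ≠ m → MeasurePreserving (fun ω => (u m' ω, u m ω)) μU
        ((gaussVec a n).prod (gaussVec a n)) := fun m' m h => mp_pair _ h
  have hv : ∀ m, MeasurePreserving (v m) μV (gaussVec b n) := fun m =>
    measurePreserving_eval (fun _ : Fin k1 => gaussVec b n) m
  have hvv : ∀ m' m, m' ≠ m → MeasurePreserving (fun ω => (v m' ω, v m ω)) μV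
        ((gaussVec b n).prod (gaussVec b n)) := fun m' m h => mp_pair _ h
  let μ := μU.prod μV
  let ν := (gaussVec N1 n).prod (gaussVec N2 n)
  -- bounds
  have b1 := e1 ΩV (Fin k1) μV v (by
    rw [Fintype.card_fin]
    have := Real.exp_pos (n * (R.1 * Real.log 2))
    linarith) hv hvv
  have b2 := e2 ΩU (Fin k2) μU u (by
    rw [Fintype.card_fin]
    have := Real.exp_pos (n * (R.2 * Real.log 2))
    linarith) hu huu
  have b3 := e3 ΩU (Fin k2) μU u (by
    rw [Fintype.card_fin]
    have := Real.exp_pos (n * (R.2 * Real.log 2))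
    linarith) hu huu
  have hadd : ∀ p q : ℝ≥0, MeasurePreserving (fun p : (Fin n → ℝ) × (Fin n → ℝ) => p.1 + p.2)
      ((gaussVec p n).prod (gaussVec q n)) (gaussVec (p + q) n) := fun p q =>
    ⟨measurable_fst.add measurable_snd, gaussVec_add p q n⟩
  let Φ1 : (ΩU × ΩV) × ((Fin n → ℝ) × (Fin n → ℝ)) → ΩV × (Fin n → ℝ) := Prod.map Prod.snd Prod.fst
  have hΦ1 : MeasurePreserving Φ1 (μ.prod ν) (μV.prod (gaussVec N1 n)) :=
    measurePreserving_snd.prod measurePreserving_fst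
  let Φ2 : Fin k1 → (ΩU × ΩV) × ((Fin n → ℝ) × (Fin n → ℝ)) → ΩU × (Fin n → ℝ) :=
    fun m1 p => (p.1.1, v m1 p.1.2 + p.2.2)
  have hΦ2 : ∀ m1, MeasurePreserving (Φ2 m1) (μ.prod ν) (μU.prod (gaussVec (b + N2) n)) := by
    intro m1
    have f1 : MeasurePreserving (Prod.map id Prod.snd) (μ.prod ν) (μ.prod (gaussVec N2 n)) :=
      (MeasurePreserving.id μ).prod measurePreserving_snd
    have f2 := measurePreserving_prodAssoc μU μV (gaussVec N2 n)
    have f3 := (hadd b N2).comp ((hv m1).prod (MeasurePreserving.id (gaussVec N2 n)))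
    exact (((MeasurePreserving.id μU).prod f3).comp f2).comp f1
  let Φ3 : Fin k1 → (ΩU × ΩV) × ((Fin n → ℝ) × (Fin n → ℝ)) → ΩU × (Fin n → ℝ) :=
    fun m1 p => (p.1.1, v m1 p.1.2 + p.2.1)
  have hΦ3 : ∀ m1, MeasurePreserving (Φ3 m1) (μ.prod ν) (μU.prod (gaussVec (b + N1) n)) := by
    intro m1
    have f1 : MeasurePreserving (Prod.map id Prod.fst) (μ.prod ν) (μ.prod (gaussVec N1 n)) :=
      (MeasurePreserving.id μ).prod measurePreserving_fst
    have f2 := measurePreserving_prodAssoc μU μV (gaussVec N1 n)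
    have f3 := (hadd b N1).comp ((hv m1).prod (MeasurePreserving.id (gaussVec N1 n)))
    exact (((MeasurePreserving.id μU).prod f3).comp f2).comp f1
  let Φ4 : Fin k1 × Fin k2 → (ΩU × ΩV) × ((Fin n → ℝ) × (Fin n → ℝ)) → (Fin n → ℝ) :=
    fun m p => u m.2 p.1.1 + v m.1 p.1.2
  have hΦ4 : ∀ m, MeasurePreserving (Φ4 m) (μ.prod ν) (gaussVec (a + b) n) := fun m =>
    ((hadd a b).comp ((hu m.2).prod (hv m.1))).comp measurePreserving_fst
  let B : Fin k1 × Fin k2 → Set ((ΩU × ΩV) × ((Fin n → ℝ) × (Fin n → ℝ))) := fun m =>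
    Φ1 ⁻¹' (bad b N1 γ1 v m.1) ∪ (Φ2 m.1 ⁻¹' (bad a (b + N2) γ2 u m.2) ∪
      (Φ3 m.1 ⁻¹' (bad a (b + N1) γ3 u m.2) ∪ Φ4 m ⁻¹' {z | ¬ ∑ t, z t ^ 2 ≤ n * P}))
  have m1 : ∀ m, MeasurableSet (bad b N1 γ1 v m) :=
    measurableSet_bad b N1 γ1 (fun m => (hv m).measurable)
  have m2 : ∀ m, MeasurableSet (bad a (b + N2) γ2 u m) :=
    measurableSet_bad a _ γ2 (fun m => (hu m).measurable)
  have m3 : ∀ m, MeasurableSet (bad a (b + N1) γ3 u m) :=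
    measurableSet_bad a _ γ3 (fun m => (hu m).measurable)
  have m4 : MeasurableSet {z : Fin n → ℝ | ¬ ∑ t, z t ^ 2 ≤ n * P} :=
    (measurableSet_le (f := fun z : Fin n → ℝ => ∑ t, z t ^ 2) (by fun_prop)
      measurable_const).compl
  have hBm : ∀ m, MeasurableSet (B m) := fun m =>
    (hΦ1.measurable (m1 m.1)).union (((hΦ2 m.1).measurable (m2 m.2)).union
      (((hΦ3 m.1).measurable (m3 m.2)).union ((hΦ4 m).measurable m4)))
  have hBle : ∀ m, μ.prod ν (B m) ≤ ENNReal.ofReal ε := by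
    intro m
    have hsum : ENNReal.ofReal ε = ENNReal.ofReal (ε/4) + (ENNReal.ofReal (ε/4) +
        (ENNReal.ofReal (ε/4) + ENNReal.ofReal (ε/4))) := by
      rw [← ENNReal.ofReal_add (by positivity) (by positivity),
        ← ENNReal.ofReal_add (by positivity) (by positivity),
        ← ENNReal.ofReal_add (by positivity) (by positivity)]
      congr 1; ring
    rw [hsum]
    refine (measure_union_le _ _).trans (add_le_add ?_
      ((measure_union_le _ _).trans (add_le_add ?_
      ((measure_union_le _ _).trans (add_le_add ?_ ?_)))))
    · rw [hΦ1.measure_preimage (m1 m.1).nullMeasurableSet]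
      exact b1 m.1
    · rw [(hΦ2 m.1).measure_preimage (m2 m.2).nullMeasurableSet]
      exact b2 m.2
    · rw [(hΦ3 m.1).measure_preimage (m3 m.2).nullMeasurableSet]
      exact b3 m.2
    · rw [(hΦ4 m).measure_preimage m4.nullMeasurableSet]
      exact e4.le
  obtain ⟨⟨U, V⟩, hc⟩ := select μ ν B hBm hBle
  refine ⟨n, k1, k2, hn, hk1, hk2,
    fun m => if ∑ t, (U m.2 + V m.1) t ^ 2 ≤ n * P then U m.2 + V m.1 else 0,
    fun y => dec b N1 γ1 V (y - U (dec a (b + N1) γ3 U y)),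
    fun y => dec a (b + N2) γ2 U y,
    ?_, hk1', hk2', ?_⟩
  · intro m
    dsimp only
    split_ifs with h
    · exact h
    · have : 0 ≤ P := by linarith
      simp only [Pi.zero_apply]
      have : 0 ≤ (n:ℝ) * P := by positivity
      simpa using this
  · unfold gErrP0
    refine avg_le hk1 hk2 ν hε.le (fun m => ?_) hc
    intro z hz
    by_contra hcon
    apply hz
    have hcon' : ((U, V), z) ∉ B m := hcon
    simp only [B, Set.mem_union, not_or, Set.mem_preimage] at hcon'
    obtain ⟨c1, c2, c3, c4⟩ := hcon'
    have c4' : ∑ t, (U m.2 + V m.1) t ^ 2 ≤ n * P := by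
      by_contra hh; exact c4 hh
    have d1 : dec b N1 γ1 V (V m.1 + z.1) = m.1 := dec_eq (x := v) (ω := V) (w := z.1) c1
    have d2 : dec a (b + N2) γ2 U (U m.2 + (V m.1 + z.2)) = m.2 :=
      dec_eq (x := u) (ω := U) (w := V m.1 + z.2) c2
    have d3 : dec a (b + N1) γ3 U (U m.2 + (V m.1 + z.1)) = m.2 :=
      dec_eq (x := u) (ω := U) (w := V m.1 + z.1) c3
    simp only [if_pos c4']
    have s1 : (fun t => (U m.2 + V m.1) t + z.1 t) = U m.2 + (V m.1 + z.1) := by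
      ext t; simp [add_assoc]
    have s2 : (fun t => (U m.2 + V m.1) t + z.2 t) = U m.2 + (V m.1 + z.2) := by
      ext t; simp [add_assoc]
    rw [s1, s2, d3, add_sub_cancel_left]
    exact ⟨d1, d2⟩

lemma ach0_zero {P : ℝ} (hP : 0 ≤ P) (N1 N2 : ℝ≥0) : gAch0 P N1 N2 (0, 0) := by
  refine ⟨le_rfl, le_rfl, fun ε hε => ⟨1, 1, 1, one_pos, one_pos, one_pos, fun _ => 0, fun _ => 0,
    fun _ => 0, ?_, by simp, by simp, ?_⟩⟩
  · intro m; simpa using hP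
  · unfold gErrP0
    have : ∀ m : Fin 1 × Fin 1, {z : (Fin 1 → ℝ) × (Fin 1 → ℝ) |
        ¬ ((0 : Fin 1) = m.1 ∧ (0 : Fin 1) = m.2)} = ∅ := by
      intro m
      have : (0 : Fin 1) = m.1 ∧ (0 : Fin 1) = m.2 :=
        ⟨Subsingleton.elim _ _, Subsingleton.elim _ _⟩
      exact Set.eq_empty_of_forall_notMem fun z hz => hz this
    simp only [this]
    simpa using hε.le

lemma ach2_zero {P : ℝ} (hP : 0 ≤ P) (N1 N2 : ℝ≥0) : gAch2 P N1 N2 (0, 0) := by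
  refine ⟨le_rfl, le_rfl, fun ε hε => ⟨1, 1, 1, one_pos, one_pos, one_pos, fun _ => 0, fun _ => 0,
    fun _ => 0, ?_, by simp, by simp, ?_⟩⟩
  · intro m; simpa using hP
  · unfold gErrP2
    have : ∀ m : Fin 1 × Fin 1, {z : (Fin 1 → ℝ) × (Fin 1 → ℝ) |
        ¬ ((0 : Fin 1) = m.1 ∧ (0 : Fin 1) = m.2)} = ∅ := by
      intro m
      have : (0 : Fin 1) = m.1 ∧ (0 : Fin 1) = m.2 :=
        ⟨Subsingleton.elim _ _, Subsingleton.elim _ _⟩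
      exact Set.eq_empty_of_forall_notMem fun z hz => hz this
    simp only [this]
    simpa using hε.le

lemma region2_sub {P : ℝ} (hP : 0 ≤ P) {N1 N2 : ℝ≥0} (hN1 : N1 ≠ 0) (hN2 : N2 ≠ 0) :
    region2 P N1 N2 ⊆ gCap2 P N1 N2 := by
  have hN1' : (0:ℝ) < N1 := by exact_mod_cast pos_iff_ne_zero.mpr hN1
  have hN2' : (0:ℝ) < N2 := by exact_mod_cast pos_iff_ne_zero.mpr hN2
  have hl2 : 0 < Real.log 2 := Real.log_pos (by norm_num)
  rintro ⟨R1, R2⟩ ⟨h1, h2, h3, h4⟩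
  simp only at h1 h2 h3 h4
  rcases hP.eq_or_lt with rfl | hP
  · rw [zero_add, div_self (by positivity), Real.logb_one, mul_zero] at h3 h4
    have e2 : R2 = 0 := le_antisymm h3 h2
    have e1 : R1 = 0 := by linarith
    subst e1 e2
    exact subset_closure (ach2_zero le_rfl N1 N2)
  rw [le_logb_iff (by positivity) (by positivity)] at h3 h4
  have hg : ∀ N : ℝ, 0 < N → Filter.Tendsto (fun a : ℝ => 1/2 * (Real.log (a + N) - Real.log N))
      (nhdsWithin P (Set.Iio P)) (nhds (1/2 * (Real.log (P + N) - Real.log N))) := by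
    intro N hN
    refine Filter.Tendsto.mono_left ?_ nhdsWithin_le_nhds
    refine Filter.Tendsto.const_mul _ (Filter.Tendsto.sub_const ?_ _)
    exact Filter.Tendsto.log ((Filter.tendsto_id).add_const N) (by positivity)
  have hpos : ∀ N : ℝ, 0 < N → 0 < 1/2 * (Real.log (P + N) - Real.log N) := by
    intro N hN
    have := Real.log_lt_log hN (by linarith : N < P + N)
    linarith
  have hlam : ∀ l : ℝ, 0 < l → l < 1 → gAch2 P N1 N2 (l * R1, l * R2) := by
    intro l hl hl1
    have aux : ∀ A B : ℝ, A ≤ B → 0 < B → l * A < B := by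
      intro A B hAB hB
      calc l * A ≤ l * B := by gcongr
        _ < B := by nlinarith
    have s3 := aux _ _ h3 (hpos N2 hN2')
    have s4 := aux _ _ h4 (hpos N1 hN1')
    obtain ⟨a, ha, t3, t4⟩ := ((Filter.eventually_mem_set.2 (Ioo_mem_nhdsLT hP)).and
      (((hg N2 hN2').eventually_const_lt s3).and ((hg N1 hN1').eventually_const_lt s4))).exists
    refine ach2 (a := ⟨a, ha.1.le⟩) hN1 hN2 ?_ ha.2 (mul_nonneg hl.le h1) (mul_nonneg hl.le h2) ?_ ?_
    · exact fun h => ha.1.ne' (congrArg NNReal.toReal h)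
    · change l * R2 * Real.log 2 < 1/2 * (Real.log (a + N2) - Real.log N2)
      linarith
    · change (l * R1 + l * R2) * Real.log 2 < 1/2 * (Real.log (a + N1) - Real.log N1)
      linarith
  refine mem_closure_of_tendsto (b := nhdsWithin (1:ℝ) (Set.Iio 1))
    (f := fun l : ℝ => (l * R1, l * R2)) ?_ ?_
  · have : Filter.Tendsto (fun l : ℝ => (l * R1, l * R2)) (nhds 1) (nhds (1 * R1, 1 * R2)) :=
      Continuous.tendsto (by fun_prop) 1
    simp only [one_mul] at this
    exact this.mono_left nhdsWithin_le_nhds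
  · filter_upwards [Ioo_mem_nhdsLT (zero_lt_one (α := ℝ))] with l hl
    exact hlam l hl.1 hl.2

lemma region1_sub {P : ℝ} (hP : 0 ≤ P) {N1 N2 : ℝ≥0} (hN1 : N1 ≠ 0) (hN12 : N1 ≤ N2) :
    region1 P N1 N2 ⊆ gCap P N1 N2 := by
  have hN1' : (0:ℝ) < N1 := by exact_mod_cast pos_iff_ne_zero.mpr hN1
  have hN12' : (N1:ℝ) ≤ N2 := by exact_mod_cast hN12
  have hN2' : (0:ℝ) < N2 := by linarith
  have hl2 : 0 < Real.log 2 := Real.log_pos (by norm_num)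
  rintro ⟨R1, R2⟩ ⟨h1, h2, β, ⟨hβ0, hβ1⟩, h3, h4⟩
  simp only at h1 h2 h3 h4
  rcases hP.eq_or_lt with rfl | hP
  · rw [mul_zero, zero_add, div_self (by positivity), Real.logb_one, mul_zero] at h3 h4
    have e2 : R2 = 0 := le_antisymm h4 h2
    have e1 : R1 = 0 := le_antisymm h3 h1
    subst e1 e2
    exact subset_closure (ach0_zero le_rfl N1 N2)
  rw [le_logb_iff (by positivity) (by positivity)] at h3 h4
  let b : ℝ → ℝ := fun t => P * (1 - t) * ((1 - t) * β + t / 2)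
  let a : ℝ → ℝ := fun t => P * (1 - t) * ((1 - t) * (1 - β) + t / 2)
  have hab : ∀ t, a t + b t = P * (1 - t) := fun t => by simp only [a, b]; ring
  let F1 : ℝ → ℝ := fun t => 1/2 * (Real.log (b t + N1) - Real.log N1)
  let F2 : ℝ → ℝ := fun t => 1/2 * (Real.log (a t + (b t + N2)) - Real.log (b t + N2))
  have hb0 : b 0 = β * P := by simp only [b]; ring
  have ha0 : a 0 = P - β * P := by simp only [a]; ring
  have cb : Continuous b := by fun_prop
  have ca : Continuous a := by fun_prop
  have hF1 : ContinuousAt F1 0 := by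
    refine ContinuousAt.mul continuousAt_const (ContinuousAt.sub ?_ continuousAt_const)
    refine ContinuousAt.log (by fun_prop) ?_
    rw [hb0]; positivity
  have hF2 : ContinuousAt F2 0 := by
    refine ContinuousAt.mul continuousAt_const (ContinuousAt.sub ?_ ?_)
    · refine ContinuousAt.log (by fun_prop) ?_
      rw [hb0, ha0]
      have : P - β * P + (β * P + N2) = P + N2 := by ring
      rw [this]; positivity
    · refine ContinuousAt.log (by fun_prop) ?_
      rw [hb0]; positivity
  have h3' : R1 * Real.log 2 ≤ F1 0 := by simp only [F1, hb0]; exact h3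
  have h4' : R2 * Real.log 2 ≤ F2 0 := by
    simp only [F2, hb0, ha0]
    rw [show P - β * P + (β * P + N2) = P + N2 by ring]
    exact h4
  let r : ℝ → ℝ × ℝ := fun t => (max 0 (R1 - (F1 0 - F1 t) / Real.log 2 - t),
    max 0 (R2 - (F2 0 - F2 t) / Real.log 2 - t))
  have hr : ContinuousAt r 0 := by
    refine ContinuousAt.prodMk ?_ ?_
    · exact ContinuousAt.sup continuousAt_const ((continuousAt_const.sub
        ((continuousAt_const.sub hF1).div_const _)).sub continuousAt_id)
    · exact ContinuousAt.sup continuousAt_const ((continuousAt_const.sub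
        ((continuousAt_const.sub hF2).div_const _)).sub continuousAt_id)
  have hr0 : r 0 = (R1, R2) := by simp [r, h1, h2]
  refine mem_closure_of_tendsto (b := nhdsWithin (0:ℝ) (Set.Ioi 0)) (f := r) ?_ ?_
  · rw [← hr0]
    exact hr.tendsto.mono_left nhdsWithin_le_nhds
  · filter_upwards [Ioo_mem_nhdsGT (zero_lt_one (α := ℝ))] with t ht
    have ht0 := ht.1
    have ht1 : 0 < 1 - t := by linarith [ht.2]
    have hb : 0 < b t := by
      have : 0 ≤ (1 - t) * β := by positivity
      simp only [b]; positivity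
    have ha : 0 < a t := by
      have : 0 ≤ (1 - t) * (1 - β) := mul_nonneg ht1.le (by linarith)
      simp only [a]; positivity
    have pF1 : 0 < F1 t := by
      have := Real.log_lt_log hN1' (by linarith : (N1:ℝ) < b t + N1)
      simp only [F1]; linarith
    have pF2 : 0 < F2 t := by
      have := Real.log_lt_log (by positivity : 0 < b t + N2) (by linarith : b t + N2 < a t + (b t + N2))
      simp only [F2]; linarith
    have aux : ∀ A F0 F : ℝ, A * Real.log 2 ≤ F0 → 0 < F →
        max 0 (A - (F0 - F) / Real.log 2 - t) * Real.log 2 < F := by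
      intro A F0 F hA hF
      rcases max_cases 0 (A - (F0 - F) / Real.log 2 - t) with h | h
      · rw [h.1]; linarith
      · rw [h.1]
        have : (A - (F0 - F) / Real.log 2 - t) * Real.log 2 = A * Real.log 2 - (F0 - F)
          - t * Real.log 2 := by field_simp
        rw [this]
        have : 0 < t * Real.log 2 := by positivity
        linarith
    refine ach0 (a := ⟨a t, ha.le⟩) (b := ⟨b t, hb.le⟩) hN1 hN12 ?_ ?_ ?_ (le_max_left _ _)
      (le_max_left _ _) (aux _ _ _ h3' pF1) (aux _ _ _ h4' pF2)
    · exact fun h => ha.ne' (congrArg NNReal.toReal h)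
    · exact fun h => hb.ne' (congrArg NNReal.toReal h)
    · change a t + b t < P
      rw [hab]
      nlinarith

/-- **Proposition 8.** Capacity regions of the scalar Gaussian broadcast channel
`G-BC(P,N₁,N₂)` with `0 < N₁ ≤ N₂`, with and without receiver side information. -/
theorem gbc_capacity_regions
    (P : ℝ) (hP : 0 ≤ P) (N1 N2 : ℝ≥0) (hN1 : 0 < N1) (hN12 : N1 ≤ N2) :
    gCap1 P N1 N2 = gCap P N1 N2 ∧
    gCap P N1 N2 = {R : ℝ × ℝ | 0 ≤ R.1 ∧ 0 ≤ R.2 ∧ ∃ β ∈ Set.Icc (0:ℝ) 1,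
      R.1 ≤ (1/2) * Real.logb 2 ((β * P + N1) / N1) ∧
      R.2 ≤ (1/2) * Real.logb 2 ((P + N2) / (β * P + N2))} ∧
    gCap2 P N1 N2 = {R : ℝ × ℝ | 0 ≤ R.1 ∧ 0 ≤ R.2 ∧
      R.2 ≤ (1/2) * Real.logb 2 ((P + N2) / N2) ∧
      R.1 + R.2 ≤ (1/2) * Real.logb 2 ((P + N1) / N1)} := by
  obtain ⟨s, rfl⟩ := exists_add_of_le hN12
  have h1 := gCap_sub_gCap1 P N1 (N1 + s)
  have h2 := gCap1_sub (s := s) hP hN1.ne'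
  have h3 := region1_sub hP hN1.ne' hN12
  have hN2 : N1 + s ≠ 0 := by simp [hN1.ne']
  refine ⟨(h2.trans h3).antisymm h1, (h1.trans h2).antisymm h3, ?_⟩
  exact (gCap2_sub hP hN1.ne').antisymm (region2_sub hP hN1.ne' hN2)

end
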